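/- There exists a universal constant C > 0 such that for every quasisymmetric homeomorphism φ of ℝP¹, the minimal Lagrangian extension Φ_ML: ℍ² → ℍ² of φ has maximal dilatation K(Φ_ML) satisfying ln K(Φ_ML) ≤ C · ‖φ‖_cr. -/

import Mathlib

/-!
Common framework for formalizing "Maximal surfaces in Anti-de Sitter space, width of
convex hulls and quasiconformal extensions of quasisymmetric homeomorphisms" (A. Seppi).

Anti-de Sitter space is modeled projectively: `qform` is the bilinear form of
signature (2,2) on ℝ⁴, `AdS3` is the projectivization of its negative cone,
and spacelike surfaces are recorded through (lifts of) smooth spacelike embeddings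
of ℝ² into the quadric {⟨x,x⟩ = -1} (the double cover of AdS³), together with a
future-directed unit normal field and the associated shape operator.
-/

noncomputable section

open Real Set Filter Topology

namespace AdSPaper

/-- The bilinear form of signature `(2,2)` on `ℝ⁴`. -/
def qform (x y : Fin 4 → ℝ) : ℝ :=
  x 0 * y 0 + x 1 * y 1 - x 2 * y 2 - x 3 * y 3

/-- Quotient topology on a projectivization. -/
instance (K V : Type*) [DivisionRing K] [AddCommGroup V] [Module K V] [TopologicalSpace V] :
    TopologicalSpace (Projectivization K V) := by
  unfold Projectivization
  infer_instance

/-- Real projective 3-space. -/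
abbrev RP3 := Projectivization ℝ (Fin 4 → ℝ)

/-- The real projective line. -/
abbrev RP1 := Projectivization ℝ (Fin 2 → ℝ)

/-- The point of `ℝP³` determined by a nonzero vector of `ℝ⁴`. -/
def projPt (x : Fin 4 → ℝ) (hx : x ≠ 0) : RP3 := Projectivization.mk ℝ x hx

/-- Anti-de Sitter space: the projectivization of the negative cone of `qform`.
(The sign of `qform x x` does not depend on the chosen representative.) -/
def AdS3 : Set RP3 := {P | qform P.rep P.rep < 0}

/-- The boundary at infinity of Anti-de Sitter space: the projectivization of the null cone. -/
def bdryAdS3 : Set RP3 := {P | qform P.rep P.rep = 0}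

/-- The nonzero lifts of a subset of `ℝP³`. -/
def lifts (Γ : Set RP3) : Set (Fin 4 → ℝ) :=
  {x | ∃ hx : x ≠ 0, projPt x hx ∈ Γ}

/-- The (projective) convex hull of a set `Γ ⊆ ℝP³` contained in an affine chart:
the image of the convex hull of a coherent family of lifts of `Γ`, chosen on the positive
side of a linear hyperplane avoiding all lifts of `Γ` (i.e. an affine chart containing `Γ`). -/
def projConvexHull (Γ : Set RP3) : Set RP3 :=
  {P | ∃ L : (Fin 4 → ℝ) →ₗ[ℝ] ℝ, (∀ x ∈ lifts Γ, L x ≠ 0) ∧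
      ∃ (y : Fin 4 → ℝ) (hy : y ≠ 0), projPt y hy = P ∧
        y ∈ convexHull ℝ {x | x ∈ lifts Γ ∧ 0 < L x}}

/-- The width of (the convex hull of) a set `Γ ⊆ ℝP³`: the supremum of the lengths of
timelike geodesic segments `t ↦ [cos t • a + sin t • b]` contained in the convex hull of `Γ`. -/
def width (Γ : Set RP3) : ℝ :=
  sSup {T : ℝ | 0 ≤ T ∧ T < π ∧ ∃ a b : Fin 4 → ℝ,
      qform a a = -1 ∧ qform b b = -1 ∧ qform a b = 0 ∧
      ∀ t ∈ Icc (0 : ℝ) T, ∃ h : (Real.cos t • a + Real.sin t • b) ≠ 0,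
        projPt (Real.cos t • a + Real.sin t • b) h ∈ projConvexHull Γ}

/-- Inverse hyperbolic cosine. -/
def arcosh (x : ℝ) : ℝ := Real.log (x + Real.sqrt (x ^ 2 - 1))

/-! ### The projective line, cross-ratios and quasisymmetric homeomorphisms -/

/-- Determinant of a pair of vectors of ℝ². -/
def det2 (v w : Fin 2 → ℝ) : ℝ := v 0 * w 1 - v 1 * w 0

/-- The cross-ratio of a quadruple of points of `ℝP¹`, with the convention
`cr(z₁,z₂,z₃,z₄) = (z₄−z₁)(z₃−z₂)/((z₂−z₁)(z₃−z₄))`.  (The expression below is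
invariant under rescaling of each of the four representatives.) -/
def crossRatio (z₁ z₂ z₃ z₄ : RP1) : ℝ :=
  (det2 z₄.rep z₁.rep * det2 z₃.rep z₂.rep) / (det2 z₂.rep z₁.rep * det2 z₃.rep z₄.rep)

/-- The cyclic orientation invariant of a triple of points of `ℝP¹`
(for finite points `a,b,c` it equals `(a−b)(b−c)(c−a)` and its sign is scale invariant). -/
def tripleOrient (a b c : RP1) : ℝ :=
  det2 a.rep b.rep * det2 b.rep c.rep * det2 c.rep a.rep

/-- A map of `ℝP¹` is orientation-preserving if it preserves the cyclic orientation
of triples of points. -/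
def OrientationPreserving (φ : RP1 → RP1) : Prop :=
  ∀ a b c : RP1, 0 < tripleOrient a b c → 0 < tripleOrient (φ a) (φ b) (φ c)

/-- The set of cross-ratio distortions `|ln |cr(φ(Q))||` of symmetric quadruples
(`cr(Q) = -1`) under the map `φ`. -/
def crSet (φ : RP1 → RP1) : Set ℝ :=
  {r | ∃ z₁ z₂ z₃ z₄ : RP1, crossRatio z₁ z₂ z₃ z₄ = -1 ∧
      r = |Real.log (abs (crossRatio (φ z₁) (φ z₂) (φ z₃) (φ z₄)))|}

/-- The cross-ratio norm `‖φ‖_cr` of a circle map `φ`. -/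
def crNorm (φ : RP1 → RP1) : ℝ := sSup (crSet φ)

/-- A quasisymmetric homeomorphism of `ℝP¹`: an orientation-preserving homeomorphism
with finite cross-ratio norm. -/
def Quasisymmetric (φ : RP1 ≃ₜ RP1) : Prop :=
  OrientationPreserving ⇑φ ∧ BddAbove (crSet ⇑φ)

/-- The null vector of ℝ^{2,2} corresponding to the pair of lines `([v],[w]) ∈ ℝP¹ × ℝP¹`
under the standard identification of `∂∞AdS³` with `ℝP¹ × ℝP¹` (via the rank-one
2×2 matrix `v wᵀ`, identifying ℝ^{2,2} with 2×2 matrices with minus the determinant). -/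
def toBoundary (v w : Fin 2 → ℝ) : Fin 4 → ℝ :=
  ![(v 0 * w 0 - v 1 * w 1) / 2, (v 0 * w 1 + v 1 * w 0) / 2,
    (v 0 * w 0 + v 1 * w 1) / 2, (v 0 * w 1 - v 1 * w 0) / 2]

/-- The graph `gr(φ)` of a map `φ : ℝP¹ → ℝP¹`, as a curve in `∂∞AdS³ ⊆ ℝP³`. -/
def grGraph (φ : RP1 → RP1) : Set RP3 :=
  {P | ∃ (v w : Fin 2 → ℝ) (hv : v ≠ 0) (hw : w ≠ 0) (hx : toBoundary v w ≠ 0),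
      projPt (toBoundary v w) hx = P ∧
      φ (Projectivization.mk ℝ v hv) = Projectivization.mk ℝ w hw}

/-! ### Spacelike and maximal surfaces in AdS³ -/

/-- The global timelike vector field `x ↦ (0,0,−x₄,x₃)` on the quadric, fixing the
time orientation of AdS³. -/
def timeVec (x : Fin 4 → ℝ) : Fin 4 → ℝ := ![0, 0, -(x 3), x 2]

/-- A (lifted, parametrized) smooth spacelike embedded disc in AdS³: a smooth embedding
of ℝ² into the quadric `{⟨x,x⟩ = −1} ⊆ ℝ^{2,2}` (the double cover of AdS³), with spacelike
first fundamental form, together with its future-directed unit normal field and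
the associated shape operator `B = ∇N`. -/
structure SpacelikeSurface where
  /-- the embedding of ℝ² into the quadric -/
  emb : (Fin 2 → ℝ) → (Fin 4 → ℝ)
  /-- the future-directed unit normal vector field -/
  normal : (Fin 2 → ℝ) → (Fin 4 → ℝ)
  /-- the shape operator, in the coordinates of the parametrization -/
  shape : (Fin 2 → ℝ) → ((Fin 2 → ℝ) →ₗ[ℝ] (Fin 2 → ℝ))
  smooth_emb : ContDiff ℝ (⊤ : ℕ∞) emb
  smooth_normal : ContDiff ℝ (⊤ : ℕ∞) normal
  inj : Function.Injective emb
  on_quadric : ∀ y, qform (emb y) (emb y) = -1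
  spacelike : ∀ y v, v ≠ 0 → 0 < qform (fderiv ℝ emb y v) (fderiv ℝ emb y v)
  normal_unit : ∀ y, qform (normal y) (normal y) = -1
  normal_orth_base : ∀ y, qform (normal y) (emb y) = 0
  normal_orth : ∀ y v, qform (normal y) (fderiv ℝ emb y v) = 0
  normal_future : ∀ y, qform (normal y) (timeVec (emb y)) < 0
  shape_spec : ∀ y v, fderiv ℝ normal y v = fderiv ℝ emb y (shape y v)

namespace SpacelikeSurface

variable (S : SpacelikeSurface)

/-- A spacelike surface is maximal if its shape operator is traceless. -/
def IsMaximal : Prop := ∀ y, LinearMap.trace ℝ (Fin 2 → ℝ) (S.shape y) = 0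

/-- The surface as a subset of `ℝP³` (i.e. of AdS³). -/
def proj : Set RP3 :=
  {P | ∃ (y : Fin 2 → ℝ) (h : S.emb y ≠ 0), projPt (S.emb y) h = P}

/-- The asymptotic boundary `∂∞S` of the surface: the frontier `closure S \ S`. -/
def bdryAtInfinity : Set RP3 := closure S.proj \ S.proj

/-- The surface is entire if its frontier is contained in the boundary at
infinity of AdS³. -/
def IsEntire : Prop := S.bdryAtInfinity ⊆ bdryAdS3

/-- The nonnegative principal curvature `λ` at a point: for a maximal surface the
principal curvatures are `±λ` with `λ = √(−det B)`. -/
def lambdaAt (y : Fin 2 → ℝ) : ℝ := Real.sqrt (-(LinearMap.det (S.shape y)))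

/-- The supremum `‖λ‖∞` of the principal curvatures of the surface. -/
def lambdaSup : ℝ := ⨆ y, S.lambdaAt y

/-- Nonpositive curvature: by the Gauss equation `K = −1 + λ²`, this is `λ ≤ 1`. -/
def NonpositiveCurvature : Prop := ∀ y, S.lambdaAt y ≤ 1

/-- Uniformly negative curvature: `λ ≤ 1 − ε` for some `ε > 0`. -/
def UniformlyNegativeCurvature : Prop := ∃ ε > 0, ∀ y, S.lambdaAt y ≤ 1 - ε

/-- The set of non-umbilical points of a maximal surface (where `λ ≠ 0`). -/
def nonUmbilic : Set (Fin 2 → ℝ) := {y | LinearMap.det (S.shape y) ≠ 0}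

/-- The intrinsic distance of the induced Riemannian metric on the surface. -/
def idist (y₁ y₂ : Fin 2 → ℝ) : ℝ :=
  sInf {L | ∃ c : ℝ → (Fin 2 → ℝ), ContDiff ℝ (⊤ : ℕ∞) c ∧ c 0 = y₁ ∧ c 1 = y₂ ∧
      L = ∫ t in (0:ℝ)..(1:ℝ),
        Real.sqrt (qform (deriv (fun s => S.emb (c s)) t) (deriv (fun s => S.emb (c s)) t))}

/-- `F` is the intrinsic gradient field of the function `f` on `U ⊆ S`: the vector field
which is `I`-dual to the differential of `f`. -/
def IsGradientOn (U : Set (Fin 2 → ℝ)) (f : (Fin 2 → ℝ) → ℝ)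
    (F : (Fin 2 → ℝ) → (Fin 2 → ℝ)) : Prop :=
  ∀ y ∈ U, ∀ v, qform (fderiv ℝ S.emb y (F y)) (fderiv ℝ S.emb y v) = fderiv ℝ f y v

/-- `H` is the intrinsic Hessian (as a (1,1)-tensor) of a function with gradient field `F`
on `U ⊆ S`: the tangential part of the ambient flat derivative of the ambient gradient
field (the normal part, in the ambient coordinates, lies in `span{σ(y), N(y)}`). -/
def IsHessianOn (U : Set (Fin 2 → ℝ)) (F : (Fin 2 → ℝ) → (Fin 2 → ℝ))
    (H : (Fin 2 → ℝ) → ((Fin 2 → ℝ) →ₗ[ℝ] (Fin 2 → ℝ))) : Prop :=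
  ∀ y ∈ U, ∀ v, ∃ a b : ℝ,
    fderiv ℝ (fun y' => fderiv ℝ S.emb y' (F y')) y v
      = fderiv ℝ S.emb y (H y v) + a • S.emb y + b • S.normal y

/-- The squared norm `‖grad f‖²` of a gradient field `F`, for the induced metric. -/
def gradNormSq (F : (Fin 2 → ℝ) → (Fin 2 → ℝ)) (y : Fin 2 → ℝ) : ℝ :=
  qform (fderiv ℝ S.emb y (F y)) (fderiv ℝ S.emb y (F y))

/-- `Δf` is the Laplace–Beltrami operator of the induced metric applied to `f`, on `U`:
the trace of the intrinsic Hessian. -/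
def IsLaplacianOn (U : Set (Fin 2 → ℝ)) (f Δf : (Fin 2 → ℝ) → ℝ) : Prop :=
  ∃ F H, S.IsGradientOn U f F ∧ S.IsHessianOn U F H ∧
    ∀ y ∈ U, Δf y = LinearMap.trace ℝ (Fin 2 → ℝ) (H y)

/-- `c` parametrizes an intrinsic geodesic of the surface: the ambient acceleration
is orthogonal to the surface, i.e. lies in `span{σ(c t), N(c t)}`. -/
def IsIntrinsicGeodesic (c : ℝ → (Fin 2 → ℝ)) : Prop :=
  ∀ t, ∃ a b : ℝ,
    deriv (deriv (fun s => S.emb (c s))) t = a • S.emb (c t) + b • S.normal (c t)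

/-- `E` is a system of normal coordinates for the surface centered at `y₀` (i.e. the
exponential map of the induced metric at that point, read in an orthonormal frame). -/
def IsNormalCoordsAt (y₀ : Fin 2 → ℝ) (E : (Fin 2 → ℝ) → (Fin 2 → ℝ)) : Prop :=
  E 0 = y₀ ∧ (∀ v, S.IsIntrinsicGeodesic (fun t => E (t • v))) ∧
  ∀ v w : Fin 2 → ℝ,
    qform (deriv (fun t : ℝ => S.emb (E (t • v))) 0) (deriv (fun t : ℝ => S.emb (E (t • w))) 0)
      = v 0 * w 0 + v 1 * w 1

end SpacelikeSurface

/-- The normal flow at time `ρ`: the parametrization of the surface `S_ρ` at constant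
timelike distance `ρ` from `S`. -/
def parallelEmb (S : SpacelikeSurface) (ρ : ℝ) : (Fin 2 → ℝ) → (Fin 4 → ℝ) :=
  fun y => Real.cos ρ • S.emb y + Real.sin ρ • S.normal y

/-- The pull-back to `S` of the first fundamental form of the parallel surface `S_ρ`. -/
def Irho (S : SpacelikeSurface) (ρ : ℝ) (y : Fin 2 → ℝ) (v w : Fin 2 → ℝ) : ℝ :=
  qform (fderiv ℝ (parallelEmb S ρ) y v) (fderiv ℝ (parallelEmb S ρ) y w)

/-- The second fundamental form of the parallel surface `S_ρ`, via `II_ρ = ½ dI_ρ/dρ`. -/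
def IIrho (S : SpacelikeSurface) (ρ : ℝ) (y : Fin 2 → ℝ) (v w : Fin 2 → ℝ) : ℝ :=
  (1 / 2) * deriv (fun ρ' => Irho S ρ' y v w) ρ

/-! ### Euclidean balls and `C⁰`/`C²` norms on ℝ² -/

/-- The Euclidean ball of radius `r` centered at the origin of ℝ². -/
def eball (r : ℝ) : Set (Fin 2 → ℝ) := {z | Real.sqrt ((z 0) ^ 2 + (z 1) ^ 2) < r}

/-- The `C⁰` norm of a function on the Euclidean ball of radius `r`. -/
def C0norm (u : (Fin 2 → ℝ) → ℝ) (r : ℝ) : ℝ :=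
  sSup {a | ∃ z ∈ eball r, a = |u z|}

/-- The `C²` norm of a function on the Euclidean ball of radius `r`. -/
def C2norm (u : (Fin 2 → ℝ) → ℝ) (r : ℝ) : ℝ :=
  sSup {a | ∃ z ∈ eball r, a = |u z| + ‖fderiv ℝ u z‖ + ‖fderiv ℝ (fderiv ℝ u) z‖}

end AdSPaper
/-! ### The hyperbolic plane, quasiconformal dilatation and minimal Lagrangian maps -/

namespace AdSPaper

/-- The upper half-plane model of ℍ², as a subset of ℂ. -/
def Hset : Set ℂ := {z | 0 < z.im}

/-- The real inner product on ℂ ≅ ℝ². -/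
def rinner (v w : ℂ) : ℝ := v.re * w.re + v.im * w.im

/-- The Christoffel bilinear form of the hyperbolic metric `(dx² + dy²)/y²` on the
upper half-plane: `Γ_z(v,w) = (i / Im z) · (v·w)` (complex multiplication). -/
def Gamma (z v w : ℂ) : ℂ := (Complex.I / (z.im : ℂ)) * (v * w)

/-- The quasiconformal dilatation of a map `Φ` at the point `z`: the ratio between the
major and the minor axis of the image of a unit circle under the differential of `Φ`. -/
def dilatationAt (Φ : ℂ → ℂ) (z : ℂ) : ℝ :=
  (⨆ v : {v : ℂ // ‖v‖ = 1}, ‖fderiv ℝ Φ z (v : ℂ)‖) /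
    (⨅ v : {v : ℂ // ‖v‖ = 1}, ‖fderiv ℝ Φ z (v : ℂ)‖)

/-- The maximal dilatation `K(Φ)` of a map of the upper half-plane. -/
def maxDilatation (Φ : ℂ → ℂ) : ℝ := ⨆ z : Hset, dilatationAt Φ (z : ℂ)

/-- `Φ` is a minimal Lagrangian diffeomorphism of ℍ² (upper half-plane model): a smooth
diffeomorphism of ℍ² which is area-preserving and whose graph is minimal in ℍ² × ℍ²;
equivalently (Bonsante–Schlenker, Prop. 1.2.6 of Toulisse), `Φ*g = g(b·,b·)` for a
self-adjoint, `det = 1`, Codazzi bundle morphism `b`. -/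
def IsMinimalLagrangian (Φ : ℂ → ℂ) : Prop :=
  ContDiffOn ℝ (⊤ : ℕ∞) Φ Hset ∧ Set.BijOn Φ Hset Hset ∧
  (∃ Ψ : ℂ → ℂ, ContDiffOn ℝ (⊤ : ℕ∞) Ψ Hset ∧ Set.InvOn Ψ Φ Hset Hset) ∧
  ∃ b : ℂ → (ℂ →L[ℝ] ℂ),
    (∀ z ∈ Hset, ∀ v w : ℂ, rinner (b z v) w = rinner v (b z w)) ∧
    (∀ z ∈ Hset, LinearMap.det ((b z : ℂ →L[ℝ] ℂ) : ℂ →ₗ[ℝ] ℂ) = 1) ∧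
    (∀ z ∈ Hset, ∀ v w : ℂ,
      rinner (fderiv ℝ Φ z v) (fderiv ℝ Φ z w) / (Φ z).im ^ 2
        = rinner (b z v) (b z w) / z.im ^ 2) ∧
    (∀ z ∈ Hset, ∀ v w : ℂ,
      fderiv ℝ (fun u => b u w) z v + Gamma z v (b z w) - b z (Gamma z v w)
        = fderiv ℝ (fun u => b u v) z w + Gamma z w (b z v) - b z (Gamma z w v))

/-- The point of the boundary `∂ℍ² = ℝ ∪ {∞}` of the upper half-plane (inside the
Riemann sphere `ℂ ∪ {∞}`) corresponding to a point of `ℝP¹`. -/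
def rp1ToSphere (ξ : RP1) : OnePoint ℂ :=
  if ξ.rep 1 = 0 then OnePoint.infty
  else OnePoint.some ((ξ.rep 0 / ξ.rep 1 : ℝ) : ℂ)

/-- `Φ : ℍ² → ℍ²` extends the circle map `φ : ℝP¹ → ℝP¹`: at every boundary point `ξ`,
`Φ(z) → φ(ξ)` as `z → ξ` from inside the upper half-plane (in the Riemann sphere). -/
def ExtendsToBoundary (Φ : ℂ → ℂ) (φ : RP1 → RP1) : Prop :=
  ∀ ξ : RP1, Filter.Tendsto (fun z => OnePoint.some (Φ z))
      ((Filter.comap OnePoint.some (nhds (rp1ToSphere ξ))) ⊓ Filter.principal Hset)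
      (nhds (rp1ToSphere (φ ξ)))

/-- `Φ` is the (unique) minimal Lagrangian extension of the quasisymmetric
homeomorphism `φ` of `ℝP¹`. -/
def IsMinimalLagrangianExtension (Φ : ℂ → ℂ) (φ : RP1 → RP1) : Prop :=
  IsMinimalLagrangian Φ ∧ ExtendsToBoundary Φ φ

end AdSPaper

namespace AdSPaper

noncomputable section

open Real Set Filter Topology ComplexConjugate

section

/-! ### Moving frames on the upper half-plane -/

open ComplexConjugate in
/-- The complex coframe `v ↦ (v + t v̄) / (y (1 - |t|²))` attached to a field `t`. -/
def coframe (t : ℂ → ℂ) (z : ℂ) : ℂ →L[ℝ] ℂ :=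
  (((z.im : ℂ) * (1 - t z * conj (t z)))⁻¹) •
    (ContinuousLinearMap.id ℝ ℂ + t z • (Complex.conjCLE : ℂ →L[ℝ] ℂ))

/-- The differential of `f` at `z` has components `p`, `q` in the coframe and its conjugate. -/
def HasDD (t : ℂ → ℂ) (f : ℂ → ℂ) (z p q : ℂ) : Prop :=
  HasFDerivAt f (p • coframe t z + q • ((Complex.conjCLE : ℂ →L[ℝ] ℂ).comp (coframe t z))) z

/-- The real function `f` has gradient `g` at `z` for the metric defined by the coframe. -/
def HasGrad (t : ℂ → ℂ) (f : ℂ → ℝ) (z g : ℂ) : Prop :=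
  HasFDerivAt f (Complex.reCLM.comp (g • coframe t z)) z


variable {t : ℂ → ℂ} {z : ℂ}

lemma coframe_apply (t : ℂ → ℂ) (z v : ℂ) :
    coframe t z v = (v + t z * conj v) / ((z.im : ℂ) * (1 - t z * conj (t z))) := by
  simp [coframe, div_eq_inv_mul, mul_add]

lemma HasDD.add {f g : ℂ → ℂ} {p q p' q' : ℂ} (hf : HasDD t f z p q) (hg : HasDD t g z p' q') :
    HasDD t (fun x => f x + g x) z (p + p') (q + q') := by
  refine (HasFDerivAt.add hf hg).congr_fderiv ?_
  ext <;> simp <;> ring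

lemma HasDD.sub {f g : ℂ → ℂ} {p q p' q' : ℂ} (hf : HasDD t f z p q) (hg : HasDD t g z p' q') :
    HasDD t (fun x => f x - g x) z (p - p') (q - q') := by
  refine (HasFDerivAt.sub hf hg).congr_fderiv ?_
  ext <;> simp <;> ring

lemma HasDD.neg {f : ℂ → ℂ} {p q : ℂ} (hf : HasDD t f z p q) :
    HasDD t (fun x => - f x) z (-p) (-q) := by
  refine (HasFDerivAt.neg hf).congr_fderiv ?_
  ext <;> simp <;> ring

lemma HasDD.mul {f g : ℂ → ℂ} {p q p' q' : ℂ} (hf : HasDD t f z p q) (hg : HasDD t g z p' q') :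
    HasDD t (fun x => f x * g x) z (p * g z + f z * p') (q * g z + f z * q') := by
  refine (HasFDerivAt.mul hf hg).congr_fderiv ?_
  ext <;> simp <;> ring

lemma hasDD_const (c : ℂ) : HasDD t (fun _ => c) z 0 0 := by
  refine (hasFDerivAt_const c z).congr_fderiv ?_
  ext <;> simp

lemma HasDD.const_mul {f : ℂ → ℂ} {p q : ℂ} (c : ℂ) (hf : HasDD t f z p q) :
    HasDD t (fun x => c * f x) z (c * p) (c * q) := by
  have := (hasDD_const (t := t) (z := z) c).mul hf
  simpa using this

lemma HasDD.conj {f : ℂ → ℂ} {p q : ℂ} (hf : HasDD t f z p q) :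
    HasDD t (fun x => conj (f x)) z (conj q) (conj p) := by
  refine ((Complex.conjCLE : ℂ →L[ℝ] ℂ).hasFDerivAt.comp z hf).congr_fderiv ?_
  ext <;> simp <;> ring

lemma HasDD.comp {f h : ℂ → ℂ} {p q d : ℂ} (hf : HasDD t f z p q) (hh : HasDerivAt h d (f z)) :
    HasDD t (fun x => h (f x)) z (d * p) (d * q) := by
  have h1 := (hh.hasFDerivAt.restrictScalars ℝ).comp z hf
  refine h1.congr_fderiv ?_
  ext <;> simp <;> ring

lemma HasDD.inv {f : ℂ → ℂ} {p q : ℂ} (hf : HasDD t f z p q) (h0 : f z ≠ 0) :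
    HasDD t (fun x => (f x)⁻¹) z (-p / (f z) ^ 2) (-q / (f z) ^ 2) := by
  have := hf.comp (hasDerivAt_inv h0)
  convert this using 1 <;> field_simp

lemma HasDD.congr {f : ℂ → ℂ} {p q p' q' : ℂ} (hf : HasDD t f z p q) (hp : p = p') (hq : q = q') :
    HasDD t f z p' q' := by subst hp hq; exact hf

lemma HasGrad.congr {f : ℂ → ℝ} {p p' : ℂ} (hf : HasGrad t f z p) (hp : p = p') :
    HasGrad t f z p' := by subst hp; exact hf

lemma HasDD.re {f : ℂ → ℂ} {p q : ℂ} (hf : HasDD t f z p q) :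
    HasGrad t (fun x => (f x).re) z (p + conj q) := by
  refine (Complex.reCLM.hasFDerivAt.comp z hf).congr_fderiv ?_
  ext <;> simp <;> ring

lemma HasDD.im {f : ℂ → ℂ} {p q : ℂ} (hf : HasDD t f z p q) :
    HasGrad t (fun x => (f x).im) z (-Complex.I * (p - conj q)) := by
  refine (Complex.imCLM.hasFDerivAt.comp z hf).congr_fderiv ?_
  ext <;> simp <;> ring

lemma HasGrad.ofReal {f : ℂ → ℝ} {g : ℂ} (hf : HasGrad t f z g) :
    HasDD t (fun x => (f x : ℂ)) z (g / 2) (conj g / 2) := by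
  refine (Complex.ofRealCLM.hasFDerivAt.comp z hf).congr_fderiv ?_
  ext
  all_goals
    apply Complex.ext <;> simp <;> ring

lemma HasGrad.add {f g : ℂ → ℝ} {p q : ℂ} (hf : HasGrad t f z p) (hg : HasGrad t g z q) :
    HasGrad t (fun x => f x + g x) z (p + q) := by
  refine (HasFDerivAt.add hf hg).congr_fderiv ?_
  ext <;> simp <;> ring

lemma HasGrad.const_mul {f : ℂ → ℝ} {p : ℂ} (c : ℝ) (hf : HasGrad t f z p) :
    HasGrad t (fun x => c * f x) z (c * p) := by
  refine (HasFDerivAt.const_mul hf c).congr_fderiv ?_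
  ext <;> simp <;> ring

lemma hasGrad_const (c : ℝ) : HasGrad t (fun _ => c) z 0 := by
  refine (hasFDerivAt_const c z).congr_fderiv ?_
  ext <;> simp

lemma HasGrad.mul {f g : ℂ → ℝ} {p q : ℂ} (hf : HasGrad t f z p) (hg : HasGrad t g z q) :
    HasGrad t (fun x => f x * g x) z (f z * q + g z * p) := by
  refine (HasFDerivAt.mul hf hg).congr_fderiv ?_
  ext <;> simp <;> ring

lemma HasGrad.comp {f : ℂ → ℝ} {h : ℝ → ℝ} {p : ℂ} {d : ℝ} (hf : HasGrad t f z p)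
    (hh : HasDerivAt h d (f z)) : HasGrad t (fun x => h (f x)) z (d * p) := by
  refine (hh.hasFDerivAt.comp z hf).congr_fderiv ?_
  ext <;> simp <;> ring

lemma HasDD.differentiableAt {f : ℂ → ℂ} {p q : ℂ} (hf : HasDD t f z p q) :
    DifferentiableAt ℝ f z := HasFDerivAt.differentiableAt hf

lemma HasDD.continuousAt {f : ℂ → ℂ} {p q : ℂ} (hf : HasDD t f z p q) :
    ContinuousAt f z := HasFDerivAt.continuousAt hf

lemma HasGrad.continuousAt {f : ℂ → ℝ} {p : ℂ} (hf : HasGrad t f z p) :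
    ContinuousAt f z := HasFDerivAt.continuousAt hf

lemma HasDD.congr_of_eventuallyEq {f g : ℂ → ℂ} {p q : ℂ} (hf : HasDD t f z p q)
    (h : g =ᶠ[𝓝 z] f) : HasDD t g z p q := HasFDerivAt.congr_of_eventuallyEq hf h

lemma HasGrad.congr_of_eventuallyEq {f g : ℂ → ℝ} {p : ℂ} (hf : HasGrad t f z p)
    (h : g =ᶠ[𝓝 z] f) : HasGrad t g z p := HasFDerivAt.congr_of_eventuallyEq hf h

lemma frame_ne (hy : 0 < z.im) (ht : ‖t z‖ < 1) :
    (z.im : ℂ) * (1 - t z * conj (t z)) ≠ 0 := by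
  rw [Complex.mul_conj, ← Complex.ofReal_one, ← Complex.ofReal_sub, ← Complex.ofReal_mul]
  rw [Ne, Complex.ofReal_eq_zero]
  have : Complex.normSq (t z) < 1 := by
    rw [Complex.normSq_eq_norm_sq]; nlinarith [norm_nonneg (t z)]
  have : 0 < z.im * (1 - Complex.normSq (t z)) := mul_pos hy (by linarith)
  exact ne_of_gt this

/-- The frame vector dual to the coframe. -/
lemma coframe_frame (hy : 0 < z.im) (ht : ‖t z‖ < 1) (w : ℂ) :
    coframe t z ((z.im : ℂ) * (w - t z * conj w)) = w := by
  have := frame_ne hy ht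
  rw [coframe_apply, div_eq_iff this]
  simp
  ring

lemma HasDD.unique {f : ℂ → ℂ} {p q p' q' : ℂ} (hy : 0 < z.im) (ht : ‖t z‖ < 1)
    (h : HasDD t f z p q) (h' : HasDD t f z p' q') : p = p' ∧ q = q' := by
  have e := HasFDerivAt.unique h h'
  have e1 := DFunLike.congr_fun e ((z.im : ℂ) * ((1:ℂ) - t z * conj (1:ℂ)))
  have e2 := DFunLike.congr_fun e ((z.im : ℂ) * (Complex.I - t z * conj Complex.I))
  simp only [add_apply, smul_apply,
    ContinuousLinearMap.comp_apply, coframe_frame hy ht, smul_eq_mul] at e1 e2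
  simp at e1 e2
  have e3 : p - q = p' - q' := by
    have : Complex.I * (p - q) = Complex.I * (p' - q') := by linear_combination e2
    exact mul_left_cancel₀ Complex.I_ne_zero this
  constructor
  · linear_combination (e1 + e3) / 2
  · linear_combination (e1 - e3) / 2

/-- Every real-differentiable function has frame components. -/
lemma hasDD_of_hasFDerivAt {f : ℂ → ℂ} {f' : ℂ →L[ℝ] ℂ} (hy : 0 < z.im) (ht : ‖t z‖ < 1)
    (h : HasFDerivAt f f' z) :
    HasDD t f z (z.im * ((f' 1 - Complex.I * f' Complex.I) / 2
        - conj (t z) * ((f' 1 + Complex.I * f' Complex.I) / 2)))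
      (z.im * ((f' 1 + Complex.I * f' Complex.I) / 2
        - t z * ((f' 1 - Complex.I * f' Complex.I) / 2))) := by
  refine h.congr_fderiv ?_
  have hne := frame_ne hy ht
  have hy' : (z.im : ℂ) ≠ 0 := by exact_mod_cast hy.ne'
  have h2 : (1 - t z * conj (t z)) ≠ 0 := fun h0 => hne (by simp [h0])
  have h3 : (1 - t z * conj (t z)) = (1 - conj (t z) * t z) := by ring
  have h4 := h2
  rw [h3] at h4
  have key : ∀ v : ℂ, f' v = v.re * f' 1 + v.im * f' Complex.I := by
    intro v
    conv_lhs => rw [show v = v.re • (1:ℂ) + v.im • Complex.I by simp [Complex.re_add_im]]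
    rw [map_add, map_smul, map_smul]; simp
  have main : ∀ v : ℂ, f' v = ((z.im * ((f' 1 - Complex.I * f' Complex.I) / 2
        - conj (t z) * ((f' 1 + Complex.I * f' Complex.I) / 2))) • coframe t z +
        (z.im * ((f' 1 + Complex.I * f' Complex.I) / 2
        - t z * ((f' 1 - Complex.I * f' Complex.I) / 2))) •
        ((Complex.conjCLE : ℂ →L[ℝ] ℂ).comp (coframe t z))) v := by
    intro v
    simp only [add_apply, smul_apply,
      ContinuousLinearMap.comp_apply, smul_eq_mul, coframe_apply]
    rw [key v]
    have e1 : (v.re : ℂ) = (v + conj v) / 2 := by rw [Complex.add_conj]; push_cast; ring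
    have e2 : (v.im : ℂ) = -Complex.I * (v - conj v) / 2 := by
      rw [Complex.sub_conj]; push_cast; ring_nf; simp
    rw [e1, e2]
    simp
    field_simp
    ring_nf
  ext v
  · rw [main]

end

section

/-- `f` has gradient `g` and Laplacian `l` on `Ω`, for the metric defined by the coframe. -/
def HasLap (t : ℂ → ℂ) (Ω : Set ℂ) (f : ℂ → ℝ) (g : ℂ → ℂ) (l : ℂ → ℝ) : Prop :=
  ∀ z ∈ Ω, HasGrad t f z (g z) ∧
    ∃ m, HasDD t g z m ((l z + Complex.I * (1 - t z) * g z) / 2)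

variable {t : ℂ → ℂ} {z : ℂ} {Ω : Set ℂ}

lemma HasLap.congr {f : ℂ → ℝ} {g g' : ℂ → ℂ} {l l' : ℂ → ℝ} (h : HasLap t Ω f g l)
    (hΩ : IsOpen Ω) (hg : ∀ z ∈ Ω, g z = g' z) (hl : ∀ z ∈ Ω, l z = l' z) :
    HasLap t Ω f g' l' := by
  intro z hz
  obtain ⟨h1, m, h2⟩ := h z hz
  refine ⟨h1.congr (hg z hz), m, ?_⟩
  rw [← hg z hz, ← hl z hz]
  refine h2.congr_of_eventuallyEq ?_
  filter_upwards [hΩ.mem_nhds hz] with x hx using (hg x hx).symm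

lemma HasLap.congr_fun {f f' : ℂ → ℝ} {g : ℂ → ℂ} {l : ℂ → ℝ} (h : HasLap t Ω f g l)
    (hΩ : IsOpen Ω) (hf : ∀ z ∈ Ω, f' z = f z) : HasLap t Ω f' g l := by
  intro z hz
  obtain ⟨h1, m, h2⟩ := h z hz
  refine ⟨h1.congr_of_eventuallyEq ?_, m, h2⟩
  filter_upwards [hΩ.mem_nhds hz] with x hx using hf x hx

lemma HasLap.mono {f : ℂ → ℝ} {g : ℂ → ℂ} {l : ℂ → ℝ} {Ω' : Set ℂ} (h : HasLap t Ω f g l)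
    (hs : Ω' ⊆ Ω) : HasLap t Ω' f g l := fun z hz => h z (hs hz)

lemma HasLap.add {f f' : ℂ → ℝ} {g g' : ℂ → ℂ} {l l' : ℂ → ℝ} (h : HasLap t Ω f g l)
    (h' : HasLap t Ω f' g' l') :
    HasLap t Ω (fun z => f z + f' z) (fun z => g z + g' z) (fun z => l z + l' z) := by
  intro z hz
  obtain ⟨h1, m, h2⟩ := h z hz
  obtain ⟨h1', m', h2'⟩ := h' z hz
  refine ⟨h1.add h1', m + m', (h2.add h2').congr rfl ?_⟩
  push_cast; ring

lemma HasLap.const_mul {f : ℂ → ℝ} {g : ℂ → ℂ} {l : ℂ → ℝ} (c : ℝ) (h : HasLap t Ω f g l) :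
    HasLap t Ω (fun z => c * f z) (fun z => c * g z) (fun z => c * l z) := by
  intro z hz
  obtain ⟨h1, m, h2⟩ := h z hz
  refine ⟨h1.const_mul c, c * m, (h2.const_mul c).congr rfl ?_⟩
  push_cast; ring

lemma hasLap_const (c : ℝ) : HasLap t Ω (fun _ => c) (fun _ => 0) (fun _ => 0) := by
  intro z hz
  refine ⟨hasGrad_const c, 0, (hasDD_const 0).congr rfl ?_⟩
  simp

lemma HasLap.mul {f f' : ℂ → ℝ} {g g' : ℂ → ℂ} {l l' : ℂ → ℝ} (h : HasLap t Ω f g l)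
    (h' : HasLap t Ω f' g' l') :
    HasLap t Ω (fun z => f z * f' z) (fun z => f z * g' z + f' z * g z)
      (fun z => f z * l' z + f' z * l z + 2 * (g z * conj (g' z)).re) := by
  intro z hz
  obtain ⟨h1, m, h2⟩ := h z hz
  obtain ⟨h1', m', h2'⟩ := h' z hz
  refine ⟨h1.mul h1', _, ((h1.ofReal.mul h2').add (h1'.ofReal.mul h2)).congr rfl ?_⟩
  have e : ((g z * conj (g' z)).re : ℂ) = (g z * conj (g' z) + conj (g z) * g' z) / 2 := by
    have := Complex.add_conj (g z * conj (g' z))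
    simp only [map_mul, Complex.conj_conj] at this
    rw [this]; push_cast; ring
  push_cast [e]
  ring

lemma HasLap.comp {f : ℂ → ℝ} {g : ℂ → ℂ} {l : ℂ → ℝ} (h : HasLap t Ω f g l)
    {χ χ₁ χ₂ : ℝ → ℝ} (hχ : ∀ z ∈ Ω, HasDerivAt χ (χ₁ (f z)) (f z))
    (hχ₁ : ∀ z ∈ Ω, HasDerivAt χ₁ (χ₂ (f z)) (f z)) :
    HasLap t Ω (fun z => χ (f z)) (fun z => χ₁ (f z) * g z)
      (fun z => χ₁ (f z) * l z + χ₂ (f z) * Complex.normSq (g z)) := by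
  intro z hz
  obtain ⟨h1, m, h2⟩ := h z hz
  refine ⟨h1.comp (hχ z hz), _, ((h1.comp (hχ₁ z hz)).ofReal.mul h2).congr rfl ?_⟩
  have e : (Complex.normSq (g z) : ℂ) = g z * conj (g z) := (Complex.mul_conj _).symm
  push_cast [e]
  simp
  ring

lemma deriv_nonpos_of_isLocalMax {φ φ' : ℝ → ℝ} {κ : ℝ}
    (h1 : ∀ᶠ s in 𝓝 0, HasDerivAt φ (φ' s) s) (h2 : HasDerivAt φ' κ 0)
    (hmax : IsLocalMax φ 0) : κ ≤ 0 := by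
  by_contra hκ
  push Not at hκ
  have h0 : φ' 0 = 0 := hmax.hasDerivAt_eq_zero h1.self_of_nhds
  have hpos : ∀ᶠ s in 𝓝[>] (0:ℝ), 0 < φ' s := by
    have hs := (hasDerivAt_iff_tendsto_slope.1 h2).mono_left
      (nhdsWithin_mono 0 (fun x (hx : x ∈ Ioi (0:ℝ)) => (ne_of_gt hx : x ≠ 0)))
    filter_upwards [hs.eventually (lt_mem_nhds hκ), self_mem_nhdsWithin] with s hs1 hs2
    have : 0 < s := hs2
    rw [slope_def_field, h0, sub_zero, sub_zero] at hs1
    exact (div_pos_iff_of_pos_right this).1 hs1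
  obtain ⟨ε, hε, hb⟩ := Metric.eventually_nhds_iff_ball.1 (h1.and hmax)
  obtain ⟨δ, hδ, hc⟩ := mem_nhdsGT_iff_exists_Ioo_subset.1 hpos
  have hδ' : 0 < δ := hδ
  set r := min (ε / 2) (δ / 2) with hr
  have hr0 : 0 < r := by positivity
  have hrε : r < ε := lt_of_le_of_lt (min_le_left _ _) (by linarith)
  have hrδ : r < δ := lt_of_le_of_lt (min_le_right _ _) (by linarith)
  have hball : ∀ s ∈ Icc 0 r, s ∈ Metric.ball (0:ℝ) ε := by
    intro s hs
    rw [Metric.mem_ball, Real.dist_eq, sub_zero, abs_of_nonneg hs.1]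
    exact lt_of_le_of_lt hs.2 hrε
  have : StrictMonoOn φ (Icc 0 r) := by
    refine strictMonoOn_of_deriv_pos (convex_Icc _ _) ?_ ?_
    · intro s hs
      exact (hb s (hball s hs)).1.continuousAt.continuousWithinAt
    · intro s hs
      rw [interior_Icc] at hs
      rw [(hb s (hball s ⟨hs.1.le, hs.2.le⟩)).1.deriv]
      exact hc ⟨hs.1, hs.2.trans hrδ⟩
  have h3 := this (left_mem_Icc.2 hr0.le) (right_mem_Icc.2 hr0.le) hr0
  have h4 := (hb r (hball r (right_mem_Icc.2 hr0.le))).2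
  linarith

lemma HasLap.grad_eq_zero {f : ℂ → ℝ} {g : ℂ → ℂ} {l : ℂ → ℝ} (h : HasLap t Ω f g l)
    (hz : z ∈ Ω) (hy : 0 < z.im) (ht : ‖t z‖ < 1) (hmax : IsLocalMax f z) : g z = 0 := by
  have h0 := hmax.hasFDerivAt_eq_zero (h z hz).1
  have e := DFunLike.congr_fun h0 ((z.im : ℂ) * (conj (g z) - t z * conj (conj (g z))))
  simp only [ContinuousLinearMap.comp_apply, smul_apply, smul_eq_mul,
    coframe_frame hy ht] at e
  simp at e
  apply Complex.ext
  · simp; nlinarith [sq_nonneg (g z).re, sq_nonneg (g z).im]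
  · simp; nlinarith [sq_nonneg (g z).re, sq_nonneg (g z).im]

lemma HasLap.second_nonpos {f : ℂ → ℝ} {g : ℂ → ℂ} {l : ℂ → ℝ} (h : HasLap t Ω f g l)
    (hΩ : IsOpen Ω) (hz : z ∈ Ω) (hy : 0 < z.im) (ht : ‖t z‖ < 1) (htc : ContinuousAt t z)
    (hmax : IsLocalMax f z) {m : ℂ} (hm : HasDD t g z m ((l z + Complex.I * (1 - t z) * g z) / 2))
    (w : ℂ) : (w * (w * m + conj w * (l z / 2))).re ≤ 0 := by
  have hg0 := h.grad_eq_zero hz hy ht hmax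
  set E : ℂ := (z.im : ℂ) * (w - t z * conj w) with hE
  have hline : ∀ s : ℝ, HasDerivAt (fun s : ℝ => z + s * E) E s := by
    intro s
    simpa using ((hasDerivAt_id s).ofReal_comp.mul_const E).const_add z
  have hcont : ContinuousAt (fun s : ℝ => z + s * E) 0 := (hline 0).continuousAt
  have hev : ∀ᶠ s : ℝ in 𝓝 0, z + s * E ∈ Ω := by
    apply hcont.eventually_mem
    simpa using hΩ.mem_nhds hz
  have d1 : ∀ᶠ s : ℝ in 𝓝 0, HasDerivAt (fun s : ℝ => f (z + s * E))
      ((g (z + s * E) * coframe t (z + s * E) E).re) s := by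
    filter_upwards [hev] with s hs
    have := (h _ hs).1
    exact (HasFDerivAt.comp_hasDerivAt (f := fun s : ℝ => z + s * E) s this
      (hline s)).congr_deriv (by simp)
  have hcf : ContinuousAt (fun x => coframe t x E) z := by
    have hne := frame_ne hy ht
    have : (fun x => coframe t x E) =
      fun x : ℂ => (E + t x * conj E) / ((x.im : ℂ) * (1 - t x * conj (t x))) := by
      ext x; rw [coframe_apply]
    rw [this]
    refine ContinuousAt.div (by fun_prop) ?_ hne
    have : ContinuousAt (fun x => conj (t x)) z := Complex.continuous_conj.continuousAt.comp htc
    have h2 : ContinuousAt (fun x : ℂ => (x.im : ℂ)) z := by fun_prop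
    exact h2.mul (continuousAt_const.sub (htc.mul this))
  have hgd : HasDerivAt (fun s : ℝ => g (z + s * E)) (w * m + conj w * (l z / 2)) 0 := by
    have hm' : HasDD t g (z + ((0:ℝ):ℂ) * E) m ((l z + Complex.I * (1 - t z) * g z) / 2) := by
      simpa using hm
    refine (HasFDerivAt.comp_hasDerivAt (f := fun s : ℝ => z + s * E) (0:ℝ) hm' (hline 0)).congr_deriv ?_
    simp [hE, coframe_frame hy ht, hg0]
    ring
  have d2 : HasDerivAt (fun s : ℝ => g (z + s * E) * coframe t (z + s * E) E)
      ((w * m + conj w * (l z / 2)) * w) 0 := by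
    rw [hasDerivAt_iff_tendsto_slope] at hgd ⊢
    have hc2 : Tendsto (fun s : ℝ => coframe t (z + s * E) E) (𝓝[≠] 0) (𝓝 w) := by
      have h3 : ContinuousAt (fun s : ℝ => coframe t (z + s * E) E) 0 := by
        refine ContinuousAt.comp (f := fun s : ℝ => z + s * E) (g := fun x => coframe t x E) ?_ hcont
        simpa using hcf
      have h4 := h3.tendsto
      simp only [Complex.ofReal_zero, zero_mul, add_zero] at h4
      rw [hE, coframe_frame hy ht] at h4
      exact h4.mono_left nhdsWithin_le_nhds
    refine (hgd.mul hc2).congr' ?_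
    filter_upwards [self_mem_nhdsWithin] with s hs
    simp [slope, hg0]
    ring
  have d3 : HasDerivAt (fun s : ℝ => (g (z + s * E) * coframe t (z + s * E) E).re)
      (((w * m + conj w * (l z / 2)) * w).re) 0 :=
    (Complex.reCLM.hasFDerivAt.comp_hasDerivAt (0:ℝ) d2)
  have hloc : IsLocalMax (fun s : ℝ => f (z + s * E)) 0 := by
    have : Tendsto (fun s : ℝ => z + s * E) (𝓝 0) (𝓝 z) := by
      simpa using hcont.tendsto
    have := this.eventually hmax
    simpa [IsLocalMax, IsMaxFilter] using this
  have := deriv_nonpos_of_isLocalMax d1 d3 hloc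
  rwa [mul_comm] at this

/-- The maximum principle: at an interior local maximum the Laplacian is nonpositive. -/
lemma HasLap.lap_nonpos {f : ℂ → ℝ} {g : ℂ → ℂ} {l : ℂ → ℝ} (h : HasLap t Ω f g l)
    (hΩ : IsOpen Ω) (hz : z ∈ Ω) (hy : 0 < z.im) (ht : ‖t z‖ < 1) (htc : ContinuousAt t z)
    (hmax : IsLocalMax f z) : l z ≤ 0 := by
  obtain ⟨-, m, hm⟩ := h z hz
  have h1 := h.second_nonpos hΩ hz hy ht htc hmax hm 1
  have h2 := h.second_nonpos hΩ hz hy ht htc hmax hm Complex.I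
  simp at h1 h2
  linarith

lemma isOpen_Hset : IsOpen Hset := isOpen_lt continuous_const Complex.continuous_im

/-! ### Derivatives of the coordinates -/

lemma hasDD_id (hy : 0 < z.im) (ht : ‖t z‖ < 1) :
    HasDD t (fun x => x) z z.im (-(z.im * t z)) := by
  have := hasDD_of_hasFDerivAt hy ht (hasFDerivAt_id (𝕜 := ℝ) z)
  refine this.congr ?_ ?_ <;> simp

lemma hasGrad_im (hy : 0 < z.im) (ht : ‖t z‖ < 1) :
    HasGrad t (fun x => x.im) z (-Complex.I * z.im * (1 + conj (t z))) := by
  refine (hasDD_id hy ht).im.congr ?_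
  simp
  ring

end

section

/-- The frame data of a minimal Lagrangian map `Φ` of the upper half-plane. -/
structure Surf where
  /-- the map -/
  Φ : ℂ → ℂ
  /-- the Beltrami-type coefficient -/
  t : ℂ → ℂ
  /-- the second frame derivative of `t` -/
  σ : ℂ → ℂ
  /-- the frame derivative of `Φ` -/
  e : ℂ → ℂ
  /-- the spin frame -/
  k : ℂ → ℂ
  im_pos : ∀ z ∈ Hset, 0 < (Φ z).im
  norm_t : ∀ z ∈ Hset, ‖t z‖ < 1
  dt : ∀ z ∈ Hset, HasDD t t z (-Complex.I * (1 - conj (t z)) * t z) (σ z)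
  dσ : ∀ z ∈ Hset, ∃ m, HasDD t σ z (-(1 - t z) * (t z * conj (t z))
    - (3 * Complex.I / 2) * (1 - conj (t z)) * σ z
    - (1 - t z) * (1 - conj (t z)) * t z / 2) m
  dΦ : ∀ z ∈ Hset, HasDD t Φ z (e z) (t z * e z)
  norm_e : ∀ z ∈ Hset, ‖e z‖ = (Φ z).im
  dk : ∀ z ∈ Hset, HasDD t k z (k z * (Complex.I / 2) * (conj (t z) + e z / (Φ z).im))
    (k z * (Complex.I / 2) * (e z * t z / (Φ z).im - 1))
  k_sq : ∀ z ∈ Hset, k z ^ 2 * (z.im * e z) = 1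

/-- `cosh` of the hyperbolic distance to `i`. -/
def psi (z : ℂ) : ℝ := (Complex.normSq z + 1) / (2 * z.im)

lemma psi_pos {z : ℂ} (hz : z ∈ Hset) : 0 < psi z := by
  have : 0 < z.im := hz
  unfold psi
  have := Complex.normSq_nonneg z
  positivity

lemma one_le_psi {z : ℂ} (hz : z ∈ Hset) : 1 ≤ psi z := by
  have h : 0 < z.im := hz
  unfold psi
  rw [le_div_iff₀ (by positivity), Complex.normSq_apply]
  nlinarith [sq_nonneg (z.im - 1), sq_nonneg z.re]

lemma continuousOn_psi : ContinuousOn psi Hset := by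
  unfold psi
  refine ContinuousOn.div ?_ ?_ ?_
  · exact (Complex.continuous_normSq.add continuous_const).continuousOn
  · fun_prop
  · intro z hz
    have h : 0 < z.im := hz
    positivity

lemma isCompact_psi_le (R : ℝ) : IsCompact {z | z ∈ Hset ∧ psi z ≤ R} := by
  have : {z | z ∈ Hset ∧ psi z ≤ R} =
      {z | 0 ≤ z.im ∧ Complex.normSq z + 1 ≤ R * (2 * z.im)} := by
    ext z
    constructor
    · rintro ⟨h1, h2⟩
      have h : 0 < z.im := h1
      refine ⟨h.le, ?_⟩
      unfold psi at h2
      rwa [div_le_iff₀ (by positivity)] at h2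
    · rintro ⟨h1, h2⟩
      have h : 0 < z.im := by
        rcases h1.eq_or_lt with h | h
        · rw [← h] at h2
          have := Complex.normSq_nonneg z
          linarith
        · exact h
      refine ⟨h, ?_⟩
      unfold psi
      rwa [div_le_iff₀ (by positivity)]
  rw [this]
  refine Metric.isCompact_of_isClosed_isBounded ?_ ?_
  · have h1 : IsClosed {z : ℂ | Complex.normSq z + 1 ≤ R * (2 * z.im)} :=
      isClosed_le (Complex.continuous_normSq.add continuous_const) (by fun_prop)
    exact (isClosed_le continuous_const Complex.continuous_im).inter h1
  · refine (Metric.isBounded_closedBall (x := (0:ℂ)) (r := 2 * |R| + 1)).subset ?_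
    rintro z ⟨h1, h2⟩
    rw [mem_closedBall_zero_iff]
    have h3 : z.im ≤ ‖z‖ := (le_abs_self _).trans (Complex.abs_im_le_norm z)
    have h4 : R * (2 * z.im) ≤ |R| * (2 * ‖z‖) :=
      mul_le_mul (le_abs_self R) (by linarith) (by linarith) (abs_nonneg R)
    rw [Complex.normSq_eq_norm_sq] at h2
    by_contra hc
    push Not at hc
    nlinarith [norm_nonneg z, abs_nonneg R]

namespace Surf

variable (S : Surf)

lemma continuousAt_t {z : ℂ} (hz : z ∈ Hset) : ContinuousAt S.t z := (S.dt z hz).continuousAt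

/-- The gradient of `psi`. -/
def gpsi (z : ℂ) : ℂ := conj z - conj (S.t z) * z + Complex.I * (1 + conj (S.t z)) * psi z

lemma grad_psi {z : ℂ} (hz : z ∈ Hset) : HasGrad S.t psi z (S.gpsi z) := by
  have hy : 0 < z.im := hz
  have ht := S.norm_t z hz
  have h1 := hasDD_id (t := S.t) hy ht
  have h2 := (h1.re.mul h1.re).add (h1.im.mul h1.im)
  have h3 := (h2.add (hasGrad_const (1:ℝ)))
  have h4 := (hasGrad_im (t := S.t) hy ht).comp (hasDerivAt_inv hy.ne')
  have h5 := (h3.mul h4).const_mul (1/2)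
  have hyc : (z.im : ℂ) ≠ 0 := by exact_mod_cast hy.ne'
  refine (h5.congr ?_).congr_of_eventuallyEq ?_
  · have e0 : z = z.re + z.im * Complex.I := (Complex.re_add_im z).symm
    have e1 : conj z = z.re - z.im * Complex.I := by apply Complex.ext <;> simp
    have e2 : conj z - conj (S.t z) * z = (z.re - z.im * Complex.I)
        - conj (S.t z) * (z.re + z.im * Complex.I) := by
      linear_combination e1 - conj (S.t z) * e0
    unfold gpsi psi
    rw [e2, Complex.normSq_apply]
    push_cast
    simp only [map_neg, map_mul, Complex.conj_ofReal]
    field_simp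
    ring
  · filter_upwards with x
    unfold psi
    rw [Complex.normSq_apply, div_eq_mul_inv, mul_inv]
    ring

lemma conj_dt {z : ℂ} (hz : z ∈ Hset) : HasDD S.t (fun x => conj (S.t x)) z
    (conj (S.σ z)) (Complex.I * (1 - S.t z) * conj (S.t z)) := by
  refine (S.dt z hz).conj.congr rfl ?_
  simp

lemma lap_psi : HasLap S.t Hset psi S.gpsi
    (fun z => 2 * (1 + Complex.normSq (S.t z)) * psi z) := by
  intro z hz
  refine ⟨S.grad_psi hz, ?_⟩
  have hy : 0 < z.im := hz
  have ht := S.norm_t z hz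
  have h1 := hasDD_id (t := S.t) hy ht
  have h2 := (S.grad_psi hz).ofReal
  have h3 := S.conj_dt hz
  have h4 := (h1.conj.sub (h3.mul h1)).add
    (((((hasDD_const 1).add h3).const_mul Complex.I)).mul h2)
  refine ⟨_, h4.congr rfl ?_⟩
  have hyc : (z.im : ℂ) ≠ 0 := by exact_mod_cast hy.ne'
  have e0 : z = z.re + z.im * Complex.I := (Complex.re_add_im z).symm
  have e1 : conj z = z.re - z.im * Complex.I := by apply Complex.ext <;> simp
  have e3 : (psi z : ℂ) = ((z.re : ℂ) * z.re + z.im * z.im + 1) / (2 * z.im) := by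
    unfold psi; rw [Complex.normSq_apply]; push_cast; ring
  unfold gpsi
  push_cast
  rw [← Complex.mul_conj, e3]
  simp only [map_add, map_sub, map_mul, Complex.conj_conj, Complex.conj_ofReal, Complex.conj_I,
    map_one, map_div₀, map_ofNat, zero_add]
  rw [e1]
  generalize z.re = x, S.t z = τ at *
  generalize z.im = y at *
  subst e0
  field_simp
  ring_nf
  simp only [Complex.I_sq]
  ring

lemma norm_gpsi_le {z : ℂ} (hz : z ∈ Hset) : ‖S.gpsi z‖ ≤ 2 * psi z := by
  have hy : 0 < z.im := hz
  have ht := S.norm_t z hz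
  have hp := psi_pos hz
  have e : S.gpsi z = (conj z + Complex.I * psi z)
      - conj (S.t z) * (z - Complex.I * psi z) := by
    unfold gpsi; ring
  have e3 : psi z * (2 * z.im) = z.re * z.re + z.im * z.im + 1 := by
    unfold psi; rw [Complex.normSq_apply]; field_simp
  have h1 : ‖conj z + Complex.I * psi z‖ ≤ psi z := by
    rw [← sq_le_sq₀ (norm_nonneg _) hp.le, ← Complex.normSq_eq_norm_sq,
      Complex.normSq_apply]
    simp
    nlinarith
  have h2 : ‖z - Complex.I * psi z‖ ≤ psi z := by
    rw [← sq_le_sq₀ (norm_nonneg _) hp.le, ← Complex.normSq_eq_norm_sq,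
      Complex.normSq_apply]
    simp
    nlinarith
  rw [e]
  refine (norm_sub_le _ _).trans ?_
  rw [norm_mul, RCLike.norm_conj]
  nlinarith [norm_nonneg (S.t z), norm_nonneg (z - Complex.I * psi z)]

/-- The Omori–Yau maximum principle. -/
lemma omori_yau {F : ℂ → ℝ} {Ω : Set ℂ} {g : ℂ → ℂ} {l : ℂ → ℝ} {M c₀ ε : ℝ} {z₀ : ℂ}
    (hF : ContinuousOn F Hset) (hM : ∀ z ∈ Hset, F z ≤ M) (hz₀ : z₀ ∈ Hset) (hc : c₀ < F z₀)
    (hΩ : IsOpen Ω) (hΩH : Ω ⊆ Hset) (hsup : ∀ z ∈ Hset, c₀ < F z → z ∈ Ω)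
    (hl : HasLap S.t Ω F g l) (hε : 0 < ε) :
    ∃ z ∈ Ω, F z₀ - ε ≤ F z ∧ c₀ < F z ∧ ‖g z‖ ≤ ε ∧ l z ≤ ε := by
  have hp0 : 0 ≤ Real.log (psi z₀) := Real.log_nonneg (one_le_psi hz₀)
  set ε' := min ε ((F z₀ - c₀) / 2) with hε'
  have hε'0 : 0 < ε' := lt_min hε (by linarith)
  set δ := min (ε / 4) (ε' / (Real.log (psi z₀) + 1)) with hδ
  have hδ0 : 0 < δ := lt_min (by linarith) (by positivity)
  have hδ1 : δ ≤ ε / 4 := min_le_left _ _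
  have hδ2 : δ * Real.log (psi z₀) ≤ ε' := by
    have : δ ≤ ε' / (Real.log (psi z₀) + 1) := min_le_right _ _
    rw [le_div_iff₀ (by linarith)] at this
    nlinarith
  set R := max (psi z₀) (Real.exp ((M - F z₀ + δ * Real.log (psi z₀)) / δ)) with hR
  have hlogc : ContinuousOn (fun z => F z - δ * Real.log (psi z)) Hset := by
    refine hF.sub (continuousOn_const.mul (continuousOn_psi.log ?_))
    intro z hz
    exact (psi_pos hz).ne'
  obtain ⟨z₁, ⟨hz₁, hz₁R⟩, hmax⟩ := (isCompact_psi_le R).exists_isMaxOn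
    ⟨z₀, hz₀, le_max_left _ _⟩ (hlogc.mono (fun z hz => hz.1))
  have hmax' : ∀ z ∈ Hset, F z - δ * Real.log (psi z) ≤ F z₁ - δ * Real.log (psi z₁) := by
    intro z hz
    by_cases h : psi z ≤ R
    · exact hmax ⟨hz, h⟩
    · push Not at h
      have h1 : F z₀ - δ * Real.log (psi z₀) ≤ F z₁ - δ * Real.log (psi z₁) :=
        hmax (⟨hz₀, le_max_left _ _⟩ : z₀ ∈ {z | z ∈ Hset ∧ psi z ≤ R})
      have h2 : (M - F z₀ + δ * Real.log (psi z₀)) / δ ≤ Real.log (psi z) := by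
        rw [Real.le_log_iff_exp_le (psi_pos hz)]
        exact (le_max_right _ _).trans h.le
      rw [div_le_iff₀ hδ0] at h2
      have := hM z hz
      linarith
  have h1 := hmax' z₀ hz₀
  have hp1 : 0 ≤ Real.log (psi z₁) := Real.log_nonneg (one_le_psi hz₁)
  have hge : F z₀ - ε' ≤ F z₁ := by nlinarith
  have hc1 : c₀ < F z₁ := by
    have : ε' ≤ (F z₀ - c₀) / 2 := min_le_right _ _
    linarith
  have hzΩ := hsup z₁ hz₁ hc1
  have hlogpsi : HasLap S.t Ω (fun z => Real.log (psi z)) _ _ :=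
    (S.lap_psi.mono hΩH).comp (χ := Real.log) (χ₁ := fun x => x⁻¹) (χ₂ := fun x => -(x ^ 2)⁻¹)
      (fun z hz => Real.hasDerivAt_log (psi_pos (hΩH hz)).ne')
      (fun z hz => hasDerivAt_inv (psi_pos (hΩH hz)).ne')
  have hlap := hl.add (hlogpsi.const_mul (-δ))
  have hloc : IsLocalMax (fun z => F z + -δ * Real.log (psi z)) z₁ := by
    filter_upwards [isOpen_Hset.mem_nhds hz₁] with z hz
    have := hmax' z hz
    linarith
  have hy : 0 < z₁.im := hz₁
  have g0 := hlap.grad_eq_zero hzΩ hy (S.norm_t z₁ hz₁) hloc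
  have l0 := hlap.lap_nonpos hΩ hzΩ hy (S.norm_t z₁ hz₁) (S.continuousAt_t hz₁) hloc
  have hpp := psi_pos hz₁
  refine ⟨z₁, hzΩ, ?_, hc1, ?_, ?_⟩
  · have : ε' ≤ ε := min_le_left _ _
    linarith
  · have : g z₁ = δ * ((psi z₁)⁻¹ * S.gpsi z₁) := by
      push_cast at g0 ⊢
      linear_combination g0
    rw [this, norm_mul, norm_mul, Complex.norm_real, Real.norm_of_nonneg hδ0.le]
    have h2 : ‖(((psi z₁)⁻¹ : ℝ) : ℂ)‖ * ‖S.gpsi z₁‖ ≤ 2 := by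
      rw [Complex.norm_real, norm_inv, Real.norm_of_nonneg hpp.le, inv_mul_le_iff₀ hpp]
      linarith [S.norm_gpsi_le hz₁]
    nlinarith
  · have h2 : (psi z₁)⁻¹ * (2 * (1 + Complex.normSq (S.t z₁)) * psi z₁) ≤ 4 := by
      have : Complex.normSq (S.t z₁) ≤ 1 := by
        rw [Complex.normSq_eq_norm_sq]
        have := S.norm_t z₁ hz₁
        nlinarith [norm_nonneg (S.t z₁)]
      rw [inv_mul_le_iff₀ hpp]
      nlinarith
    have h3 : 0 ≤ (psi z₁ ^ 2)⁻¹ * Complex.normSq (S.gpsi z₁) :=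
      mul_nonneg (by positivity) (Complex.normSq_nonneg _)
    nlinarith

end Surf

end

section

/-- The bilinear polynomial with coefficients `P`. -/
def bipoly (P : Fin 4 → ℝ) (a b : ℂ) : ℂ := P 0 * (a * b) + P 1 * a + P 2 * b + P 3

/-- The determinant of the coefficients `P`. -/
def det4 (P : Fin 4 → ℝ) : ℝ := P 0 * P 3 - P 1 * P 2

namespace Surf

variable (S : Surf)

/-- The complex functional attached to `P`. -/
def U (P : Fin 4 → ℝ) (z : ℂ) : ℂ := S.k z * bipoly P (conj z) (S.Φ z)

/-- The complex functional giving the gradient of `Re U`. -/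
def V (P : Fin 4 → ℝ) (z : ℂ) : ℂ := S.k z * bipoly P z (S.Φ z)

/-- The support function of `P` on the surface. -/
def u (P : Fin 4 → ℝ) (z : ℂ) : ℝ := (S.U P z).re

/-- The pairing of `P` with the normal field. -/
def n (P : Fin 4 → ℝ) (z : ℂ) : ℝ := (S.U P z).im

/-- The squared norm of `t`. -/
def a (z : ℂ) : ℝ := Complex.normSq (S.t z)

variable {S} {P : Fin 4 → ℝ} {z : ℂ}

lemma k_ne (hz : z ∈ Hset) : S.k z ≠ 0 := by
  intro h
  have := S.k_sq z hz
  simp [h] at this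

lemma normSq_k (hz : z ∈ Hset) : Complex.normSq (S.k z) * (z.im * (S.Φ z).im) = 1 := by
  have h := congrArg norm (S.k_sq z hz)
  have hy : 0 < z.im := hz
  rw [norm_mul, norm_mul, norm_pow, S.norm_e z hz, Complex.norm_real, Real.norm_of_nonneg hy.le,
    norm_one] at h
  rw [Complex.normSq_eq_norm_sq]
  exact h

lemma k_mul_e (hz : z ∈ Hset) : S.k z * S.e z = (S.Φ z).im * conj (S.k z) := by
  have h1 := S.k_sq z hz
  have h2 : (S.k z * conj (S.k z)) * (z.im * (S.Φ z).im : ℂ) = 1 := by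
    rw [Complex.mul_conj]; exact_mod_cast normSq_k hz
  have hy : (z.im : ℂ) ≠ 0 := by exact_mod_cast (show 0 < z.im from hz).ne'
  have hk := k_ne (S := S) hz
  have : (S.k z * z.im) * (S.k z * S.e z) = (S.k z * z.im) * ((S.Φ z).im * conj (S.k z)) := by
    linear_combination h1 - h2
  exact mul_left_cancel₀ (mul_ne_zero hk hy) this

lemma dU (P : Fin 4 → ℝ) (hz : z ∈ Hset) : HasDD S.t (S.U P) z
    (Complex.I / 2 * (conj (S.t z) * S.V P z + conj (S.V P z)))
    (-(Complex.I / 2) * S.V P z + Complex.I / 2 * S.t z * conj (S.V P z)) := by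
  have hy : 0 < z.im := hz
  have h1 := hasDD_id (t := S.t) hy (S.norm_t z hz)
  have h2 := S.dΦ z hz
  have h3 := (S.dk z hz).mul (((((h1.conj.mul h2).const_mul (P 0)).add
    (h1.conj.const_mul (P 1))).add (h2.const_mul (P 2))).add (hasDD_const (P 3 : ℂ)))
  have hη : ((S.Φ z).im : ℂ) ≠ 0 := by exact_mod_cast (S.im_pos z hz).ne'
  have e1 : conj z = z - 2 * z.im * Complex.I := by apply Complex.ext <;> simp; ring
  have e2 : conj (S.Φ z) = S.Φ z - 2 * (S.Φ z).im * Complex.I := by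
    apply Complex.ext <;> simp; ring
  have e3 : conj (S.k z) = S.k z * S.e z / (S.Φ z).im := by
    rw [k_mul_e hz]; field_simp
  refine h3.congr ?_ ?_
  all_goals
    simp only [V, bipoly, map_add, map_mul, map_neg, Complex.conj_ofReal, e1, e2, e3]
    field_simp
    ring_nf
    simp only [Complex.I_sq, Complex.I_pow_three, Complex.I_pow_four]
    ring

lemma ofReal_u : (S.u P z : ℂ) = (S.U P z + conj (S.U P z)) / 2 := by
  rw [Complex.add_conj]; unfold u; push_cast; ring

lemma ofReal_n : (S.n P z : ℂ) = -(Complex.I / 2) * (S.U P z - conj (S.U P z)) := by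
  rw [Complex.sub_conj]; unfold n; push_cast; ring_nf; simp

lemma dV (P : Fin 4 → ℝ) (hz : z ∈ Hset) : HasDD S.t (S.V P) z
    (Complex.I * S.u P z - Complex.I / 2 * (1 - conj (S.t z)) * S.V P z)
    (-(Complex.I / 2) * (1 - S.t z) * S.V P z + S.t z * S.n P z) := by
  have hy : 0 < z.im := hz
  have h1 := hasDD_id (t := S.t) hy (S.norm_t z hz)
  have h2 := S.dΦ z hz
  have h3 := (S.dk z hz).mul (((((h1.mul h2).const_mul (P 0)).add
    (h1.const_mul (P 1))).add (h2.const_mul (P 2))).add (hasDD_const (P 3 : ℂ)))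
  have hη : ((S.Φ z).im : ℂ) ≠ 0 := by exact_mod_cast (S.im_pos z hz).ne'
  have e1 : conj z = z - 2 * z.im * Complex.I := by apply Complex.ext <;> simp; ring
  have e2 : conj (S.Φ z) = S.Φ z - 2 * (S.Φ z).im * Complex.I := by
    apply Complex.ext <;> simp; ring
  have e3 : conj (S.k z) = S.k z * S.e z / (S.Φ z).im := by
    rw [k_mul_e hz]; field_simp
  rw [ofReal_u, ofReal_n]
  refine h3.congr ?_ ?_
  all_goals
    simp only [U, V, bipoly, map_add, map_sub, map_mul, map_neg, Complex.conj_ofReal,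
      Complex.conj_conj, e1, e2, e3, Complex.conj_I, map_ofNat]
    field_simp
    ring_nf
    simp only [Complex.I_sq, Complex.I_pow_three, Complex.I_pow_four]
    ring

lemma lap_u (P : Fin 4 → ℝ) : HasLap S.t Hset (S.u P) (fun z => Complex.I * conj (S.V P z))
    (fun z => 2 * S.u P z) := by
  intro z hz
  refine ⟨(dU P hz).re.congr ?_, _, ((dV P hz).conj.const_mul Complex.I).congr rfl ?_⟩
  · simp only [map_add, map_mul, map_neg, map_div₀, Complex.conj_I, Complex.conj_conj, map_ofNat]
    ring
  · simp only [map_add, map_sub, map_mul, map_neg, map_div₀, Complex.conj_I, Complex.conj_conj,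
      map_ofNat, map_one, Complex.conj_ofReal]
    push_cast
    ring_nf
    simp only [Complex.I_sq, Complex.I_pow_three, Complex.I_pow_four]
    ring

lemma lap_n (P : Fin 4 → ℝ) : HasLap S.t Hset (S.n P) (fun z => conj (S.t z) * S.V P z)
    (fun z => 2 * S.a z * S.n P z) := by
  intro z hz
  refine ⟨(dU P hz).im.congr ?_, _, ((S.conj_dt hz).mul (dV P hz)).congr rfl ?_⟩
  · simp only [map_add, map_mul, map_neg, map_div₀, Complex.conj_I, Complex.conj_conj, map_ofNat]
    ring_nf
    simp only [Complex.I_sq, Complex.I_pow_three, Complex.I_pow_four]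
    ring
  · unfold a
    push_cast
    rw [← Complex.mul_conj]
    ring

lemma normSq_V (P : Fin 4 → ℝ) (hz : z ∈ Hset) :
    Complex.normSq (S.V P z) = S.u P z ^ 2 + S.n P z ^ 2 - 4 * det4 P := by
  have h1 : S.u P z ^ 2 + S.n P z ^ 2 = Complex.normSq (S.U P z) := by
    rw [Complex.normSq_apply]; unfold u n; ring
  have h2 := normSq_k (S := S) hz
  rw [h1]
  unfold U V det4 bipoly
  rw [map_mul, map_mul]
  generalize S.k z = k at *
  generalize S.Φ z = f at *
  have : (4 : ℝ) * (P 0 * P 3 - P 1 * P 2) =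
    4 * (P 0 * P 3 - P 1 * P 2) * (Complex.normSq k * (z.im * f.im)) := by rw [h2, mul_one]
  rw [this]
  simp only [Complex.normSq_apply, Complex.add_re, Complex.add_im, Complex.mul_re, Complex.mul_im,
    Complex.ofReal_re, Complex.ofReal_im, Complex.conj_re, Complex.conj_im]
  ring

/-- The logarithmic derivative entering the gradient of `a`. -/
def om (S : Surf) (z : ℂ) : ℂ := conj (S.σ z) - Complex.I * (1 - conj (S.t z)) * conj (S.t z)

lemma lap_a : HasLap S.t Hset S.a (fun z => 2 * S.t z * S.om z)
    (fun z => -4 * (1 - S.a z) * S.a z + 4 * Complex.normSq (S.om z)) := by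
  intro z hz
  have ht := S.dt z hz
  have hc := S.conj_dt hz
  obtain ⟨m, hs⟩ := S.dσ z hz
  have hω := hs.conj.sub ((((hasDD_const 1).sub hc).const_mul Complex.I).mul hc)
  constructor
  · have := (ht.mul hc).re
    refine (this.congr ?_).congr_of_eventuallyEq ?_
    · unfold om
      simp only [map_add, map_sub, map_mul, map_neg, Complex.conj_I, Complex.conj_conj, map_one]
      ring
    · filter_upwards with x
      unfold a
      rw [Complex.mul_conj]; simp
  · refine ⟨_, ((ht.const_mul 2).mul hω).congr rfl ?_⟩
    unfold a om
    push_cast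
    rw [← Complex.mul_conj, ← Complex.mul_conj]
    simp only [map_add, map_sub, map_mul, map_neg, Complex.conj_I, Complex.conj_conj, map_one,
      map_div₀, map_ofNat]
    ring_nf
    simp only [Complex.I_sq, Complex.I_pow_three, Complex.I_pow_four]
    ring

lemma a_nonneg : 0 ≤ S.a z := Complex.normSq_nonneg _

lemma a_lt_one (hz : z ∈ Hset) : S.a z < 1 := by
  unfold a
  rw [Complex.normSq_eq_norm_sq]
  have := S.norm_t z hz
  nlinarith [norm_nonneg (S.t z)]

lemma continuousAt_u (hz : z ∈ Hset) : ContinuousAt (S.u P) z := (lap_u P z hz).1.continuousAt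
lemma continuousAt_a (hz : z ∈ Hset) : ContinuousAt S.a z := (lap_a z hz).1.continuousAt
lemma continuousOn_u : ContinuousOn (S.u P) Hset := fun _ hz => (continuousAt_u hz).continuousWithinAt
lemma continuousOn_a : ContinuousOn S.a Hset := fun _ hz => (continuousAt_a hz).continuousWithinAt

end Surf

end

section

namespace Surf

variable (S : Surf)

/-- The gradient of `log u`. -/
def X (P : Fin 4 → ℝ) (z : ℂ) : ℂ := Complex.I * conj (S.V P z) / S.u P z

/-- The signed ratio `n / u`. -/
def r (ς : ℝ) (P : Fin 4 → ℝ) (z : ℂ) : ℝ := ς * S.n P z / S.u P z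

/-- The squared norm of the gradient of `log u`. -/
def h (P : Fin 4 → ℝ) (z : ℂ) : ℝ := Complex.normSq (S.X P z)

/-- The signed second fundamental form evaluated on the gradient of `log u`. -/
def bet (ς : ℝ) (P : Fin 4 → ℝ) (z : ℂ) : ℝ :=
  ς * (Complex.I * conj (S.t z) * conj (S.X P z) ^ 2).re

variable {S} {P : Fin 4 → ℝ} {z : ℂ} {ς : ℝ}

lemma h_nonneg : 0 ≤ S.h P z := Complex.normSq_nonneg _

lemma V_eq (hu : 0 < S.u P z) : S.V P z = Complex.I * S.u P z * conj (S.X P z) := by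
  have : (S.u P z : ℂ) ≠ 0 := by exact_mod_cast hu.ne'
  unfold X
  simp only [map_div₀, map_mul, Complex.conj_I, Complex.conj_conj, Complex.conj_ofReal]
  field_simp
  simp

lemma h_eq (hς : ς ^ 2 = 1) (hz : z ∈ Hset) (hu : 0 < S.u P z) :
    S.h P z = 1 + S.r ς P z ^ 2 - 4 * det4 P * ((S.u P z)⁻¹ * (S.u P z)⁻¹) := by
  have h1 := normSq_V (S := S) P hz
  rw [V_eq hu] at h1
  simp only [map_mul, Complex.normSq_I, Complex.normSq_conj, Complex.normSq_ofReal] at h1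
  unfold h r
  field_simp
  rw [hς]
  linarith

lemma abs_bet_le (hς : ς ^ 2 = 1) : |S.bet ς P z| ≤ ‖S.t z‖ * S.h P z := by
  unfold bet h
  have h1 : |ς| = 1 := by
    rw [← sq_abs] at hς
    nlinarith [abs_nonneg ς]
  rw [abs_mul, h1, one_mul]
  refine (Complex.abs_re_le_norm _).trans ?_
  rw [norm_mul, norm_mul, norm_pow, Complex.norm_conj, Complex.norm_conj, Complex.norm_I,
    Complex.normSq_eq_norm_sq, one_mul]

lemma lap_inv_u (hu : ∀ z ∈ Hset, 0 < S.u P z) :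
    HasLap S.t Hset (fun z => (S.u P z)⁻¹) (fun z => -((S.u P z : ℂ))⁻¹ * S.X P z)
      (fun z => (S.u P z)⁻¹ * (-2 + 2 * S.h P z)) := by
  have h1 := (lap_u (S := S) P).comp (χ := fun x => x⁻¹) (χ₁ := fun x => -(x ^ 2)⁻¹)
    (χ₂ := fun x => 2 * (x ^ 3)⁻¹) (fun z hz => hasDerivAt_inv (hu z hz).ne')
    (fun z hz => by
      have h0 := (hu z hz).ne'
      have := ((hasDerivAt_pow 2 (S.u P z)).inv (by positivity)).neg
      refine this.congr_deriv ?_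
      field_simp
      norm_num
      ring)
  refine h1.congr isOpen_Hset ?_ ?_
  · intro z hz
    have h0 : (S.u P z : ℂ) ≠ 0 := by exact_mod_cast (hu z hz).ne'
    unfold X
    push_cast
    field_simp
  · intro z hz
    have h0 := (hu z hz).ne'
    have h2 := V_eq (hu z hz)
    simp only [map_mul, Complex.normSq_I, Complex.normSq_conj]
    rw [h2]
    simp only [map_mul, Complex.normSq_I, Complex.normSq_conj, Complex.normSq_ofReal]
    unfold h
    field_simp

lemma lap_r (hu : ∀ z ∈ Hset, 0 < S.u P z) :
    HasLap S.t Hset (S.r ς P)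
      (fun z => ς * Complex.I * conj (S.t z) * conj (S.X P z) - S.r ς P z * S.X P z)
      (fun z => 2 * S.a z * S.r ς P z - 2 * S.r ς P z + 2 * S.r ς P z * S.h P z
        - 2 * S.bet ς P z) := by
  have h1 := ((lap_n (S := S) P).mul (lap_inv_u hu)).const_mul ς
  refine (h1.congr isOpen_Hset ?_ ?_).congr_fun isOpen_Hset ?_
  · intro z hz
    have h0 : (S.u P z : ℂ) ≠ 0 := by exact_mod_cast (hu z hz).ne'
    rw [V_eq (hu z hz)]
    unfold r
    push_cast
    field_simp
    ring
  · intro z hz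
    have h0 := (hu z hz).ne'
    rw [V_eq (hu z hz)]
    have e : (conj (S.t z) * (Complex.I * S.u P z * conj (S.X P z)) *
        conj (-(S.u P z : ℂ)⁻¹ * S.X P z)) =
        ((-1 : ℝ) : ℂ) * (Complex.I * conj (S.t z) * conj (S.X P z) ^ 2) := by
      have h0 : (S.u P z : ℂ) ≠ 0 := by exact_mod_cast (hu z hz).ne'
      simp only [map_mul, map_neg, map_inv₀, Complex.conj_ofReal]
      push_cast
      field_simp
    rw [e, Complex.re_ofReal_mul]
    unfold r bet
    field_simp
    ring
  · intro z hz
    unfold r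
    ring

lemma normSq_grad_r :
    Complex.normSq (ς * Complex.I * conj (S.t z) * conj (S.X P z) - S.r ς P z * S.X P z) =
      (ς ^ 2 * S.a z + S.r ς P z ^ 2) * S.h P z - 2 * S.r ς P z * S.bet ς P z := by
  unfold a h bet
  generalize S.r ς P z = r
  simp only [Complex.normSq_apply, Complex.add_re, Complex.add_im, Complex.mul_re, Complex.mul_im,
    Complex.ofReal_re, Complex.ofReal_im, Complex.conj_re, Complex.conj_im, Complex.sub_re,
    Complex.sub_im, Complex.I_re, Complex.I_im, pow_two]
  ring

lemma lap_h (hς : ς ^ 2 = 1) (hu : ∀ z ∈ Hset, 0 < S.u P z) :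
    HasLap S.t Hset (S.h P)
      (fun z => 2 * (1 - S.h P z) * S.X P z +
        2 * S.r ς P z * (ς * Complex.I * conj (S.t z) * conj (S.X P z)))
      (fun z => 4 - 10 * S.h P z + 6 * S.h P z ^ 2 + 4 * S.a z * S.r ς P z ^ 2
        + 2 * S.a z * S.h P z - 8 * S.r ς P z * S.bet ς P z) := by
  have h1 := (((hasLap_const 1).add ((lap_r (ς := ς) hu).mul (lap_r (ς := ς) hu))).add
    (((lap_inv_u hu).mul (lap_inv_u hu)).const_mul (-(4 * det4 P))))
  refine (h1.congr isOpen_Hset ?_ ?_).congr_fun isOpen_Hset ?_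
  · intro z hz
    have h2 := h_eq hς hz (hu z hz)
    have h3 : (S.h P z : ℂ) = 1 + S.r ς P z ^ 2 -
      4 * det4 P * ((S.u P z : ℂ)⁻¹ * (S.u P z : ℂ)⁻¹) := by exact_mod_cast h2
    rw [h3]
    push_cast
    ring
  · intro z hz
    have h2 := h_eq hς hz (hu z hz)
    rw [Complex.mul_conj, Complex.ofReal_re, Complex.mul_conj, Complex.ofReal_re, normSq_grad_r]
    have h3 : Complex.normSq (-(S.u P z : ℂ)⁻¹ * S.X P z) =
      ((S.u P z)⁻¹ * (S.u P z)⁻¹) * S.h P z := by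
      unfold h
      rw [map_mul, Complex.normSq_neg, map_inv₀, Complex.normSq_ofReal, mul_inv]
    rw [h3, hς]
    have h4 : 4 * det4 P * ((S.u P z)⁻¹ * (S.u P z)⁻¹) = 1 + S.r ς P z ^ 2 - S.h P z := by
      linarith
    linear_combination (-(2 * (-2 + 2 * S.h P z) + 2 * S.h P z)) * h4
  · intro z hz
    rw [h_eq hς hz (hu z hz)]
    ring

end Surf

end

section

lemma re_mul_conj_le (x y : ℂ) : |(x * conj y).re| ≤ ‖x‖ * ‖y‖ := by
  refine (Complex.abs_re_le_norm _).trans ?_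
  rw [norm_mul, Complex.norm_conj]

namespace Surf

variable {S : Surf} {P : Fin 4 → ℝ} {z : ℂ} {ς : ℝ}

/-- The bounds on `u` and `n` which make the maximum principle at infinity available. -/
structure Adm (S : Surf) (P : Fin 4 → ℝ) (c C : ℝ) : Prop where
  c_pos : 0 < c
  u_ge : ∀ z ∈ Hset, c ≤ S.u P z
  n_le : ∀ z ∈ Hset, |S.n P z| ≤ C * S.u P z

namespace Adm
variable {c C : ℝ} (A : Adm S P c C)
include A

lemma u_pos : ∀ z ∈ Hset, 0 < S.u P z := fun z hz => A.c_pos.trans_le (A.u_ge z hz)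

lemma r_sq_le (hς : ς ^ 2 = 1) (hz : z ∈ Hset) : S.r ς P z ^ 2 ≤ C ^ 2 := by
  have h1 := A.u_pos z hz
  have h2 := A.n_le z hz
  unfold r
  rw [div_pow, mul_pow, hς, one_mul, div_le_iff₀ (by positivity), ← sq_abs]
  calc |S.n P z| ^ 2 ≤ (C * S.u P z) ^ 2 := by gcongr
    _ = _ := by ring

lemma exists_h_le : ∃ M, 0 ≤ M ∧ ∀ z ∈ Hset, S.h P z ≤ M := by
  refine ⟨1 + C ^ 2 + |4 * det4 P| * (c⁻¹ * c⁻¹), ?_, ?_⟩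
  · have := A.c_pos
    positivity
  intro z hz
  have h1 := A.u_pos z hz
  rw [h_eq (ς := 1) (by norm_num) hz h1]
  have h2 := A.r_sq_le (ς := 1) (by norm_num) hz
  have h3 : (S.u P z)⁻¹ ≤ c⁻¹ := by
    have := A.c_pos
    gcongr
    exact A.u_ge z hz
  have h4 : 0 ≤ (S.u P z)⁻¹ := by positivity
  have h5 : -(4 * det4 P) * ((S.u P z)⁻¹ * (S.u P z)⁻¹) ≤ |4 * det4 P| * (c⁻¹ * c⁻¹) :=
    mul_le_mul (neg_le_abs _) (by gcongr; exact h4.trans h3) (by positivity) (abs_nonneg _)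
  linarith

end Adm

lemma continuousOn_of_lap {f : ℂ → ℝ} {g : ℂ → ℂ} {l : ℂ → ℝ} (hl : HasLap S.t Hset f g l) :
    ContinuousOn f Hset := fun z hz => (hl z hz).1.continuousAt.continuousWithinAt

lemma norm_t_sq : ‖S.t z‖ ^ 2 = S.a z := (Complex.normSq_eq_norm_sq _).symm

lemma norm_X_sq : ‖S.X P z‖ ^ 2 = S.h P z := (Complex.normSq_eq_norm_sq _).symm

lemma inner_X_grad_h : (S.X P z * conj (2 * (1 - S.h P z) * S.X P z +
        2 * S.r ς P z * (ς * Complex.I * conj (S.t z) * conj (S.X P z)))).re =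
      2 * (1 - S.h P z) * S.h P z + 2 * S.r ς P z * S.bet ς P z := by
  unfold bet h
  generalize S.r ς P z = r
  simp only [Complex.normSq_apply, Complex.add_re, Complex.add_im, Complex.mul_re, Complex.mul_im,
    Complex.ofReal_re, Complex.ofReal_im, Complex.conj_re, Complex.conj_im, Complex.sub_re,
    Complex.sub_im, Complex.I_re, Complex.I_im, pow_two, Complex.one_re, Complex.one_im,
    Complex.re_ofNat, Complex.im_ofNat]
  ring

lemma r_bet_le (hς : ς ^ 2 = 1) : |S.r ς P z * S.bet ς P z| ≤
    |S.r ς P z| * ‖S.t z‖ * S.h P z := by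
  rw [abs_mul, mul_assoc]
  exact mul_le_mul_of_nonneg_left (abs_bet_le hς) (abs_nonneg _)

lemma r_bet_le' (hς : ς ^ 2 = 1) : 4 * |S.r ς P z * S.bet ς P z| ≤
    4 * S.a z * S.r ς P z ^ 2 + S.h P z ^ 2 := by
  have h1 := r_bet_le (S := S) (P := P) (z := z) hς
  rw [← norm_t_sq, ← sq_abs (S.r ς P z)]
  nlinarith [sq_nonneg (2 * ‖S.t z‖ * |S.r ς P z| - S.h P z)]

lemma r_bet_le'' (hς : ς ^ 2 = 1) : 2 * |S.r ς P z * S.bet ς P z| ≤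
    S.a z * S.r ς P z ^ 2 + S.h P z ^ 2 := by
  have h1 := r_bet_le (S := S) (P := P) (z := z) hς
  rw [← norm_t_sq, ← sq_abs (S.r ς P z)]
  nlinarith [sq_nonneg (‖S.t z‖ * |S.r ς P z| - S.h P z)]

namespace Adm
variable {c C : ℝ} (A : Adm S P c C)
include A

lemma h_le_six (hz : z ∈ Hset) : S.h P z ≤ 6 := by
  by_contra hc
  push Not at hc
  obtain ⟨M, hM0, hM⟩ := A.exists_h_le
  have hl := lap_h (ς := 1) (by norm_num) A.u_pos
  obtain ⟨w, hw, -, h1, h2, h3⟩ := omori_yau S (continuousOn_of_lap hl) hM hz hc isOpen_Hset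
    subset_rfl (fun z hz _ => hz) hl (ε := 1 / (1 + M)) (by positivity)
  have h4 := inner_X_grad_h (S := S) (P := P) (z := w) (ς := 1)
  have h5 := re_mul_conj_le (S.X P w) (2 * (1 - S.h P w) * S.X P w +
        2 * S.r 1 P w * ((1:ℝ) * Complex.I * conj (S.t w) * conj (S.X P w)))
  rw [h4] at h5
  have h6 : ‖S.X P w‖ ≤ 1 + M := by
    have := hM w hw
    rw [← norm_X_sq] at this
    nlinarith [norm_nonneg (S.X P w)]
  have h7 : ‖S.X P w‖ * ‖(2 * (1 - S.h P w) * S.X P w +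
        2 * S.r 1 P w * ((1:ℝ) * Complex.I * conj (S.t w) * conj (S.X P w)) : ℂ)‖ ≤ 1 := by
    calc _ ≤ (1 + M) * (1 / (1 + M)) := by gcongr
      _ = 1 := by field_simp
  have h8 : 1 / (1 + M) ≤ 1 := by
    rw [div_le_one (by positivity)]; linarith
  have h9 := r_bet_le' (S := S) (P := P) (z := w) (ς := 1) (by norm_num)
  have h10 := (abs_le.mp (h5.trans h7)).2
  have h11 := neg_abs_le (S.r 1 P w * S.bet 1 P w)
  have h12 := le_abs_self (S.r 1 P w * S.bet 1 P w)
  have h13 : 0 ≤ S.a w * S.h P w := mul_nonneg a_nonneg h_nonneg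
  nlinarith

end Adm
end Surf

end

section

namespace Surf

/-- The gradient of `r`. -/
def gr (S : Surf) (ς : ℝ) (P : Fin 4 → ℝ) (z : ℂ) : ℂ :=
  ς * Complex.I * conj (S.t z) * conj (S.X P z) - S.r ς P z * S.X P z

/-- The gradient of `h`. -/
def gh (S : Surf) (ς : ℝ) (P : Fin 4 → ℝ) (z : ℂ) : ℂ :=
  2 * (1 - S.h P z) * S.X P z + 2 * S.r ς P z * (ς * Complex.I * conj (S.t z) * conj (S.X P z))

/-- A factor of the gradient of `a r²`. -/
def zet (S : Surf) (ς : ℝ) (P : Fin 4 → ℝ) (z : ℂ) : ℂ :=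
  2 * S.r ς P z * S.om z + 2 * conj (S.t z) * S.gr ς P z

variable {S : Surf} {P : Fin 4 → ℝ} {z : ℂ} {ς : ℝ}

lemma lap_T (hς : ς ^ 2 = 1) (hu : ∀ z ∈ Hset, 0 < S.u P z) :
    HasLap S.t Hset (fun z => S.a z * S.r ς P z ^ 2)
      (fun z => S.r ς P z * S.t z * S.zet ς P z)
      (fun z => -8 * (1 - S.a z) * (S.a z * S.r ς P z ^ 2) + Complex.normSq (S.zet ς P z)
        + 2 * (S.a z * S.r ς P z ^ 2) * S.h P z - 2 * S.a z ^ 2 * S.h P z) := by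
  have h1 := lap_a.mul ((lap_r (ς := ς) hu).mul (lap_r (ς := ς) hu))
  refine (h1.congr isOpen_Hset ?_ ?_).congr_fun isOpen_Hset ?_
  · intro z hz
    have : (S.a z : ℂ) = S.t z * conj (S.t z) := (Complex.mul_conj _).symm
    unfold zet gr
    push_cast
    rw [this]
    ring
  · intro z hz
    have hg := normSq_grad_r (S := S) (P := P) (z := z) (ς := ς)
    rw [hς] at hg
    rw [Complex.mul_conj, Complex.ofReal_re, hg]
    unfold zet
    have e2 : Complex.normSq (2 * S.r ς P z * S.om z + 2 * conj (S.t z) * S.gr ς P z) =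
        4 * S.r ς P z ^ 2 * Complex.normSq (S.om z) + 4 * S.a z * Complex.normSq (S.gr ς P z)
        + 8 * S.r ς P z * (S.om z * S.t z * conj (S.gr ς P z)).re := by
      unfold a
      generalize S.gr ς P z = g
      generalize S.r ς P z = r
      simp only [Complex.normSq_apply, Complex.add_re, Complex.add_im, Complex.mul_re,
        Complex.mul_im, Complex.ofReal_re, Complex.ofReal_im, Complex.conj_re, Complex.conj_im,
        Complex.re_ofNat, Complex.im_ofNat]
      ring
    have hg' : Complex.normSq (S.gr ς P z) = (1 * S.a z + S.r ς P z ^ 2) * S.h P z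
      - 2 * S.r ς P z * S.bet ς P z := hg
    rw [e2, hg']
    have e3 : (2 * S.t z * S.om z * conj ((S.r ς P z : ℂ) * (ς * Complex.I * conj (S.t z) * conj (S.X P z) - S.r ς P z * S.X P z) + S.r ς P z * (ς * Complex.I * conj (S.t z) * conj (S.X P z) - S.r ς P z * S.X P z))).re = 4 * S.r ς P z * (S.om z * S.t z * conj (S.gr ς P z)).re := by
      have : (2 * S.t z * S.om z * conj ((S.r ς P z : ℂ) * (ς * Complex.I * conj (S.t z) * conj (S.X P z) - S.r ς P z * S.X P z) + S.r ς P z * (ς * Complex.I * conj (S.t z) * conj (S.X P z) - S.r ς P z * S.X P z))) = ((4 * S.r ς P z : ℝ) : ℂ) * (S.om z * S.t z * conj (S.gr ς P z)) := by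
        change (2 * S.t z * S.om z * conj ((S.r ς P z : ℂ) * S.gr ς P z + S.r ς P z * S.gr ς P z)) = _
        simp only [map_add, map_mul, Complex.conj_ofReal]
        push_cast
        ring
      rw [this, Complex.re_ofReal_mul]
    rw [e3]
    ring
  · intro z hz
    ring

lemma lap_T_bound : -(S.a z * S.r ς P z ^ 2 * S.h P z) ≤ Complex.normSq (S.zet ς P z)
    + 2 * (S.X P z * conj (S.r ς P z * S.t z * S.zet ς P z)).re := by
  have : Complex.normSq (S.zet ς P z) + 2 * (S.X P z * conj (S.r ς P z * S.t z * S.zet ς P z)).re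
    + S.a z * S.r ς P z ^ 2 * S.h P z
      = Complex.normSq (S.zet ς P z + S.r ς P z * conj (S.t z) * S.X P z) := by
    unfold a h
    generalize S.zet ς P z = g
    generalize S.r ς P z = r
    simp only [Complex.normSq_apply, Complex.add_re, Complex.add_im, Complex.mul_re,
        Complex.mul_im, Complex.ofReal_re, Complex.ofReal_im, Complex.conj_re, Complex.conj_im,
        Complex.re_ofNat, Complex.im_ofNat]
    ring
  have h2 := Complex.normSq_nonneg (S.zet ς P z + S.r ς P z * conj (S.t z) * S.X P z)
  linarith

lemma Adm.T_le {c C : ℝ} (A : Adm S P c C) (hς : ς ^ 2 = 1) (hz : z ∈ Hset) :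
    S.a z * S.r ς P z ^ 2 ≤ 126 := by
  have hl := (lap_T hς A.u_pos).add ((lap_h hς A.u_pos).const_mul 5)
  by_contra hc
  push Not at hc
  have hM : ∀ z ∈ Hset, S.a z * S.r ς P z ^ 2 + 5 * S.h P z ≤ C ^ 2 + 5 * 6 := by
    intro z hz
    have h1 := A.r_sq_le hς hz
    have h2 := A.h_le_six hz
    have h3 := a_lt_one (S := S) hz
    have h4 := a_nonneg (S := S) (z := z)
    nlinarith [sq_nonneg (S.r ς P z)]
  have hc' : 126 < S.a z * S.r ς P z ^ 2 + 5 * S.h P z := by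
    have := h_nonneg (S := S) (P := P) (z := z)
    linarith
  obtain ⟨w, hw, -, h1, h2, h3⟩ := omori_yau S (continuousOn_of_lap hl) hM hz hc' isOpen_Hset
    subset_rfl (fun z hz _ => hz) hl (ε := 1) (by positivity)
  change ‖S.r ς P w * S.t w * S.zet ς P w + (5:ℝ) * S.gh ς P w‖ ≤ 1 at h2
  have h6 : ‖S.X P w‖ ≤ 3 := by
    have := A.h_le_six hw
    rw [← norm_X_sq] at this
    nlinarith [norm_nonneg (S.X P w)]
  have h7 : |(S.X P w * conj (S.r ς P w * S.t w * S.zet ς P w + (5:ℝ) * S.gh ς P w)).re| ≤ 3 := by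
    refine (re_mul_conj_le _ _).trans ?_
    nlinarith [norm_nonneg (S.X P w), norm_nonneg (S.r ς P w * S.t w * S.zet ς P w + (5:ℝ) * S.gh ς P w)]
  have h8 : (S.X P w * conj (S.gh ς P w)).re = _ := inner_X_grad_h
  have h9 := lap_T_bound (S := S) (P := P) (z := w) (ς := ς)
  have h10 : (S.X P w * conj (S.r ς P w * S.t w * S.zet ς P w + (5:ℝ) * S.gh ς P w)).re =
    (S.X P w * conj (S.r ς P w * S.t w * S.zet ς P w)).re +
      5 * (S.X P w * conj (S.gh ς P w)).re := by
    rw [map_add, mul_add, Complex.add_re, map_mul (starRingEnd ℂ) ((5:ℝ):ℂ), Complex.conj_ofReal,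
      mul_left_comm, Complex.re_ofReal_mul]
  rw [h10, h8] at h7
  have h11 := (abs_le.mp h7).2
  have h12 := r_bet_le'' (S := S) (P := P) (z := w) hς
  have h13 := neg_abs_le (S.r ς P w * S.bet ς P w)
  have h14 := le_abs_self (S.r ς P w * S.bet ς P w)
  have ha0 := a_nonneg (S := S) (z := w)
  have ha1 := a_lt_one (S := S) hw
  have hh := h_nonneg (S := S) (P := P) (z := w)
  have hh6 := A.h_le_six hw
  have h15 : 0 ≤ S.a w * S.h P w := mul_nonneg ha0 hh
  have h16 : S.a w ^ 2 * S.h P w ≤ S.h P w := by nlinarith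
  have hT : 0 ≤ S.a w * S.r ς P w ^ 2 := by positivity
  have h17 : 0 ≤ S.a w * S.r ς P w ^ 2 * S.h P w := by positivity
  have h18 : 0 ≤ S.a w * (S.a w * S.r ς P w ^ 2) := by positivity
  nlinarith

end Surf

end

section

/-- The profile of the barrier in the variable `a`. -/
def kap (x : ℝ) : ℝ := (-(Real.log x) / 2)⁻¹

lemma kap_nonneg {x : ℝ} (h0 : 0 ≤ x) (h1 : x ≤ 1) : 0 ≤ kap x := by
  unfold kap
  have := Real.log_nonpos h0 h1
  apply inv_nonneg.mpr
  linarith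

lemma kap_le {x y : ℝ} (h0 : 0 ≤ x) (hxy : x ≤ y) (h1 : y < 1) : kap x ≤ kap y := by
  rcases h0.eq_or_lt with h | h
  · rw [← h]
    have : kap 0 = 0 := by simp [kap]
    rw [this]
    exact kap_nonneg (by linarith) h1.le
  · unfold kap
    have h2 := Real.log_le_log h hxy
    have h3 := Real.log_neg (h.trans_le hxy) h1
    apply inv_anti₀ <;> linarith

lemma continuousAt_kap {x : ℝ} (h0 : 0 ≤ x) (h1 : x < 1) : ContinuousAt kap x := by
  rcases h0.eq_or_lt with h | h
  · rw [← h, continuousAt_iff_punctured_nhds]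
    have : kap 0 = 0 := by simp [kap]
    rw [this]
    refine Tendsto.inv_tendsto_atTop ?_
    exact (tendsto_neg_atBot_atTop.comp Real.tendsto_log_nhdsNE_zero).atTop_div_const (by norm_num)
  · unfold kap
    have h3 := Real.log_neg h h1
    have := Real.continuousAt_log h.ne'
    exact (this.neg.div_const 2).inv₀ (by simp only [Pi.neg_apply]; linarith)

set_option maxHeartbeats 1000000 in
/-- The algebraic core of the barrier estimate. -/
lemma barrier_core {X t gr gh Y E : ℂ} {r a h y β lr lh lG δ ρ : ℝ} (hr : 1 < r) (hr' : r ≤ 24)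
    (hX : ‖X‖ ^ 2 = h) (ht : ‖t‖ ^ 2 = a) (ht1 : ‖t‖ ≤ 1) (hh : h ≤ 6) (hρ : ρ = (r * (r - 1))⁻¹)
    (hgr : ‖gr‖ ^ 2 = (a + r ^ 2) * h - 2 * r * β) (hβ : |β| ≤ ‖t‖ * h)
    (hXr : (X * conj gr).re = β - r * h)
    (hXh : (X * conj gh).re = 2 * (1 - h) * h + 2 * r * β)
    (hgh : ‖gh‖ ≤ 2 * |1 - h| * ‖X‖ + 2 * r * ‖t‖ * ‖X‖)
    (hy : 1 - a ≤ -y)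
    (hE : (6000 * ρ : ℝ) * gr - Y + (2 : ℝ) * gh = E) (hEδ : ‖E‖ ≤ δ) (hδ : δ ≤ 1 / 100)
    (hlr : lr = -2 * (1 - a) * r - 2 * (X * conj gr).re)
    (hlh : lh = 4 - 6 * h + 2 * h ^ 2 + 4 * (a * r ^ 2) + 2 * a * h - 4 * r * β
      - 2 * (X * conj gh).re)
    (hlG : lG = 6000 * (ρ * lr - (2 * r - 1) * ρ ^ 2 * ‖gr‖ ^ 2) +
      (4 * (1 - a) / y + ‖Y‖ ^ 2) + 2 * lh) (hlGδ : lG ≤ δ) :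
    r - 1 ≤ 4000 * (1 - a) := by
  have hδ0 : 0 ≤ δ := (norm_nonneg _).trans hEδ
  have hh0 : 0 ≤ h := by rw [← hX]; positivity
  have ha0 : 0 ≤ a := by rw [← ht]; positivity
  have ha1 : a ≤ 1 := by rw [← ht]; nlinarith [norm_nonneg t]
  have hX3 : ‖X‖ ≤ 3 := by nlinarith [norm_nonneg X]
  have hβ1 : |β| ≤ h := hβ.trans (by nlinarith [norm_nonneg t])
  obtain ⟨hβa, hβb⟩ := abs_le.mp hβ1
  have hr1 : 0 < r - 1 := by linarith
  have hρ0 : 0 < ρ := by rw [hρ]; positivity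
  -- the gradient of `r` is not too small
  have hgr1 : (r - 1) ^ 2 * h ≤ ‖gr‖ ^ 2 := by
    rw [hgr, ← ht]
    have h1 : β ≤ ‖t‖ * h := (abs_le.mp hβ).2
    have h2 : 2 * r * β ≤ 2 * r * (‖t‖ * h) := by gcongr
    have h3 : (r - 1) ^ 2 ≤ (r - ‖t‖) ^ 2 := by
      apply pow_le_pow_left₀ hr1.le; linarith
    nlinarith [mul_le_mul_of_nonneg_right h3 hh0]
  set N := ρ ^ 2 * ‖gr‖ ^ 2 with hN
  have hN0 : 0 ≤ N := by positivity
  have hNh : h ≤ 576 * N := by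
    have h1 : ρ ^ 2 * ((r - 1) ^ 2 * h) ≤ N := by rw [hN]; gcongr
    have h2 : ρ ^ 2 * ((r - 1) ^ 2 * h) = h / r ^ 2 := by rw [hρ]; field_simp
    rw [h2, div_le_iff₀ (by positivity)] at h1
    have h3 : N * r ^ 2 ≤ N * 24 ^ 2 := by gcongr
    linarith
  have hgh2 : ‖gh‖ ^ 2 ≤ 3364 * h := by
    have h1 : |1 - h| ≤ 5 := by rw [abs_le]; constructor <;> linarith
    have h2 : r * ‖t‖ ≤ 24 := by nlinarith [norm_nonneg t]
    have h3 : ‖gh‖ ≤ 58 * ‖X‖ := by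
      have h4 := mul_le_mul_of_nonneg_right h1 (norm_nonneg X)
      have h5 := mul_le_mul_of_nonneg_right h2 (norm_nonneg X)
      linarith
    calc ‖gh‖ ^ 2 ≤ (58 * ‖X‖) ^ 2 := by gcongr
      _ = 3364 * h := by rw [← hX]; ring
  set W : ℂ := (6000 * ρ : ℝ) * gr + (2 : ℝ) * gh with hW
  have hY : Y = W - E := by rw [← hE, hW]; ring
  have hYsq : ‖W‖ ^ 2 / 2 - δ ^ 2 ≤ ‖Y‖ ^ 2 := by
    have h1 : ‖W‖ ≤ ‖Y‖ + ‖E‖ := by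
      calc ‖W‖ = ‖Y + E‖ := by rw [hY]; ring_nf
        _ ≤ _ := norm_add_le _ _
    have h2 : ‖W‖ ^ 2 ≤ (‖Y‖ + ‖E‖) ^ 2 := by gcongr
    have h3 : ‖E‖ ^ 2 ≤ δ ^ 2 := by gcongr
    nlinarith [sq_nonneg (‖Y‖ - ‖E‖)]
  have hWsq : 18000000 * N - 13456 * h ≤ ‖W‖ ^ 2 := by
    have h1 : 6000 * ρ * ‖gr‖ ≤ ‖W‖ + 2 * ‖gh‖ := by
      calc 6000 * ρ * ‖gr‖ = ‖W + (-((2 : ℝ) * gh) : ℂ)‖ := by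
            rw [hW, add_neg_cancel_right, norm_mul, Complex.norm_real, Real.norm_of_nonneg]
            positivity
        _ ≤ ‖W‖ + ‖(-((2 : ℝ) * gh) : ℂ)‖ := norm_add_le _ _
        _ = _ := by rw [norm_neg, norm_mul, Complex.norm_real]; norm_num
    have h2 : (6000 * ρ * ‖gr‖) ^ 2 ≤ (‖W‖ + 2 * ‖gh‖) ^ 2 := by gcongr
    have h3 : (6000 * ρ * ‖gr‖) ^ 2 = 36000000 * N := by rw [hN]; ring
    nlinarith [sq_nonneg (‖W‖ - 2 * ‖gh‖)]
  have hXE : |(X * conj E).re| ≤ 3 * δ := by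
    refine (re_mul_conj_le _ _).trans ?_
    exact mul_le_mul hX3 hEδ (norm_nonneg _) (by norm_num)
  obtain ⟨hXE1, hXE2⟩ := abs_le.mp hXE
  have hYexp : (X * conj Y).re = 6000 * ρ * (X * conj gr).re + 2 * (X * conj gh).re
      - (X * conj E).re := by
    rw [hY, hW]
    simp only [map_sub, map_add, map_mul, Complex.conj_ofReal]
    rw [mul_sub, mul_add, Complex.sub_re, Complex.add_re, mul_left_comm, mul_left_comm X,
      Complex.re_ofReal_mul, Complex.re_ofReal_mul]
  have hEexp : (X * conj E).re = 6000 * ρ * (X * conj gr).re + 2 * (X * conj gh).re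
      - (X * conj Y).re := by linarith
  have hXr0 : (X * conj gr).re ≤ 0 := by
    have := mul_le_mul_of_nonneg_right hr.le hh0
    rw [hXr]; linarith
  have hXr1 : ρ * (X * conj gr).re ≤ 0 := mul_nonpos_of_nonneg_of_nonpos hρ0.le hXr0
  have hyy : -4 ≤ 4 * (1 - a) / y := by
    rcases eq_or_ne y 0 with h | h
    · rw [h]; norm_num
    · have hy0 : y < 0 := lt_of_le_of_ne (by linarith) h
      rw [le_div_iff_of_neg hy0]
      linarith
  have hrβ0 : |r * β| ≤ 24 * h := by
    rw [abs_mul, abs_of_pos (by linarith)]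
    exact mul_le_mul hr' hβ1 (abs_nonneg _) (by norm_num)
  obtain ⟨hrβ', hrβ⟩ := abs_le.mp hrβ0
  have hhh : 0 ≤ h * h := mul_nonneg hh0 hh0
  have hXh1 : (X * conj gh).re ≤ 58 * h := by rw [hXh]; linarith
  have hρr : ρ * r = (r - 1)⁻¹ := by rw [hρ]; field_simp
  have hN47 : (2 * r - 1) * N ≤ 47 * N := by gcongr; linarith
  have key : lG + 2 * (X * conj E).re = -12000 * ((1 - a) * (ρ * r)) - 6000 * ((2 * r - 1) * N)
      + 4 * (1 - a) / y + ‖Y‖ ^ 2 - 2 * (X * conj Y).re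
      + 2 * (4 - 6 * h + 2 * h ^ 2 + 4 * (a * r ^ 2) + 2 * a * h - 4 * r * β) := by
    rw [hlG, hlr, hlh, hN, hEexp]
    ring
  have hT : 0 ≤ a * r ^ 2 := by positivity
  have hah : 0 ≤ a * h := by positivity
  have hδ2 : δ ^ 2 ≤ 1 / 100 := by
    have := mul_le_mul hδ hδ hδ0 (by norm_num)
    linarith
  have fin : 3 ≤ 12000 * ((1 - a) * (ρ * r)) := by linarith
  rw [hρr, ← div_eq_mul_inv, mul_div_assoc', le_div_iff₀ hr1] at fin
  linarith

end

section

namespace Surf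

variable {S : Surf} {P : Fin 4 → ℝ} {z : ℂ} {ς : ℝ}

lemma inner_X_grad_r : (S.X P z * conj (S.gr ς P z)).re =
    S.bet ς P z - S.r ς P z * S.h P z := by
  unfold bet h gr
  generalize S.r ς P z = r
  simp only [Complex.normSq_apply, Complex.add_re, Complex.add_im, Complex.mul_re, Complex.mul_im,
    Complex.ofReal_re, Complex.ofReal_im, Complex.conj_re, Complex.conj_im, Complex.sub_re,
    Complex.sub_im, Complex.I_re, Complex.I_im, pow_two]
  ring

lemma norm_gh_le (hς : |ς| = 1) (hr : 0 ≤ S.r ς P z) : ‖S.gh ς P z‖ ≤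
    2 * |1 - S.h P z| * ‖S.X P z‖ + 2 * S.r ς P z * ‖S.t z‖ * ‖S.X P z‖ := by
  unfold gh
  refine (norm_add_le _ _).trans (le_of_eq ?_)
  congr 1
  · rw [norm_mul, norm_mul, ← Complex.ofReal_one, ← Complex.ofReal_sub, Complex.norm_real]
    norm_num
  · simp only [norm_mul, Complex.norm_real, Complex.norm_conj, Complex.norm_I]
    rw [Real.norm_eq_abs, Real.norm_eq_abs, hς, abs_of_nonneg hr]
    norm_num
    ring

/-- The barrier function. -/
def barF (S : Surf) (ς : ℝ) (P : Fin 4 → ℝ) (z : ℂ) : ℝ :=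
  (max (S.r ς P z - 1) 0 / max (S.r ς P z) 1) ^ 6000 * Real.exp (2 * S.h P z) * kap (S.a z)

/-- The region where the barrier is positive. -/
def barΩ (S : Surf) (ς : ℝ) (P : Fin 4 → ℝ) : Set ℂ :=
  {z | z ∈ Hset ∧ 1 < S.r ς P z ∧ 0 < S.a z}

lemma continuousOn_barF (hς : ς ^ 2 = 1) (hu : ∀ z ∈ Hset, 0 < S.u P z) :
    ContinuousOn (S.barF ς P) Hset := by
  have h1 := continuousOn_of_lap (lap_r (ς := ς) hu)
  have h2 := continuousOn_of_lap (lap_h hς hu)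
  unfold barF
  refine ContinuousOn.mul (ContinuousOn.mul (ContinuousOn.pow (ContinuousOn.div ?_ ?_ ?_) _) ?_) ?_
  · exact (h1.sub continuousOn_const).sup continuousOn_const
  · exact h1.sup continuousOn_const
  · intro z hz
    have : (1:ℝ) ≤ max (S.r ς P z) 1 := le_max_right _ _
    positivity
  · exact Real.continuous_exp.comp_continuousOn (continuousOn_const.mul h2)
  · intro z hz
    exact ((continuousAt_kap a_nonneg (a_lt_one hz)).comp (continuousAt_a hz)).continuousWithinAt

lemma isOpen_barΩ (hu : ∀ z ∈ Hset, 0 < S.u P z) : IsOpen (S.barΩ ς P) := by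
  have h1 := continuousOn_of_lap (lap_r (ς := ς) hu)
  have h2 := continuousOn_a (S := S)
  have e : S.barΩ ς P = (Hset ∩ S.r ς P ⁻¹' Ioi 1) ∩ (Hset ∩ S.a ⁻¹' Ioi 0) := by
    ext z; simp only [barΩ, mem_ofPred_eq, mem_inter_iff, mem_preimage, mem_Ioi]; tauto
  rw [e]
  exact (h1.isOpen_inter_preimage isOpen_Hset isOpen_Ioi).inter
    (h2.isOpen_inter_preimage isOpen_Hset isOpen_Ioi)

lemma ratio_mem (r : ℝ) : 0 ≤ max (r - 1) 0 / max r 1 ∧ max (r - 1) 0 / max r 1 ≤ 1 := by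
  have h1 : (1:ℝ) ≤ max r 1 := le_max_right _ _
  have h2 : r ≤ max r 1 := le_max_left _ _
  have h3 : max (r - 1) 0 ≤ max r 1 := max_le (by linarith) (by linarith)
  constructor
  · positivity
  · exact div_le_one_of_le₀ h3 (by linarith)

/-- The logarithm of the barrier. -/
def barG (S : Surf) (ς : ℝ) (P : Fin 4 → ℝ) (z : ℂ) : ℝ :=
  6000 * (Real.log (S.r ς P z - 1) - Real.log (S.r ς P z)) + -Real.log (-(Real.log (S.a z)) / 2)
    + 2 * S.h P z

lemma barF_eq (hz : z ∈ S.barΩ ς P) : S.barF ς P z = Real.exp (S.barG ς P z) := by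
  obtain ⟨hz, hr, ha⟩ := hz
  have hl := Real.log_neg ha (a_lt_one hz)
  unfold barF barG kap
  rw [max_eq_left (by linarith), max_eq_left hr.le, Real.exp_add, Real.exp_add, Real.exp_neg,
    Real.exp_log (by linarith), ← Real.log_div (by linarith) (by linarith)]
  have key : ∀ m : ℕ, ∀ x : ℝ, 0 < x → x ^ m = Real.exp (m * Real.log x) := by
    intro m x hx
    rw [Real.exp_nat_mul, Real.exp_log hx]
  rw [key 6000 _ (div_pos (by linarith) (by linarith)), Nat.cast_ofNat]
  exact mul_right_comm _ _ _

lemma hasDerivAt_log_sub_log {x : ℝ} (hx : 1 < x) :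
    HasDerivAt (fun x => Real.log (x - 1) - Real.log x) ((x * (x - 1))⁻¹) x := by
  have h1 : x - 1 ≠ 0 := by linarith
  have h2 : x ≠ 0 := by linarith
  have := (((hasDerivAt_id x).sub_const 1).log h1).sub (Real.hasDerivAt_log h2)
  refine this.congr_deriv ?_
  simp only [id]
  field_simp
  ring

lemma hasDerivAt_inv_mul_sub {x : ℝ} (hx : 1 < x) :
    HasDerivAt (fun x => (x * (x - 1))⁻¹) (-(2 * x - 1) * ((x * (x - 1))⁻¹) ^ 2) x := by
  have h1 : x - 1 ≠ 0 := by linarith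
  have h2 : x ≠ 0 := by linarith
  have := ((hasDerivAt_id x).mul ((hasDerivAt_id x).sub_const 1)).inv (by simp [h1, h2])
  refine this.congr_deriv ?_
  simp only [Pi.mul_apply, id]
  field_simp
  ring

lemma hasDerivAt_neg_log_neg_log {x : ℝ} (hx : 0 < x) (hx1 : x < 1) :
    HasDerivAt (fun x => -Real.log (-(Real.log x) / 2)) (-(x * Real.log x)⁻¹) x := by
  have h1 := Real.log_neg hx hx1
  have := (((Real.hasDerivAt_log hx.ne').neg.div_const 2).log
    (by simp only [Pi.neg_apply]; linarith)).neg
  refine this.congr_deriv ?_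
  have := h1.ne
  simp only [Pi.neg_apply]
  field_simp

lemma hasDerivAt_neg_inv_mul_log {x : ℝ} (hx : 0 < x) (hx1 : x < 1) :
    HasDerivAt (fun x => -(x * Real.log x)⁻¹)
      ((Real.log x + 1) * ((x * Real.log x)⁻¹) ^ 2) x := by
  have h1 := (Real.log_neg hx hx1).ne
  have := (((hasDerivAt_id x).mul (Real.hasDerivAt_log hx.ne')).inv
    (by simp [h1, hx.ne'])).neg
  refine this.congr_deriv ?_
  simp only [Pi.mul_apply, id]
  field_simp

lemma lap_barG (hς : ς ^ 2 = 1) (hu : ∀ z ∈ Hset, 0 < S.u P z) :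
    HasLap S.t (S.barΩ ς P) (S.barG ς P)
      (fun z => (6000 * (S.r ς P z * (S.r ς P z - 1))⁻¹ : ℝ) * S.gr ς P z
        - 2 * S.t z * S.om z * ((S.a z * Real.log (S.a z))⁻¹ : ℝ) + (2 : ℝ) * S.gh ς P z)
      (fun z => 6000 * ((S.r ς P z * (S.r ς P z - 1))⁻¹ *
          (-2 * (1 - S.a z) * S.r ς P z - 2 * (S.X P z * conj (S.gr ς P z)).re)
          - (2 * S.r ς P z - 1) * (S.r ς P z * (S.r ς P z - 1))⁻¹ ^ 2 * ‖S.gr ς P z‖ ^ 2)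
        + (4 * (1 - S.a z) / Real.log (S.a z)
          + ‖2 * S.t z * S.om z * ((S.a z * Real.log (S.a z))⁻¹ : ℝ)‖ ^ 2)
        + 2 * (4 - 6 * S.h P z + 2 * S.h P z ^ 2 + 4 * (S.a z * S.r ς P z ^ 2)
          + 2 * S.a z * S.h P z - 4 * S.r ς P z * S.bet ς P z
            - 2 * (S.X P z * conj (S.gh ς P z)).re)) := by
  have hΩ : S.barΩ ς P ⊆ Hset := fun z hz => hz.1
  have h1 := ((lap_r (ς := ς) hu).mono hΩ).comp (χ := fun x => Real.log (x - 1) - Real.log x)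
    (χ₁ := fun x => (x * (x - 1))⁻¹) (χ₂ := fun x => -(2 * x - 1) * ((x * (x - 1))⁻¹) ^ 2)
    (fun z hz => hasDerivAt_log_sub_log hz.2.1)
    (fun z hz => hasDerivAt_inv_mul_sub hz.2.1)
  have h2 := ((lap_a (S := S)).mono hΩ).comp (χ := fun x => -Real.log (-(Real.log x) / 2))
    (χ₁ := fun x => -(x * Real.log x)⁻¹)
    (χ₂ := fun x => (Real.log x + 1) * ((x * Real.log x)⁻¹) ^ 2)
    (fun z hz => hasDerivAt_neg_log_neg_log hz.2.2 (a_lt_one hz.1))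
    (fun z hz => hasDerivAt_neg_inv_mul_log hz.2.2 (a_lt_one hz.1))
  have h3 := ((h1.const_mul 6000).add h2).add (((lap_h hς hu).mono hΩ).const_mul 2)
  refine h3.congr (isOpen_barΩ hu) ?_ ?_
  · intro z hz
    unfold gr gh
    push_cast
    ring
  · rintro z ⟨hz, hr, ha⟩
    have hl := (Real.log_neg ha (a_lt_one hz)).ne
    have e1 : ‖2 * S.t z * S.om z * ((S.a z * Real.log (S.a z))⁻¹ : ℝ)‖ ^ 2 =
        4 * Complex.normSq (S.om z) * S.a z * ((S.a z * Real.log (S.a z))⁻¹) ^ 2 := by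
      rw [norm_mul, norm_mul, norm_mul, Complex.norm_real, mul_pow, mul_pow, mul_pow, norm_t_sq,
        ← Complex.normSq_eq_norm_sq (S.om z), Real.norm_eq_abs, sq_abs,
        Complex.norm_ofNat]
      ring
    have e2 : Complex.normSq (2 * S.t z * S.om z) = 4 * S.a z * Complex.normSq (S.om z) := by
      rw [map_mul, map_mul]
      unfold a
      norm_num
    have e3 : (S.X P z * conj (S.gh ς P z)).re = _ := inner_X_grad_h
    rw [e1, e2, e3, inner_X_grad_r, ← Complex.normSq_eq_norm_sq (S.gr ς P z)]
    change _ * (_ + (-(2 * S.r ς P z - 1) * (S.r ς P z * (S.r ς P z - 1))⁻¹ ^ 2) *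
      Complex.normSq (S.gr ς P z)) + _ + _ = _
    have e4 : -(S.a z * Real.log (S.a z))⁻¹ *
        (-4 * (1 - S.a z) * S.a z + 4 * Complex.normSq (S.om z)) +
        (Real.log (S.a z) + 1) * (S.a z * Real.log (S.a z))⁻¹ ^ 2 *
          (4 * S.a z * Complex.normSq (S.om z)) = 4 * (1 - S.a z) / Real.log (S.a z) +
        4 * Complex.normSq (S.om z) * S.a z * ((S.a z * Real.log (S.a z))⁻¹) ^ 2 := by
      field_simp
      ring
    rw [e4]
    ring

/-- The barrier estimate. -/
lemma Adm.barF_le {c C ℓ : ℝ} (A : Adm S P c C) (hς : ς ^ 2 = 1) (hz : z ∈ Hset)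
    (hℓ : ∀ z ∈ Hset, S.a z ≤ ℓ) (hℓ1 : ℓ < 1) :
    S.barF ς P z ≤ 8000 * Real.exp 12 := by
  have hςa : |ς| = 1 := by
    rw [← sq_abs] at hς
    nlinarith [abs_nonneg ς]
  by_contra hc
  push Not at hc
  have hu := A.u_pos
  have hE12 : 1 ≤ Real.exp 12 := Real.one_le_exp (by norm_num)
  have hfac : ∀ z ∈ Hset, Real.exp (2 * S.h P z) ≤ Real.exp 12 := by
    intro z hz
    have := A.h_le_six hz
    exact Real.exp_le_exp.mpr (by linarith)
  have hM : ∀ z ∈ Hset, S.barF ς P z ≤ Real.exp 12 * kap ℓ := by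
    intro z hz
    have h1 := ratio_mem (S.r ς P z)
    have h2 := pow_le_one₀ (n := 6000) h1.1 h1.2
    have h3 := kap_le a_nonneg (hℓ z hz) hℓ1
    have h4 := kap_nonneg (x := S.a z) a_nonneg (a_lt_one hz).le
    unfold barF
    calc _ ≤ 1 * Real.exp 12 * kap ℓ := by
          have := hfac z hz
          gcongr
      _ = _ := by ring
  have hl := (lap_barG hς hu).comp (χ := Real.exp) (χ₁ := Real.exp) (χ₂ := Real.exp)
    (fun z _ => Real.hasDerivAt_exp _) (fun z _ => Real.hasDerivAt_exp _)
  replace hl := hl.congr_fun (f' := S.barF ς P) (isOpen_barΩ hu) (fun z hz => barF_eq hz)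
  have hsup : ∀ z ∈ Hset, 8000 * Real.exp 12 < S.barF ς P z → z ∈ S.barΩ ς P := by
    intro z hz h
    have h0 : 0 < S.barF ς P z := by linarith
    refine ⟨hz, ?_, ?_⟩
    · by_contra hr
      push Not at hr
      unfold barF at h0
      rw [max_eq_right (by linarith)] at h0
      simp at h0
    · by_contra ha
      have : S.a z = 0 := le_antisymm (not_lt.mp ha) a_nonneg
      unfold barF kap at h0
      rw [this] at h0
      simp at h0
  obtain ⟨w, hw, -, h1, h2, h3⟩ := omori_yau S (continuousOn_barF hς hu) hM hz hc (isOpen_barΩ hu)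
    (fun z hz => hz.1) hsup hl (ε := 1) (by norm_num)
  have hFw := barF_eq hw
  obtain ⟨hwH, hr, ha⟩ := hw
  have ha1 := a_lt_one (S := S) hwH
  rw [← hFw] at h2 h3
  have hF0 : 8000 ≤ S.barF ς P w := by linarith
  rw [norm_mul, Complex.norm_real, Real.norm_of_nonneg (by linarith)] at h2
  have hy : 1 - S.a w ≤ -Real.log (S.a w) := by
    have := Real.log_le_sub_one_of_pos ha
    linarith
  have hkap : kap (S.a w) ≤ 2 / (1 - S.a w) := by
    unfold kap
    rw [show (2:ℝ) / (1 - S.a w) = ((1 - S.a w) / 2)⁻¹ by rw [inv_div]]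
    apply inv_anti₀ (by linarith)
    linarith
  have hratio : S.barF ς P w ≤ (max (S.r ς P w - 1) 0 / max (S.r ς P w) 1) *
      Real.exp 12 * kap (S.a w) := by
    have h1 := ratio_mem (S.r ς P w)
    have h2 := pow_le_of_le_one (n := 6000) h1.1 h1.2 (by norm_num)
    have h4 := kap_nonneg (x := S.a w) a_nonneg ha1.le
    unfold barF
    have := hfac w hwH
    have h5 := h1.1
    gcongr
  rcases le_or_gt (S.r ς P w) 24 with hr24 | hr24
  · have hconc := barrier_core (X := S.X P w) (t := S.t w) (gr := S.gr ς P w) (gh := S.gh ς P w)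
      (Y := 2 * S.t w * S.om w * ((S.a w * Real.log (S.a w))⁻¹ : ℝ)) (y := Real.log (S.a w))
      (δ := 1 / 100) hr hr24 norm_X_sq norm_t_sq (S.norm_t w hwH).le (A.h_le_six hwH) rfl
      (by rw [← Complex.normSq_eq_norm_sq]
          have := normSq_grad_r (S := S) (P := P) (z := w) (ς := ς)
          rw [hς, one_mul] at this
          exact this) (abs_bet_le hς) inner_X_grad_r inner_X_grad_h
      (norm_gh_le hςa (by linarith)) hy rfl ?_ le_rfl rfl rfl rfl ?_
    · rw [max_eq_left (by linarith), max_eq_left hr.le] at hratio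
      have h5 : (S.r ς P w - 1) / S.r ς P w ≤ S.r ς P w - 1 :=
        div_le_self (by linarith) hr.le
      have h6 : S.barF ς P w ≤ (S.r ς P w - 1) * Real.exp 12 * (2 / (1 - S.a w)) := by
        refine hratio.trans ?_
        have h4 := kap_nonneg (x := S.a w) a_nonneg ha1.le
        have : 0 ≤ S.r ς P w - 1 := by linarith
        gcongr
      have h7 : (S.r ς P w - 1) * Real.exp 12 * (2 / (1 - S.a w)) ≤
          4000 * (1 - S.a w) * Real.exp 12 * (2 / (1 - S.a w)) := by
        have : 0 < 1 - S.a w := by linarith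
        gcongr
      have h8 : 4000 * (1 - S.a w) * Real.exp 12 * (2 / (1 - S.a w)) = 8000 * Real.exp 12 := by
        have : 1 - S.a w ≠ 0 := by linarith
        field_simp
        norm_num
      linarith
    · refine le_trans ?_ (show (1:ℝ) / 8000 ≤ 1 / 100 by norm_num)
      rw [le_div_iff₀ (by norm_num)]
      refine le_trans ?_ h2
      rw [mul_comm]
      gcongr
    · set lG := 6000 * ((S.r ς P w * (S.r ς P w - 1))⁻¹ *
          (-2 * (1 - S.a w) * S.r ς P w - 2 * (S.X P w * conj (S.gr ς P w)).re)
          - (2 * S.r ς P w - 1) * (S.r ς P w * (S.r ς P w - 1))⁻¹ ^ 2 * ‖S.gr ς P w‖ ^ 2)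
        + (4 * (1 - S.a w) / Real.log (S.a w)
          + ‖2 * S.t w * S.om w * ((S.a w * Real.log (S.a w))⁻¹ : ℝ)‖ ^ 2)
        + 2 * (4 - 6 * S.h P w + 2 * S.h P w ^ 2 + 4 * (S.a w * S.r ς P w ^ 2)
          + 2 * S.a w * S.h P w - 4 * S.r ς P w * S.bet ς P w
            - 2 * (S.X P w * conj (S.gh ς P w)).re) with hlG
      have h9 : S.barF ς P w * lG ≤ 1 := by
        have : 0 ≤ S.barF ς P w * Complex.normSq ((6000 * (S.r ς P w * (S.r ς P w - 1))⁻¹ : ℝ) *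
          S.gr ς P w - 2 * S.t w * S.om w * ((S.a w * Real.log (S.a w))⁻¹ : ℝ)
          + (2 : ℝ) * S.gh ς P w) := mul_nonneg (by linarith) (Complex.normSq_nonneg _)
        linarith
      change lG ≤ 1 / 100
      by_contra hcon
      push Not at hcon
      nlinarith
  · have hT := A.T_le hς hwH
    have ha4 : S.a w ≤ 1 / 4 := by nlinarith
    have h5 := kap_le (x := S.a w) a_nonneg ha4 (by norm_num)
    have h6 : kap (1 / 4) ≤ 2 / (1 - 1 / 4) := by
      unfold kap
      rw [show (2:ℝ) / (1 - 1 / 4) = ((1 - 1 / 4) / 2)⁻¹ by rw [inv_div]]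
      have := Real.log_le_sub_one_of_pos (show (0:ℝ) < 1 / 4 by norm_num)
      apply inv_anti₀ (by norm_num)
      linarith
    have h7 : S.barF ς P w ≤ 1 * Real.exp 12 * (2 / (1 - 1 / 4)) := by
      refine hratio.trans ?_
      have h1 := ratio_mem (S.r ς P w)
      have h4 := kap_nonneg (x := S.a w) a_nonneg ha1.le
      gcongr
      · exact h1.2
      · linarith
    linarith

end Surf

end

section

lemma exists_uniform_section {E : Type*} [TopologicalSpace E] {p : E → ℂ}
    (hp : IsLocalHomeomorph p) {K : Set E} (hK : IsCompact K) :
    ∃ δ > 0, ∀ z ∈ K, ∃ e : OpenPartialHomeomorph E ℂ, z ∈ e.source ∧ p = e ∧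
      Metric.ball (p z) δ ⊆ e.target := by
  refine hK.induction_on (p := fun s => ∃ δ > 0, ∀ z ∈ s, ∃ e : OpenPartialHomeomorph E ℂ,
    z ∈ e.source ∧ p = e ∧ Metric.ball (p z) δ ⊆ e.target) ⟨1, one_pos, by simp⟩ ?_ ?_ ?_
  · rintro s t hst ⟨δ, hδ, h⟩
    exact ⟨δ, hδ, fun z hz => h z (hst hz)⟩
  · rintro s t ⟨δ, hδ, h⟩ ⟨δ', hδ', h'⟩
    refine ⟨min δ δ', lt_min hδ hδ', ?_⟩
    rintro z (hz | hz)
    · obtain ⟨e, h1, h2, h3⟩ := h z hz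
      exact ⟨e, h1, h2, (Metric.ball_subset_ball (min_le_left _ _)).trans h3⟩
    · obtain ⟨e, h1, h2, h3⟩ := h' z hz
      exact ⟨e, h1, h2, (Metric.ball_subset_ball (min_le_right _ _)).trans h3⟩
  · intro z _
    obtain ⟨e, he, hpe⟩ := hp z
    obtain ⟨δ, hδ, hb⟩ := Metric.isOpen_iff.mp e.open_target (e z) (e.map_source he)
    refine ⟨e.source ∩ p ⁻¹' Metric.ball (p z) (δ / 2), mem_nhdsWithin_of_mem_nhds
      (inter_mem (e.open_source.mem_nhds he)
        (hp.continuous.continuousAt (Metric.ball_mem_nhds _ (half_pos hδ)))),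
      δ / 2, half_pos hδ, ?_⟩
    rintro w ⟨hw1, hw2⟩
    refine ⟨e, hw1, hpe, fun x hx => hb ?_⟩
    rw [← hpe]
    rw [mem_preimage, Metric.mem_ball] at hw2
    rw [Metric.mem_ball] at hx ⊢
    linarith [dist_triangle x (p w) (p z)]

/-- A segment lifts through a local homeomorphism if all its partial lifts stay in a compact
set. -/
lemma exists_lift_segment {E : Type*} [TopologicalSpace E] {p : E → ℂ}
    (hp : IsLocalHomeomorph p) {K : Set E} (hK : IsCompact K) (z₀ : E) (w : ℂ)
    (hbd : ∀ s ∈ Icc (0:ℝ) 1, ∀ Γ : ℝ → E, ContinuousOn Γ (Icc 0 s) → Γ 0 = z₀ →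
      (∀ x ∈ Icc 0 s, p (Γ x) = p z₀ + x * (w - p z₀)) → Γ s ∈ K) :
    ∃ Γ : ℝ → E, ContinuousOn Γ (Icc 0 1) ∧ Γ 0 = z₀ ∧
      (∀ x ∈ Icc (0:ℝ) 1, p (Γ x) = p z₀ + x * (w - p z₀)) := by
  obtain ⟨δ, hδ, hsec⟩ := exists_uniform_section hp hK
  set c : ℝ := δ / (‖w - p z₀‖ + 1) with hc
  have hc0 : 0 < c := by positivity
  have hcl : c * ‖w - p z₀‖ < δ := by
    rw [hc, div_mul_eq_mul_div, div_lt_iff₀ (by positivity)]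
    nlinarith [norm_nonneg (w - p z₀)]
  have key : ∀ n : ℕ, ∃ Γ : ℝ → E, ContinuousOn Γ (Icc 0 (min (n * c) 1)) ∧ Γ 0 = z₀ ∧
      (∀ x ∈ Icc (0:ℝ) (min (n * c) 1), p (Γ x) = p z₀ + x * (w - p z₀)) := by
    intro n
    induction n with
    | zero =>
      refine ⟨fun _ => z₀, continuousOn_const, rfl, ?_⟩
      intro x hx
      have : x = 0 := by simpa using hx
      simp [this]
    | succ n ih =>
      obtain ⟨Γ, h1, h2, h3⟩ := ih
      set s := min (n * c) 1 with hs
      have hs0 : 0 ≤ s := le_min (by positivity) zero_le_one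
      have hsK := hbd s ⟨hs0, min_le_right _ _⟩ Γ h1 h2 h3
      obtain ⟨e, he1, he2, he3⟩ := hsec _ hsK
      set s' := min ((n + 1 : ℕ) * c) 1 with hs'
      have hss' : s ≤ s' := min_le_min_right _ (by push_cast; nlinarith)
      have hs's : s' ≤ s + c := by
        rw [hs, ← min_add_add_right]
        apply min_le_min
        · push_cast; linarith
        · linarith
      have htar : ∀ x ∈ Icc s s', p z₀ + x * (w - p z₀) ∈ e.target := by
        intro x hx
        apply he3
        rw [h3 s ⟨hs0, le_rfl⟩, Metric.mem_ball, dist_eq_norm]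
        rw [show p z₀ + x * (w - p z₀) - (p z₀ + s * (w - p z₀)) = ((x - s : ℝ) : ℂ) * (w - p z₀) by
          push_cast; ring, norm_mul, Complex.norm_real, Real.norm_of_nonneg (by linarith [hx.1])]
        refine lt_of_le_of_lt ?_ hcl
        gcongr
        linarith [hx.2]
      have hcont2 : ContinuousOn (fun x : ℝ => e.symm (p z₀ + x * (w - p z₀))) (Icc s s') := by
        refine e.continuousOn_symm.comp (by fun_prop) htar
      have hagree : e.symm (p z₀ + s * (w - p z₀)) = Γ s := by
        rw [← h3 s ⟨hs0, le_rfl⟩, he2, e.left_inv he1]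
      refine ⟨fun x => if x ≤ s then Γ x else e.symm (p z₀ + x * (w - p z₀)), ?_, ?_, ?_⟩
      · rw [← Icc_union_Icc_eq_Icc hs0 hss']
        refine ContinuousOn.union_of_isClosed ?_ ?_ isClosed_Icc isClosed_Icc
        · exact h1.congr fun x hx => if_pos hx.2
        · refine hcont2.congr fun x hx => ?_
          rcases hx.1.eq_or_lt with h | h
          · subst h
            simp [hagree]
          · exact if_neg (not_le.mpr h)
      · simp [hs0, h2]
      · intro x hx
        by_cases h : x ≤ s
        · simp only [h, if_true]
          exact h3 x ⟨hx.1, h⟩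
        · simp only [h, if_false]
          rw [he2, e.right_inv (by rw [← he2]; exact htar x ⟨(not_le.mp h).le, hx.2⟩)]
  obtain ⟨n, hn⟩ := exists_nat_ge (1 / c)
  obtain ⟨Γ, hΓ⟩ := key n
  rw [min_eq_right (by rwa [div_le_iff₀ hc0] at hn)] at hΓ
  exact ⟨Γ, hΓ⟩

/-- A local homeomorphism of a connected Hausdorff space to the plane, such that all segments to
points of `T` lift, is bijective over `T`. -/
lemma existsUnique_of_lift_segment {E : Type*} [TopologicalSpace E] [T2Space E]
    [PreconnectedSpace E] [Nonempty E] {p : E → ℂ} (hp : IsLocalHomeomorph p) (w : ℂ)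
    (hl : ∀ z₀ : E, ∃ Γ : ℝ → E, ContinuousOn Γ (Icc 0 1) ∧ Γ 0 = z₀ ∧
      (∀ x ∈ Icc (0:ℝ) 1, p (Γ x) = p z₀ + x * (w - p z₀))) : ∃! z, p z = w := by
  choose Γ h1 h2 h3 using hl
  have hsep : IsSeparatedMap p := T2Space.isSeparatedMap p
  let F : C(unitInterval × E, ℂ) :=
    ⟨fun q => p q.2 + ((q.1 : ℝ) : ℂ) * (w - p q.2), by
      have := hp.continuous
      fun_prop⟩
  have hc : Continuous (fun q : unitInterval × E => Γ q.2 q.1) := by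
    refine hp.continuous_lift hsep F (g := fun q => Γ q.2 q.1) ?_ ?_ ?_
    · ext q
      exact h3 q.2 q.1 q.1.2
    · simpa [h2] using continuous_id'
    · intro a
      exact (h1 a).comp_continuous continuous_subtype_val (fun x => x.2)
  have he : ∀ a b : E, Γ a 1 = Γ b 1 := by
    have hc1 : Continuous (fun a : E => Γ a 1) :=
      hc.comp (Continuous.prodMk_right (1 : unitInterval))
    refine hsep.const_of_comp hp.isLocallyInjective hc1 ?_
    intro a b
    have e1 := h3 a 1 (by simp)
    have e2 := h3 b 1 (by simp)
    simp only [Complex.ofReal_one, one_mul, add_sub_cancel] at e1 e2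
    rw [e1, e2]
  obtain ⟨z₀⟩ := ‹Nonempty E›
  refine ⟨Γ z₀ 1, by simpa using h3 z₀ 1 (by simp), ?_⟩
  intro z hz
  rw [he z₀ z]
  have hcz : Continuous (fun x : unitInterval => Γ z x) :=
    hc.comp (Continuous.prodMk_left z)
  have := hsep.const_of_comp hp.isLocallyInjective hcz (fun x y => by
    rw [h3 z x x.2, h3 z y y.2, hz]; simp) 0 1
  simpa [h2] using this

lemma norm_deriv_log_psi_le {z : ℂ} (hz : z ∈ Hset) :
    ∃ L : ℂ →L[ℝ] ℝ, HasFDerivAt (fun z => Real.log (psi z)) L z ∧ ∀ v, |L v| ≤ ‖v‖ / z.im := by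
  have hy : 0 < z.im := hz
  have hre := Complex.reCLM.hasFDerivAt (x := z)
  have him := Complex.imCLM.hasFDerivAt (x := z)
  have h1 := (((hre.mul hre).add (him.mul him)).add_const 1)
  have h0 : 0 < z.re * z.re + z.im * z.im + 1 := by
    nlinarith [mul_self_nonneg z.re, mul_self_nonneg z.im]
  have h2 := (h1.log h0.ne').sub ((him.const_mul 2).log (by simpa using hy.ne'))
  refine ⟨_, h2.congr_of_eventuallyEq ?_, ?_⟩
  · filter_upwards [isOpen_Hset.mem_nhds hz] with x hx
    have hx' : 0 < x.im := hx
    unfold psi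
    have h0' : 0 < x.re * x.re + x.im * x.im + 1 := by
      nlinarith [mul_self_nonneg x.re, mul_self_nonneg x.im]
    rw [Complex.normSq_apply, Real.log_div h0'.ne' (by positivity)]
    rfl
  · intro v
    have e : ∀ A : ℝ, A = 2 * (z.re * v.re + z.im * v.im) / (z.re * z.re + z.im * z.im + 1)
        - v.im / z.im → |A| ≤ ‖v‖ / z.im := by
      rintro A rfl
      rw [div_sub_div _ _ h0.ne' hy.ne', abs_div, abs_of_pos (mul_pos h0 hy),
        div_le_div_iff₀ (by positivity) hy]
      have h3 : |2 * (z.re * v.re + z.im * v.im) * z.im - (z.re * z.re + z.im * z.im + 1) * v.im| ≤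
          ‖v‖ * (z.re * z.re + z.im * z.im + 1) := by
        apply abs_le_of_sq_le_sq _ (by positivity)
        rw [mul_pow, ← Complex.normSq_eq_norm_sq, Complex.normSq_apply]
        nlinarith [sq_nonneg (2 * z.re * z.im * v.im - (z.im * z.im - z.re * z.re - 1) * v.re),
          sq_nonneg (z.im * v.re), sq_nonneg (z.im * v.im)]
      nlinarith
    apply e
    simp
    field_simp
    ring

lemma log_psi_lift_le {f : ℂ → ℂ} {f' : ℂ → (ℂ ≃L[ℝ] ℂ)}
    (hf : ∀ z ∈ Hset, HasStrictFDerivAt f (f' z : ℂ →L[ℝ] ℂ) z)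
    (hexp : ∀ z ∈ Hset, ∀ v, ‖v‖ / z.im ≤ ‖f' z v‖ / (f z).im)
    {w₀ w : ℂ} {m : ℝ} (hm : 0 < m) (hw₀ : m ≤ w₀.im) (hw : m ≤ w.im)
    {s : ℝ} (hs : s ∈ Icc (0:ℝ) 1) {Γ : ℝ → ℂ} (hΓ : ContinuousOn Γ (Icc 0 s))
    (hH : ∀ x ∈ Icc 0 s, Γ x ∈ Hset) (hl : ∀ x ∈ Icc 0 s, f (Γ x) = w₀ + x * (w - w₀)) :
    Real.log (psi (Γ s)) ≤ Real.log (psi (Γ 0)) + ‖w - w₀‖ / m := by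
  have hder : ∀ x ∈ Icc 0 s, HasDerivWithinAt Γ ((f' (Γ x)).symm (w - w₀)) (Icc 0 s) x := by
    intro x hx
    have hfx := hf _ (hH x hx)
    set e := hfx.toOpenPartialHomeomorph f with he
    have hmem : Γ x ∈ e.source := hfx.mem_toOpenPartialHomeomorph_source
    have hev : ∀ᶠ y in 𝓝[Icc 0 s] x, Γ y = e.symm (w₀ + y * (w - w₀)) := by
      have := (hΓ x hx).eventually (e.open_source.mem_nhds hmem)
      filter_upwards [this, self_mem_nhdsWithin] with y hy1 hy2
      rw [← hl y hy2]
      exact (e.left_inv hy1).symm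
    have hseg : HasDerivWithinAt (fun y : ℝ => w₀ + y * (w - w₀)) (w - w₀) (Icc 0 s) x := by
      have := ((Complex.ofRealCLM.hasDerivAt (x := x)).mul_const (w - w₀)).const_add w₀
      simpa using this.hasDerivWithinAt
    have hinv : HasFDerivAt e.symm ((f' (Γ x)).symm : ℂ →L[ℝ] ℂ) (w₀ + x * (w - w₀)) := by
      rw [← hl x hx]
      exact hfx.to_localInverse.hasFDerivAt
    have := hinv.comp_hasDerivWithinAt x hseg
    exact this.congr_of_eventuallyEq hev (hev.self_of_nhdsWithin hx)
  choose L hL1 hL2 using fun x : Icc 0 s => norm_deriv_log_psi_le  (hH x.1 x.2)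
  have hder2 : ∀ x (hx : x ∈ Icc 0 s), HasDerivWithinAt (fun x => Real.log (psi (Γ x)))
      (L ⟨x, hx⟩ ((f' (Γ x)).symm (w - w₀))) (Icc 0 s) x := fun x hx =>
    (hL1 ⟨x, hx⟩).comp_hasDerivWithinAt x (hder x hx)
  have hbd : ∀ x (hx : x ∈ Icc 0 s), ‖L ⟨x, hx⟩ ((f' (Γ x)).symm (w - w₀))‖ ≤ ‖w - w₀‖ / m := by
    intro x hx
    refine (hL2 ⟨x, hx⟩ _).trans ((hexp _ (hH x hx) _).trans ?_)
    rw [ContinuousLinearEquiv.apply_symm_apply]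
    apply div_le_div_of_nonneg_left (norm_nonneg _) hm
    rw [hl x hx]
    have : (w₀ + x * (w - w₀)).im = (1 - x) * w₀.im + x * w.im := by simp; ring
    rw [this]
    have h1 : x ≤ 1 := hx.2.trans hs.2
    nlinarith [hx.1, mul_nonneg hx.1 (sub_nonneg.mpr hw), mul_nonneg (sub_nonneg.mpr h1) (sub_nonneg.mpr hw₀)]
  have := (convex_Icc (0:ℝ) s).norm_image_sub_le_of_norm_hasDerivWithin_le
    (f := fun x => Real.log (psi (Γ x))) (f' := fun x => if hx : x ∈ Icc 0 s then
      L ⟨x, hx⟩ ((f' (Γ x)).symm (w - w₀)) else 0) (C := ‖w - w₀‖ / m)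
    (fun x hx => by simpa only [hx, dif_pos] using hder2 x hx)
    (fun x hx => by simpa only [hx, dif_pos] using hbd x hx) (left_mem_Icc.mpr hs.1)
    (right_mem_Icc.mpr hs.1)
  rw [Real.norm_eq_abs, Real.norm_eq_abs, sub_zero, abs_of_nonneg hs.1] at this
  have h2 := (abs_le.mp this).2
  have : ‖w - w₀‖ / m * s ≤ ‖w - w₀‖ / m * 1 := by
    gcongr
    exact hs.2
  linarith

/-- A locally expanding map of the upper half-plane is bijective and expanding at large scale. -/
theorem hadamard {f : ℂ → ℂ} {f' : ℂ → (ℂ ≃L[ℝ] ℂ)} (hmap : ∀ z ∈ Hset, f z ∈ Hset)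
    (hf : ∀ z ∈ Hset, HasStrictFDerivAt f (f' z : ℂ →L[ℝ] ℂ) z)
    (hexp : ∀ z ∈ Hset, ∀ v, ‖v‖ / z.im ≤ ‖f' z v‖ / (f z).im) :
    (∀ w ∈ Hset, ∃ z ∈ Hset, f z = w) ∧ (∀ z ∈ Hset, ∀ z' ∈ Hset, f z = f z' → z = z') ∧
    ∀ z ∈ Hset, ∀ z' ∈ Hset, ∀ m > 0, m ≤ (f z).im → m ≤ (f z').im →
      Real.log (psi z') ≤ Real.log (psi z) + ‖f z' - f z‖ / m := by
  set p : Hset → ℂ := fun z => f z with hp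
  have hlh : IsLocalHomeomorph p := by
    have h1 : IsLocalHomeomorphOn f Hset := by
      refine IsLocalHomeomorphOn.mk f Hset fun z hz => ?_
      exact ⟨(hf z hz).toOpenPartialHomeomorph f, (hf z hz).mem_toOpenPartialHomeomorph_source,
        fun _ _ => rfl⟩
    have h2 := isOpen_Hset.isOpenEmbedding_subtypeVal.isLocalHomeomorph
    rw [isLocalHomeomorph_iff_isLocalHomeomorphOn_univ] at h2 ⊢
    exact h1.comp h2 (fun z _ => z.2)
  have hconv : Convex ℝ Hset := convex_halfSpace_im_gt 0
  have : Nonempty Hset := ⟨⟨Complex.I, by simp [Hset]⟩⟩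
  have : PreconnectedSpace Hset := Subtype.preconnectedSpace hconv.isPreconnected
  have hlift : ∀ w ∈ Hset, ∀ z₀ : Hset, ∃ Γ : ℝ → Hset, ContinuousOn Γ (Icc 0 1) ∧ Γ 0 = z₀ ∧
      (∀ x ∈ Icc (0:ℝ) 1, p (Γ x) = p z₀ + x * (w - p z₀)) := by
    intro w hw z₀
    set m := min (p z₀).im w.im with hm
    have hm0 : 0 < m := lt_min (hmap z₀ z₀.2) hw
    refine exists_lift_segment hlh (K := {z : Hset | psi z ≤
      Real.exp (Real.log (psi z₀) + ‖w - p z₀‖ / m)}) ?_ z₀ w ?_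
    · rw [Subtype.isCompact_iff]
      convert isCompact_psi_le (Real.exp (Real.log (psi z₀) + ‖w - p z₀‖ / m)) using 1
      ext z
      simp [and_comm]
    · intro s hs Γ h1 h2 h3
      have := log_psi_lift_le hf hexp hm0 (min_le_left _ _) (min_le_right _ _) hs
        (Γ := fun x => (Γ x : ℂ)) (continuous_subtype_val.comp_continuousOn h1)
        (fun x _ => (Γ x).2) h3
      simp only [h2] at this
      rw [mem_ofPred_eq]
      rwa [← Real.log_le_iff_le_exp (psi_pos (Γ s).2)]
  have huniq := fun w hw => existsUnique_of_lift_segment hlh w (hlift w hw)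
  have hinj : ∀ z ∈ Hset, ∀ z' ∈ Hset, f z = f z' → z = z' := by
    intro z hz z' hz' h
    have := (huniq (f z') (hmap z' hz')).unique (y₁ := ⟨z, hz⟩) (y₂ := ⟨z', hz'⟩) h rfl
    simpa using this
  refine ⟨?_, hinj, ?_⟩
  · intro w hw
    obtain ⟨z, hz⟩ := (huniq w hw).exists
    exact ⟨z, z.2, hz⟩
  · intro z hz z' hz' m hm hmz hmz'
    obtain ⟨Γ, h1, h2, h3⟩ := hlift (f z') (hmap z' hz') ⟨z, hz⟩
    have e : (Γ 1 : ℂ) = z' := by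
      apply hinj _ (Γ 1).2 _ hz'
      simpa using h3 1 (by simp)
    have := log_psi_lift_le hf hexp hm hmz hmz' (s := 1) (by simp)
        (Γ := fun x => (Γ x : ℂ)) (continuous_subtype_val.comp_continuousOn h1)
        (fun x _ => (Γ x).2) h3
    simpa [e, h2] using this

end

section

lemma norm_coframe_ge {t : ℂ → ℂ} {z : ℂ} (hy : 0 < z.im) (ht : ‖t z‖ < 1) (v : ℂ) :
    ‖v‖ / (2 * z.im) ≤ ‖coframe t z v‖ := by
  have h1 : ‖(z.im : ℂ) * (1 - t z * conj (t z))‖ = z.im * (1 - ‖t z‖ ^ 2) := by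
    rw [Complex.mul_conj, Complex.normSq_eq_norm_sq, ← Complex.ofReal_one, ← Complex.ofReal_sub,
      ← Complex.ofReal_mul, Complex.norm_real, Real.norm_of_nonneg]
    have := norm_nonneg (t z)
    exact mul_nonneg hy.le (by nlinarith)
  have h2 : ‖v‖ - ‖t z‖ * ‖v‖ ≤ ‖v + t z * conj v‖ := by
    have := norm_sub_norm_le v (-(t z * conj v))
    rwa [norm_neg, norm_mul, RCLike.norm_conj, sub_neg_eq_add] at this
  rw [coframe_apply, norm_div, h1]
  have h3 : 0 < 1 - ‖t z‖ := by linarith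
  have h4 : 1 - ‖t z‖ ^ 2 = (1 - ‖t z‖) * (1 + ‖t z‖) := by ring
  have h5 : 0 < 1 + ‖t z‖ := by positivity
  rw [h4, div_le_div_iff₀ (by positivity) (by positivity)]
  have h6 : ‖v‖ * (z.im * ((1 - ‖t z‖) * (1 + ‖t z‖))) ≤
      (‖v‖ - ‖t z‖ * ‖v‖) * (2 * z.im) := by
    have : 0 ≤ ‖v‖ * z.im * (1 - ‖t z‖) := by positivity
    nlinarith
  exact h6.trans (mul_le_mul_of_nonneg_right h2 (by positivity))

lemma continuousAt_coframe {t : ℂ → ℂ} {z : ℂ} (hy : 0 < z.im) (ht : ‖t z‖ < 1)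
    (hc : ContinuousAt t z) : ContinuousAt (coframe t) z := by
  have h0 : ContinuousAt (fun z : ℂ => (z.im : ℂ)) z := by fun_prop
  have h1 : ContinuousAt (fun z => ((z.im : ℂ) * (1 - t z * conj (t z)))⁻¹) z := by
    refine ContinuousAt.inv₀ ?_ (frame_ne hy ht)
    exact h0.mul (continuousAt_const.sub (hc.mul (Complex.continuous_conj.continuousAt.comp hc)))
  have h2 : ContinuousAt (fun z => ContinuousLinearMap.id ℝ ℂ +
      t z • (Complex.conjCLE : ℂ →L[ℝ] ℂ)) z :=
    continuousAt_const.add (hc.smul continuousAt_const)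
  exact h1.smul h2

lemma HasDD.hasStrictFDerivAt {t f p q : ℂ → ℂ} {z : ℂ} (hy : 0 < z.im) (ht : ‖t z‖ < 1)
    (hc : ContinuousAt t z) (hf : ∀ᶠ x in 𝓝 z, HasDD t f x (p x) (q x)) (hp : ContinuousAt p z)
    (hq : ContinuousAt q z) : HasStrictFDerivAt f (p z • coframe t z +
      q z • ((Complex.conjCLE : ℂ →L[ℝ] ℂ).comp (coframe t z))) z := by
  have h := continuousAt_coframe hy ht hc
  refine hasStrictFDerivAt_of_hasFDerivAt_of_continuousAt (f' := fun x => p x • coframe t x +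
      q x • ((Complex.conjCLE : ℂ →L[ℝ] ℂ).comp (coframe t x))) hf ?_
  exact (hp.smul h).add (hq.smul (continuousAt_const.clm_comp h))

lemma norm_frame_comb_ge (p q w : ℂ) : (‖p‖ - ‖q‖) * ‖w‖ ≤ ‖p * w + q * conj w‖ := by
  have := norm_sub_norm_le (p * w) (-(q * conj w))
  rw [norm_neg, norm_mul, norm_mul, RCLike.norm_conj, sub_neg_eq_add] at this
  linarith

namespace Surf
variable {S : Surf} {z : ℂ}

/-- The coefficient vector of the surface point. -/
def PF (S : Surf) (z : ℂ) : Fin 4 → ℝ :=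
  ![(S.k z).re, -(S.k z * S.Φ z).re, -(S.k z * conj z).re, (S.k z * (conj z * S.Φ z)).re]

/-- The numerator of the Möbius action of the surface point on `x`. -/
def mobN (S : Surf) (x z : ℂ) : ℂ := S.PF z 3 + S.PF z 1 * x

/-- The denominator of the Möbius action of the surface point on `x`. -/
def mobM (S : Surf) (x z : ℂ) : ℂ := -S.PF z 2 - S.PF z 0 * x

lemma ofReal_re' (w : ℂ) : (w.re : ℂ) = (w + conj w) / 2 := by
  rw [Complex.add_conj]; push_cast; ring

lemma u_eq_PF (P : Fin 4 → ℝ) (z : ℂ) : S.u P z =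
    P 0 * S.PF z 3 - P 1 * S.PF z 2 - P 2 * S.PF z 1 + P 3 * S.PF z 0 := by
  unfold u U bipoly PF
  simp
  ring

lemma k_conj_k (hz : z ∈ Hset) :
    S.k z * conj (S.k z) * (z.im * (S.Φ z).im : ℂ) = 1 := by
  rw [Complex.mul_conj]; exact_mod_cast normSq_k hz

lemma conj_eq (w : ℂ) : conj w = w - 2 * w.im * Complex.I := by
  apply Complex.ext <;> simp; ring

lemma det4_PF (hz : z ∈ Hset) : det4 (S.PF z) = 1 := by
  have h2 := normSq_k (S := S) hz
  rw [← h2]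
  unfold det4 PF
  simp [Complex.normSq_apply]
  ring

lemma conj_mul_mobM_sub (x : ℂ) : conj (S.Φ z) * S.mobM x z - S.mobN x z =
    -Complex.I * (S.Φ z).im * S.k z * (conj z - x) := by
  unfold mobM mobN PF
  simp only [Matrix.cons_val]
  push_cast
  simp only [ofReal_re', map_mul, Complex.conj_conj, conj_eq (S.Φ z)]
  ring

lemma mul_mobM_sub (x : ℂ) : S.Φ z * S.mobM x z - S.mobN x z =
    Complex.I * (S.Φ z).im * conj (S.k z) * (z - x) := by
  unfold mobM mobN PF
  simp only [Matrix.cons_val]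
  push_cast
  simp only [ofReal_re', map_mul, Complex.conj_conj, conj_eq (S.Φ z)]
  ring

lemma im_mobN_mul_conj (hz : z ∈ Hset) (x : ℂ) : (S.mobN x z * conj (S.mobM x z)).im = x.im := by
  have h := det4_PF (S := S) hz
  unfold det4 at h
  unfold mobN mobM
  simp
  linear_combination x.im * h

lemma mobM_ne (hz : z ∈ Hset) {x : ℂ} (hx : x ∈ Hset) : S.mobM x z ≠ 0 := by
  intro h
  have := im_mobN_mul_conj (S := S) hz x
  have hx' : 0 < x.im := hx
  rw [h] at this
  simp at this
  linarith

/-- The Möbius action of the surface point on `x`. -/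
def mob (S : Surf) (x z : ℂ) : ℂ := S.mobN x z / S.mobM x z

lemma im_mob (hz : z ∈ Hset) (x : ℂ) : (S.mob x z).im = x.im / Complex.normSq (S.mobM x z) := by
  rw [← im_mobN_mul_conj (S := S) hz x, mob, Complex.div_im]
  simp
  ring

lemma mob_mem (hz : z ∈ Hset) {x : ℂ} (hx : x ∈ Hset) : S.mob x z ∈ Hset := by
  have h := Complex.normSq_pos.2 (mobM_ne (S := S) hz hx)
  have hx' : 0 < x.im := hx
  show 0 < (S.mob x z).im
  rw [im_mob hz]
  positivity

lemma dPF (hz : z ∈ Hset) :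
    HasDD S.t (fun z => (S.PF z 0 : ℂ)) z (Complex.I / 2 * conj (S.k z)) (-Complex.I / 2 * S.k z) ∧
    HasDD S.t (fun z => (S.PF z 1 : ℂ)) z (-Complex.I / 2 * conj (S.k z * S.Φ z))
      (Complex.I / 2 * (S.k z * S.Φ z)) ∧
    HasDD S.t (fun z => (S.PF z 2 : ℂ)) z (-Complex.I / 2 * conj (S.k z * z))
      (Complex.I / 2 * (S.k z * z)) ∧
    HasDD S.t (fun z => (S.PF z 3 : ℂ)) z (Complex.I / 2 * conj (S.k z * z * S.Φ z))
      (-Complex.I / 2 * (S.k z * z * S.Φ z)) := by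
  have key : ∀ P : Fin 4 → ℝ, HasDD S.t (fun z => (S.u P z : ℂ)) z
      (Complex.I / 2 * conj (S.V P z)) (-Complex.I / 2 * S.V P z) := by
    intro P
    refine (lap_u P z hz).1.ofReal.congr ?_ ?_
    · ring
    · simp; ring
  refine ⟨(key ![0, 0, 0, 1]).congr_of_eventuallyEq (.of_forall fun x => ?_) |>.congr ?_ ?_,
    (key ![0, 0, -1, 0]).congr_of_eventuallyEq (.of_forall fun x => ?_) |>.congr ?_ ?_,
    (key ![0, -1, 0, 0]).congr_of_eventuallyEq (.of_forall fun x => ?_) |>.congr ?_ ?_,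
    (key ![1, 0, 0, 0]).congr_of_eventuallyEq (.of_forall fun x => ?_) |>.congr ?_ ?_⟩
  all_goals first
    | (simp only [u_eq_PF]; simp)
    | (simp [V, bipoly]; done)
    | (simp [V, bipoly]; ring)

lemma d_mob (hz : z ∈ Hset) {x : ℂ} (hx : x ∈ Hset) : HasDD S.t (S.mob x) z
    ((conj z - x) ^ 2 / (2 * z.im * S.mobM x z ^ 2)) ((z - x) ^ 2 / (2 * z.im * S.mobM x z ^ 2)) := by
  obtain ⟨h0, h1, h2, h3⟩ := dPF (S := S) hz
  have hM := mobM_ne (S := S) hz hx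
  have hN : HasDD S.t (S.mobN x) z (Complex.I / 2 * conj (S.k z) * conj (S.Φ z) * (conj z - x))
      (-Complex.I / 2 * S.k z * S.Φ z * (z - x)) :=
    ((h3.add (h1.mul (hasDD_const x))).congr_of_eventuallyEq
      (.of_forall fun _ => rfl)).congr (by simp; ring) (by simp; ring)
  have hMd : HasDD S.t (S.mobM x) z (Complex.I / 2 * conj (S.k z) * (conj z - x))
      (-Complex.I / 2 * S.k z * (z - x)) :=
    ((h2.neg.sub (h0.mul (hasDD_const x))).congr_of_eventuallyEq
      (.of_forall fun _ => rfl)).congr (by simp; ring) (by simp; ring)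
  have e1 := conj_mul_mobM_sub (S := S) (z := z) x
  have e2 := mul_mobM_sub (S := S) (z := z) x
  have hk := k_conj_k (S := S) hz
  have hy : (z.im : ℂ) ≠ 0 := by exact_mod_cast (show 0 < z.im from hz).ne'
  refine ((hN.mul (hMd.inv hM)).congr_of_eventuallyEq
    (.of_forall fun w => div_eq_mul_inv _ _)).congr ?_ ?_
  · field_simp
    have e1' : conj (S.Φ z) * S.mobM x z = S.mobN x z
      + -Complex.I * (S.Φ z).im * S.k z * (conj z - x) := by linear_combination e1
    linear_combination (Complex.I * conj (S.k z) * (conj z - x) * z.im) * e1 +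
      (conj z - x) ^ 2 * hk - (S.Φ z).im * S.k z * conj (S.k z) * z.im * (conj z - x) ^ 2 * Complex.I_sq
  · field_simp
    linear_combination (-Complex.I * S.k z * (z - x) * z.im) * e2 +
      (z - x) ^ 2 * hk - (S.Φ z).im * S.k z * conj (S.k z) * z.im * (z - x) ^ 2 * Complex.I_sq

lemma continuousAt_PF (hz : z ∈ Hset) : ContinuousAt S.PF z := by
  obtain ⟨h0, h1, h2, h3⟩ := dPF (S := S) hz
  have key : ∀ f : ℂ → ℝ, ContinuousAt (fun x => (f x : ℂ)) z → ContinuousAt f z := by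
    intro f hf
    have := Complex.continuous_re.continuousAt.comp hf
    simpa [Function.comp_def] using this
  rw [continuousAt_pi]
  intro i
  fin_cases i
  exacts [key _ h0.continuousAt, key _ h1.continuousAt, key _ h2.continuousAt,
    key _ h3.continuousAt]

lemma continuousAt_mobM (hz : z ∈ Hset) (x : ℂ) : ContinuousAt (S.mobM x) z := by
  have h := continuousAt_PF (S := S) hz
  rw [continuousAt_pi] at h
  have := h 2
  have := h 0
  unfold mobM
  fun_prop

lemma exists_mob_deriv (hz : z ∈ Hset) {x : ℂ} (hx : x ∈ Hset) : ∃ L : ℂ ≃L[ℝ] ℂ,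
    HasStrictFDerivAt (S.mob x) (L : ℂ →L[ℝ] ℂ) z ∧
      ∀ v, ‖v‖ / z.im ≤ ‖L v‖ / (S.mob x z).im := by
  have hy : 0 < z.im := hz
  have hM := mobM_ne (S := S) hz hx
  set p : ℂ → ℂ := fun z => (conj z - x) ^ 2 / (2 * z.im * S.mobM x z ^ 2)
  set q : ℂ → ℂ := fun z => (z - x) ^ 2 / (2 * z.im * S.mobM x z ^ 2)
  have hcM := continuousAt_mobM (S := S) hz x
  have hne : (2 * z.im * S.mobM x z ^ 2 : ℂ) ≠ 0 := by
    have : (z.im : ℂ) ≠ 0 := by exact_mod_cast hy.ne'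
    simp [this, hM]
  have hden : ContinuousAt (fun z : ℂ => (2 * z.im * S.mobM x z ^ 2 : ℂ)) z := by fun_prop
  have hp : ContinuousAt p z := by
    refine ContinuousAt.div ?_ hden hne
    have := Complex.continuous_conj.continuousAt (x := z)
    fun_prop
  have hq : ContinuousAt q z := ContinuousAt.div (by fun_prop) hden hne
  have hs := HasDD.hasStrictFDerivAt (f := S.mob x) hy (S.norm_t z hz) (S.dt z hz).continuousAt
    (by filter_upwards [isOpen_Hset.mem_nhds hz] with w hw using d_mob hw hx) hp hq
  set L := p z • coframe S.t z + q z • ((Complex.conjCLE : ℂ →L[ℝ] ℂ).comp (coframe S.t z)) with hL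
  have him := mob_mem (S := S) hz hx
  have him' : 0 < (S.mob x z).im := him
  have hge : ∀ v, ‖v‖ / z.im ≤ ‖L v‖ / (S.mob x z).im := by
    intro v
    rw [le_div_iff₀ him']
    have h1 : L v = p z * coframe S.t z v + q z * conj (coframe S.t z v) := by simp [hL]
    have h2 : ‖p z‖ - ‖q z‖ = 2 * (S.mob x z).im := by
      rw [im_mob hz]
      simp only [p, q, norm_div, norm_pow, norm_mul, Complex.norm_real, Complex.norm_ofNat,
        ← Complex.normSq_eq_norm_sq]
      rw [Real.norm_of_nonneg hy.le, ← sub_div, Complex.normSq_apply, Complex.normSq_apply]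
      have := Complex.normSq_pos.2 hM
      field_simp
      simp
      ring
    rw [h1]
    refine le_trans ?_ (norm_frame_comb_ge _ _ _)
    rw [h2]
    have := norm_coframe_ge hy (S.norm_t z hz) v
    have h3 : ‖v‖ / z.im * (S.mob x z).im = 2 * (S.mob x z).im * (‖v‖ / (2 * z.im)) := by
      field_simp
    rw [h3]
    exact mul_le_mul_of_nonneg_left this (by positivity)
  have hinj : Function.Injective (L : ℂ →ₗ[ℝ] ℂ) := by
    rw [← LinearMap.ker_eq_bot, LinearMap.ker_eq_bot']
    intro v hv
    have := hge v
    rw [show L v = 0 from hv, norm_zero, zero_div] at this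
    by_contra h0
    have : 0 < ‖v‖ / z.im := div_pos (norm_pos_iff.2 h0) hy
    linarith
  refine ⟨(LinearEquiv.ofInjectiveEndo _ hinj).toContinuousLinearEquiv, ?_, hge⟩
  convert hs using 1
  exact ContinuousLinearMap.ext fun v => rfl

lemma mob_hadamard {x : ℂ} (hx : x ∈ Hset) :
    (∀ z ∈ Hset, ∀ z' ∈ Hset, S.mob x z = S.mob x z' → z = z') ∧
    ∀ z ∈ Hset, ∀ z' ∈ Hset, ∀ m > 0, m ≤ (S.mob x z).im → m ≤ (S.mob x z').im →
      Real.log (psi z') ≤ Real.log (psi z) + ‖S.mob x z' - S.mob x z‖ / m := by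
  have h : ∀ z : ℂ, ∃ L : ℂ ≃L[ℝ] ℂ, z ∈ Hset → HasStrictFDerivAt (S.mob x) (L : ℂ →L[ℝ] ℂ) z ∧
      ∀ v, ‖v‖ / z.im ≤ ‖L v‖ / (S.mob x z).im := by
    intro z
    by_cases hz : z ∈ Hset
    · obtain ⟨L, hL⟩ := exists_mob_deriv (S := S) hz hx
      exact ⟨L, fun _ => hL⟩
    · exact ⟨ContinuousLinearEquiv.refl ℝ ℂ, fun h => absurd h hz⟩
  choose L hL using h
  exact (hadamard (fun z hz => mob_mem hz hx) (fun z hz => (hL z hz).1)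
    (fun z hz => (hL z hz).2)).2

end Surf

end

section

/-- The polarization of twice the determinant. -/
def B4 (P Q : Fin 4 → ℝ) : ℝ := P 0 * Q 3 + P 3 * Q 0 - P 1 * Q 2 - P 2 * Q 1

lemma B4_self (P : Fin 4 → ℝ) : B4 P P = 2 * det4 P := by unfold B4 det4; ring

lemma B4_comm (P Q : Fin 4 → ℝ) : B4 P Q = B4 Q P := by unfold B4; ring

lemma exists_root_mem_Hset {α β γ : ℝ} (h : β ^ 2 - 4 * α * γ < 0) :
    ∃ x ∈ Hset, (α : ℂ) * x ^ 2 + β * x + γ = 0 := by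
  have hα : α ≠ 0 := by
    rintro rfl
    nlinarith [sq_nonneg β]
  have hs : 0 < √(4 * α * γ - β ^ 2) := Real.sqrt_pos.2 (by linarith)
  have hss : √(4 * α * γ - β ^ 2) ^ 2 = 4 * α * γ - β ^ 2 := Real.sq_sqrt (by linarith)
  set s := √(4 * α * γ - β ^ 2)
  refine ⟨⟨-β / (2 * α), s / (2 * |α|)⟩, ?_, ?_⟩
  · show 0 < s / (2 * |α|)
    have := abs_pos.2 hα
    positivity
  · have h1 : |α| ^ 2 = α ^ 2 := sq_abs α
    have h2 : |α| ≠ 0 := abs_ne_zero.2 hα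
    apply Complex.ext
    · simp [sq]
      have h3 : s / (2 * |α|) * (s / (2 * |α|)) = s ^ 2 / (4 * α ^ 2) := by
        rw [← h1]; field_simp; ring
      rw [h3, hss]
      field_simp
      ring
    · simp [sq]
      field_simp
      ring

namespace Surf
variable {S : Surf} {z : ℂ} {P : Fin 4 → ℝ}

lemma u_eq_B4 (P : Fin 4 → ℝ) (z : ℂ) : S.u P z = B4 P (S.PF z) := by
  rw [u_eq_PF]; unfold B4; ring

lemma B4_PF_self (hz : z ∈ Hset) : B4 (S.PF z) (S.PF z) = 2 := by
  rw [B4_self, det4_PF hz, mul_one]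

lemma four_le_B4_sq {z z' : ℂ} (hz : z ∈ Hset) (hz' : z' ∈ Hset) :
    4 ≤ B4 (S.PF z) (S.PF z') ^ 2 := by
  by_contra! h
  have h1 := det4_PF (S := S) hz
  have h2 := det4_PF (S := S) hz'
  have e0 : B4 (S.PF z) (S.PF z') ^ 2 - 4 = B4 (S.PF z) (S.PF z') ^ 2 -
      4 * det4 (S.PF z) * det4 (S.PF z') := by rw [h1, h2]; ring
  obtain ⟨x, hx, e⟩ := exists_root_mem_Hset
    (α := S.PF z 0 * S.PF z' 1 - S.PF z 1 * S.PF z' 0)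
    (β := S.PF z 0 * S.PF z' 3 - S.PF z 3 * S.PF z' 0 + S.PF z 2 * S.PF z' 1 -
      S.PF z 1 * S.PF z' 2)
    (γ := S.PF z 2 * S.PF z' 3 - S.PF z 3 * S.PF z' 2) (by
      have : B4 (S.PF z) (S.PF z') ^ 2 - 4 * det4 (S.PF z) * det4 (S.PF z') < 0 := by
        rw [← e0]; linarith
      unfold B4 det4 at this
      linarith)
  have hmob : S.mob x z = S.mob x z' := by
    unfold mob
    rw [div_eq_div_iff (mobM_ne hz hx) (mobM_ne hz' hx)]
    unfold mobN mobM
    push_cast at e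
    linear_combination e
  have := (mob_hadamard hx).1 z hz z' hz' hmob
  subst this
  rw [B4_PF_self hz] at h
  norm_num at h

lemma continuousOn_PF : ContinuousOn S.PF Hset := fun _ hz => (continuousAt_PF hz).continuousWithinAt

/-- The surface is achronal. -/
lemma two_le_B4 {z z' : ℂ} (hz : z ∈ Hset) (hz' : z' ∈ Hset) :
    2 ≤ B4 (S.PF z) (S.PF z') := by
  by_contra! h
  have h1 : B4 (S.PF z) (S.PF z') ≤ -2 := by
    have := four_le_B4_sq (S := S) hz hz'
    by_contra!
    nlinarith
  have hc : ContinuousOn (fun x => B4 (S.PF z) (S.PF x)) Hset := by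
    have h := continuousOn_PF (S := S)
    rw [continuousOn_pi] at h
    have := h 0
    have := h 1
    have := h 2
    have := h 3
    unfold B4
    fun_prop
  have hconv : IsPreconnected Hset := (convex_halfSpace_im_gt 0).isPreconnected
  have := hconv.intermediate_value hz' hz hc
  obtain ⟨x, hx, e⟩ := this (show (0:ℝ) ∈ Icc _ _ from ⟨by linarith, by
    simp only [B4_PF_self hz]; norm_num⟩)
  have := four_le_B4_sq (S := S) hz hx
  simp only at e
  rw [e] at this
  norm_num at this

/-- The surface is properly embedded. -/
lemma exists_psi_le (S : Surf) (R : ℝ) :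
    ∃ C, ∀ z ∈ Hset, ‖S.PF z‖ ≤ R → psi z ≤ C := by
  have hI : Complex.I ∈ Hset := by simp [Hset]
  set R' := max (max R ‖S.PF Complex.I‖) 1 with hR'
  have hR1 : 1 ≤ R' := le_max_right _ _
  have key : ∀ z ∈ Hset, ‖S.PF z‖ ≤ R' → 1 / (4 * R' ^ 2) ≤ (S.mob Complex.I z).im ∧
      ‖S.mob Complex.I z‖ ≤ 4 * R' ^ 2 := by
    intro z hz h
    have hc : ∀ i, ‖(S.PF z i : ℂ)‖ ≤ R' := fun i => by
      rw [Complex.norm_real]; exact (norm_le_pi_norm _ i).trans h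
    have hN : ‖S.mobN Complex.I z‖ ≤ 2 * R' := by
      unfold mobN
      refine (norm_add_le _ _).trans ?_
      rw [norm_mul, Complex.norm_I, mul_one]
      linarith [hc 3, hc 1]
    have hM : ‖S.mobM Complex.I z‖ ≤ 2 * R' := by
      unfold mobM
      refine (norm_sub_le _ _).trans ?_
      rw [norm_mul, Complex.norm_I, mul_one, norm_neg]
      linarith [hc 2, hc 0]
    have hM0 := norm_pos_iff.2 (mobM_ne (S := S) hz hI)
    have hNM : 1 ≤ ‖S.mobN Complex.I z‖ * ‖S.mobM Complex.I z‖ := by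
      have e := im_mobN_mul_conj (S := S) hz Complex.I
      have := Complex.abs_im_le_norm (S.mobN Complex.I z * conj (S.mobM Complex.I z))
      rwa [e, norm_mul, Complex.norm_conj, Complex.I_im, abs_one] at this
    constructor
    · rw [im_mob hz, Complex.I_im, Complex.normSq_eq_norm_sq]
      apply one_div_le_one_div_of_le (by positivity)
      nlinarith
    · unfold mob
      rw [norm_div, div_le_iff₀ hM0]
      have a1 := mul_le_mul_of_nonneg_left hNM (norm_nonneg (S.mobN Complex.I z))
      have a2 : ‖S.mobN Complex.I z‖ ^ 2 ≤ (2 * R') ^ 2 :=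
        pow_le_pow_left₀ (norm_nonneg _) hN 2
      have a3 := mul_le_mul_of_nonneg_right a2 hM0.le
      nlinarith
  refine ⟨Real.exp (Real.log (psi Complex.I) + (8 * R' ^ 2) / (1 / (4 * R' ^ 2))), ?_⟩
  intro z hz h
  obtain ⟨h1, h2⟩ := key z hz (h.trans ((le_max_left _ _).trans (le_max_left _ _)))
  obtain ⟨h3, h4⟩ := key _ hI ((le_max_right _ _).trans (le_max_left _ _))
  rw [← Real.log_le_iff_le_exp (psi_pos hz)]
  have hm : 0 < 1 / (4 * R' ^ 2) := by positivity
  refine ((mob_hadamard hI).2 _ hI z hz _ hm h3 h1).trans ?_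
  gcongr
  refine (norm_sub_le _ _).trans ?_
  linarith

/-- The gradient of the ratio `n / u` of a null vector forces a bound on this ratio. -/
lemma abs_n_le_of_null {ℓ : ℝ} (hℓ : ∀ z ∈ Hset, ‖S.t z‖ ≤ ℓ) (hP : det4 P = 0)
    (hu : ∀ z ∈ Hset, 0 < S.u P z) : ∀ z ∈ Hset, |S.n P z| ≤ ℓ * S.u P z := by
  intro z₀ hz₀
  by_contra! hlt
  have hℓ0 : 0 ≤ ℓ := (norm_nonneg _).trans (hℓ z₀ hz₀)
  obtain ⟨ς, hς, hςn⟩ : ∃ ς : ℝ, ς ^ 2 = 1 ∧ ς * S.n P z₀ = |S.n P z₀| := by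
    rcases le_total 0 (S.n P z₀) with h | h
    · exact ⟨1, by norm_num, by rw [abs_of_nonneg h, one_mul]⟩
    · exact ⟨-1, by norm_num, by rw [abs_of_nonpos h]; ring⟩
  have hr0 : ℓ < S.r ς P z₀ := by
    unfold r
    rw [hςn, lt_div_iff₀ (hu z₀ hz₀)]; exact hlt
  set ℓ' := (S.r ς P z₀ + ℓ) / 2 with hℓ'
  have h1 : ℓ < ℓ' := by rw [hℓ']; linarith
  have h2 : ℓ' < S.r ς P z₀ := by rw [hℓ']; linarith
  have hlap := (lap_r (ς := ς) hu).comp (χ := Real.arctan) (χ₁ := fun x => (1 + x ^ 2)⁻¹)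
    (χ₂ := fun x => -(2 * x) / (1 + x ^ 2) ^ 2)
    (fun z _ => by simpa using Real.hasDerivAt_arctan (S.r ς P z))
    (fun z _ => by
      have h : HasDerivAt (fun x : ℝ => 1 + x ^ 2) (2 * S.r ς P z) (S.r ς P z) := by
        simpa using (hasDerivAt_pow 2 (S.r ς P z)).const_add 1
      exact h.inv (by positivity))
  have hlr := lap_r (ς := ς) hu
  set ε := (ℓ' - ℓ) / √(1 + ℓ' ^ 2) / 2 with hε
  have hε0 : 0 < ε := by
    have : 0 < ℓ' - ℓ := by linarith
    positivity
  have hcr : ContinuousOn (S.r ς P) Hset := fun z hz => (hlr z hz).1.continuousAt.continuousWithinAt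
  obtain ⟨z, hz, -, h3, h4, -⟩ := S.omori_yau (M := π / 2) (c₀ := Real.arctan ℓ') (z₀ := z₀)
    (Real.continuous_arctan.comp_continuousOn hcr)
    (fun z _ => (Real.arctan_lt_pi_div_two _).le) hz₀ (Real.arctan_strictMono h2) isOpen_Hset
    subset_rfl (fun z hz _ => hz) hlap hε0
  have h5 : ℓ' < S.r ς P z := Real.arctan_strictMono.lt_iff_lt.1 h3
  have hh := h_eq (P := P) hς hz (hu z hz)
  rw [hP] at hh
  have hg := normSq_grad_r (S := S) (P := P) (z := z) (ς := ς)
  have hb := abs_bet_le (S := S) (P := P) (z := z) hς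
  set G := (ς * Complex.I * conj (S.t z) * conj (S.X P z) - S.r ς P z * S.X P z)
  set r := S.r ς P z
  have hr : 0 < r := by linarith
  have hh' : S.h P z = 1 + r ^ 2 := by rw [hh]; ring
  have hG : (r - ℓ) ^ 2 * (1 + r ^ 2) ≤ ‖G‖ ^ 2 := by
    rw [← Complex.normSq_eq_norm_sq, hg, hς, one_mul, hh']
    rw [hh'] at hb
    have h6 := (le_abs_self _).trans hb
    have h7 : S.a z = ‖S.t z‖ ^ 2 := Complex.normSq_eq_norm_sq _
    rw [h7]
    have h8 : (r - ℓ) ^ 2 ≤ (r - ‖S.t z‖) ^ 2 := by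
      have := hℓ z hz
      apply pow_le_pow_left₀ <;> linarith
    have h9 := mul_le_mul_of_nonneg_left h6 hr.le
    have h10 := mul_le_mul_of_nonneg_right h8 (show 0 ≤ 1 + r ^ 2 by positivity)
    nlinarith
  have hn : ‖(((1 + r ^ 2)⁻¹ : ℝ) : ℂ) * G‖ = (1 + r ^ 2)⁻¹ * ‖G‖ := by
    rw [norm_mul, Complex.norm_real, Real.norm_of_nonneg (by positivity)]
  rw [hn] at h4
  have hmono : (ℓ' - ℓ) ^ 2 * (1 + r ^ 2) ≤ (r - ℓ) ^ 2 * (1 + ℓ' ^ 2) := by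
    have a1 : (ℓ' - ℓ) ^ 2 ≤ (r - ℓ) ^ 2 := by apply pow_le_pow_left₀ <;> linarith
    have a2 : ((ℓ' - ℓ) * r) ^ 2 ≤ ((r - ℓ) * ℓ') ^ 2 := by
      apply pow_le_pow_left₀
      · exact mul_nonneg (by linarith) hr.le
      · nlinarith
    nlinarith
  have hs : √(1 + ℓ' ^ 2) ^ 2 = 1 + ℓ' ^ 2 := Real.sq_sqrt (by positivity)
  have hs0 : 0 < √(1 + ℓ' ^ 2) := Real.sqrt_pos.2 (by positivity)
  have hlow : (ℓ' - ℓ) / √(1 + ℓ' ^ 2) ≤ (1 + r ^ 2)⁻¹ * ‖G‖ := by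
    rw [div_le_iff₀ hs0, inv_mul_eq_div, div_mul_eq_mul_div, le_div_iff₀ (by positivity)]
    apply le_of_sq_le_sq _ (by positivity)
    rw [mul_pow, mul_pow, hs]
    have b1 := mul_le_mul_of_nonneg_right hG (show 0 ≤ 1 + ℓ' ^ 2 by positivity)
    have b2 := mul_le_mul_of_nonneg_right hmono (show 0 ≤ 1 + r ^ 2 by positivity)
    nlinarith
  rw [hε] at h4
  have : 0 < (ℓ' - ℓ) / √(1 + ℓ' ^ 2) := div_pos (by linarith) hs0
  linarith

end Surf

end

section

/-- The trace on the upper half-plane of the neighbourhoods of a boundary point. -/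
def bdryNhds (ξ : RP1) : Filter ℂ :=
  Filter.comap OnePoint.some (nhds (rp1ToSphere ξ)) ⊓ Filter.principal Hset

/-- The Euclidean length of `(z, 1)`. -/
def sph (z : ℂ) : ℝ := √(1 + ‖z‖ ^ 2)

lemma sph_pos (z : ℂ) : 0 < sph z := Real.sqrt_pos.2 (by positivity)

lemma sph_sq (z : ℂ) : sph z ^ 2 = 1 + ‖z‖ ^ 2 := Real.sq_sqrt (by positivity)

lemma comap_nhds_infty : comap (OnePoint.some : ℂ → OnePoint ℂ) (𝓝 OnePoint.infty) = cocompact ℂ := by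
  rw [OnePoint.comap_coe_nhds_infty, coclosedCompact_eq_cocompact]

lemma comap_nhds_coe (x : ℂ) : comap (OnePoint.some : ℂ → OnePoint ℂ) (𝓝 (x : OnePoint ℂ)) = 𝓝 x :=
  OnePoint.comap_coe_nhds x

lemma norm_le_sph (z : ℂ) : ‖z‖ ≤ sph z := Real.le_sqrt_of_sq_le (by linarith)

lemma continuous_sph : Continuous sph := by unfold sph; fun_prop

lemma tendsto_lin (ξ : RP1) : Tendsto (fun z : ℂ => ‖(ξ.rep 0 : ℂ) - ξ.rep 1 * z‖ / sph z)
    (comap OnePoint.some (𝓝 (rp1ToSphere ξ))) (𝓝 0) := by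
  unfold rp1ToSphere
  split_ifs with h
  · rw [comap_nhds_infty]
    simp only [h, Complex.ofReal_zero, zero_mul, sub_zero]
    have h1 : Tendsto sph (cocompact ℂ) atTop :=
      tendsto_atTop_mono norm_le_sph tendsto_norm_cocompact_atTop
    exact h1.const_div_atTop _
  · rw [comap_nhds_coe]
    have h1 : ContinuousAt (fun z : ℂ => ‖(ξ.rep 0 : ℂ) - ξ.rep 1 * z‖ / sph z)
        ((ξ.rep 0 / ξ.rep 1 : ℝ) : ℂ) := by
      refine ContinuousAt.div ?_ continuous_sph.continuousAt (sph_pos _).ne'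
      fun_prop
    have h2 := h1.tendsto
    have h3 : (ξ.rep 0 : ℂ) - ξ.rep 1 * ((ξ.rep 0 / ξ.rep 1 : ℝ) : ℂ) = 0 := by
      have : (ξ.rep 1 : ℂ) ≠ 0 := by exact_mod_cast h
      push_cast
      field_simp
      simp
    rw [h3, norm_zero, zero_div] at h2
    exact h2

instance neBot_bdryNhds (ξ : RP1) : NeBot (bdryNhds ξ) := by
  unfold bdryNhds rp1ToSphere
  split_ifs with h
  · rw [comap_nhds_infty]
    have h1 : Tendsto (fun x : ℝ => (x : ℂ) * Complex.I) atTop (cocompact ℂ ⊓ 𝓟 Hset) := by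
      rw [tendsto_inf]
      constructor
      · rw [← Metric.cobounded_eq_cocompact, ← comap_norm_atTop, tendsto_comap_iff]
        refine tendsto_atTop_mono (fun x => ?_) tendsto_id
        simp [le_abs_self]
      · rw [tendsto_principal]
        filter_upwards [eventually_gt_atTop 0] with x hx
        simpa [Hset] using hx
    exact h1.neBot
  · rw [comap_nhds_coe]
    have : ((ξ.rep 0 / ξ.rep 1 : ℝ) : ℂ) ∈ closure Hset := by
      have : closure Hset = {z | 0 ≤ z.im} := Complex.closure_setOfPred_lt_im 0
      rw [this]
      simp only [mem_ofPred_eq, Complex.ofReal_im, le_refl]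
    exact mem_closure_iff_nhdsWithin_neBot.1 this

lemma bdryNhds_le (ξ : RP1) : ∀ᶠ z in bdryNhds ξ, z ∈ Hset :=
  (inf_le_right : bdryNhds ξ ≤ 𝓟 Hset) (mem_principal_self _)

lemma rep_sq_pos (ξ : RP1) : 0 < ξ.rep 0 ^ 2 + ξ.rep 1 ^ 2 := by
  have h := ξ.rep_nonzero
  by_contra! h0
  apply h
  ext i
  fin_cases i
  · simp; nlinarith [sq_nonneg (ξ.rep 0), sq_nonneg (ξ.rep 1)]
  · simp; nlinarith [sq_nonneg (ξ.rep 0), sq_nonneg (ξ.rep 1)]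

lemma norm_perp_sq (v : Fin 2 → ℝ) (z : ℂ) : (‖(v 1 : ℂ) + v 0 * z‖ / sph z) ^ 2 =
    v 0 ^ 2 + v 1 ^ 2 - (‖(v 0 : ℂ) - v 1 * z‖ / sph z) ^ 2 := by
  have hs := sph_pos z
  have h : ‖(v 1 : ℂ) + v 0 * z‖ ^ 2 + ‖(v 0 : ℂ) - v 1 * z‖ ^ 2 =
      (v 0 ^ 2 + v 1 ^ 2) * sph z ^ 2 := by
    rw [sph_sq, ← Complex.normSq_eq_norm_sq, ← Complex.normSq_eq_norm_sq,
      ← Complex.normSq_eq_norm_sq]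
    simp [Complex.normSq_apply]
    ring
  rw [div_pow, div_pow]
  field_simp
  linarith

lemma tendsto_perp {ι : Type*} {F : Filter ι} {f : ι → ℂ} {v : Fin 2 → ℝ}
    (h : Tendsto (fun x => ‖(v 0 : ℂ) - v 1 * f x‖ / sph (f x)) F (𝓝 0)) :
    Tendsto (fun x => ‖(v 1 : ℂ) + v 0 * f x‖ / sph (f x)) F (𝓝 √(v 0 ^ 2 + v 1 ^ 2)) := by
  have h1 : ∀ x, ‖(v 1 : ℂ) + v 0 * f x‖ / sph (f x) =
      √(v 0 ^ 2 + v 1 ^ 2 - (‖(v 0 : ℂ) - v 1 * f x‖ / sph (f x)) ^ 2) := by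
    intro x
    rw [← norm_perp_sq, Real.sqrt_sq]
    have := sph_pos (f x)
    positivity
  simp only [h1]
  have h2 := (((h.pow 2).const_sub (v 0 ^ 2 + v 1 ^ 2)).sqrt)
  simpa using h2

/-- The rank one null vector attached to a pair of lines. -/
def rk (v w : Fin 2 → ℝ) : Fin 4 → ℝ := ![v 1 * w 1, -(v 1 * w 0), -(v 0 * w 1), v 0 * w 0]

lemma B4_rk_rk (v w v' w' : Fin 2 → ℝ) : B4 (rk v w) (rk v' w') = det2 v v' * det2 w w' := by
  simp [B4, rk, det2]; ring

lemma det4_rk (v w : Fin 2 → ℝ) : det4 (rk v w) = 0 := by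
  simp [det4, rk]; ring

lemma tendsto_norm_bipoly {ι : Type*} {F : Filter ι} {f g : ι → ℂ} {v w : Fin 2 → ℝ}
    (hv0 : 0 < v 0 ^ 2 + v 1 ^ 2) (hw0 : 0 < w 0 ^ 2 + w 1 ^ 2)
    (hf : Tendsto (fun x => ‖(v 0 : ℂ) - v 1 * f x‖ / sph (f x)) F (𝓝 0))
    (hg : Tendsto (fun x => ‖(w 0 : ℂ) - w 1 * g x‖ / sph (g x)) F (𝓝 0)) (Q : Fin 4 → ℝ) :
    Tendsto (fun x => ‖bipoly Q (f x) (g x)‖ / (sph (f x) * sph (g x))) F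
      (𝓝 (|B4 Q (rk v w)| / (√(v 0 ^ 2 + v 1 ^ 2) * √(w 0 ^ 2 + w 1 ^ 2)))) := by
  have hf' := tendsto_perp hf
  have hg' := tendsto_perp hg
  set V := v 0 ^ 2 + v 1 ^ 2
  set W := w 0 ^ 2 + w 1 ^ 2
  have key : ∃ C1 C2 C3 : ℝ, ∀ a b : ℂ, (V * W : ℂ) * bipoly Q a b =
      (B4 Q (rk v w) : ℂ) * ((v 1 + v 0 * a) * (w 1 + w 0 * b)) +
      (C1 * ((v 0 - v 1 * a) * (w 0 - w 1 * b)) + C2 * ((v 0 - v 1 * a) * (w 1 + w 0 * b)) +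
        C3 * ((v 1 + v 0 * a) * (w 0 - w 1 * b))) := by
    refine ⟨Q 0 * (v 1 * w 1) - Q 1 * (v 1 * w 0) - Q 2 * (v 0 * w 1) + Q 3 * (v 0 * w 0),
      -Q 0 * (v 1 * w 0) - Q 1 * (v 1 * w 1) + Q 2 * (v 0 * w 0) + Q 3 * (v 0 * w 1),
      -Q 0 * (v 0 * w 1) + Q 1 * (v 0 * w 0) - Q 2 * (v 1 * w 1) + Q 3 * (v 1 * w 0), ?_⟩
    intro a b
    simp only [V, W, bipoly, B4, rk, Matrix.cons_val]
    push_cast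
    ring
  obtain ⟨C1, C2, C3, key⟩ := key
  have hmain := ((hf'.mul hg').const_mul |B4 Q (rk v w)|)
  have herr : Tendsto (fun x => |C1| * (‖(v 0 : ℂ) - v 1 * f x‖ / sph (f x) *
      (‖(w 0 : ℂ) - w 1 * g x‖ / sph (g x))) + |C2| * (‖(v 0 : ℂ) - v 1 * f x‖ / sph (f x) *
      (‖(w 1 : ℂ) + w 0 * g x‖ / sph (g x))) + |C3| * (‖(v 1 : ℂ) + v 0 * f x‖ / sph (f x) *
      (‖(w 0 : ℂ) - w 1 * g x‖ / sph (g x)))) F (𝓝 0) := by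
    have := (((hf.mul hg).const_mul |C1|).add ((hf.mul hg').const_mul |C2|)).add
      ((hf'.mul hg).const_mul |C3|)
    simpa using this
  have hdiff : Tendsto (fun x => V * W * (‖bipoly Q (f x) (g x)‖ / (sph (f x) * sph (g x))) -
      |B4 Q (rk v w)| * (‖(v 1 : ℂ) + v 0 * f x‖ / sph (f x) *
      (‖(w 1 : ℂ) + w 0 * g x‖ / sph (g x)))) F (𝓝 0) := by
    refine squeeze_zero_norm (fun x => ?_) herr
    have h1 := sph_pos (f x)
    have h2 := sph_pos (g x)
    have e1 : V * W * ‖bipoly Q (f x) (g x)‖ = ‖(V * W : ℂ) * bipoly Q (f x) (g x)‖ := by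
      rw [norm_mul, norm_mul, Complex.norm_real, Complex.norm_real, Real.norm_of_nonneg hv0.le,
        Real.norm_of_nonneg hw0.le]
    have e2 : |B4 Q (rk v w)| * (‖(v 1 : ℂ) + v 0 * f x‖ * ‖(w 1 : ℂ) + w 0 * g x‖) =
        ‖(B4 Q (rk v w) : ℂ) * ((v 1 + v 0 * f x) * (w 1 + w 0 * g x))‖ := by
      rw [norm_mul, norm_mul, Complex.norm_real, Real.norm_eq_abs]
    have e3 := abs_norm_sub_norm_le ((V * W : ℂ) * bipoly Q (f x) (g x))
      ((B4 Q (rk v w) : ℂ) * ((v 1 + v 0 * f x) * (w 1 + w 0 * g x)))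
    rw [← e1, ← e2, key, add_sub_cancel_left] at e3
    have e4 := e3.trans (norm_add₃_le)
    simp only [norm_mul, Complex.norm_real] at e4
    rw [Real.norm_eq_abs, show V * W * (‖bipoly Q (f x) (g x)‖ / (sph (f x) * sph (g x))) -
      |B4 Q (rk v w)| * (‖(v 1 : ℂ) + v 0 * f x‖ / sph (f x) *
      (‖(w 1 : ℂ) + w 0 * g x‖ / sph (g x))) = (V * W * ‖bipoly Q (f x) (g x)‖ -
      |B4 Q (rk v w)| * (‖(v 1 : ℂ) + v 0 * f x‖ * ‖(w 1 : ℂ) + w 0 * g x‖)) /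
        (sph (f x) * sph (g x)) by field_simp, abs_div, abs_of_pos (mul_pos h1 h2),
        div_le_iff₀ (mul_pos h1 h2)]
    refine e4.trans (le_of_eq ?_)
    simp only [Real.norm_eq_abs]
    field_simp
  have h3 := (hdiff.add hmain).const_mul ((V * W)⁻¹)
  have hV : √V * √V = V := Real.mul_self_sqrt hv0.le
  have hW : √W * √W = W := Real.mul_self_sqrt hw0.le
  have hV0 : 0 < √V := Real.sqrt_pos.2 hv0
  have hW0 : 0 < √W := Real.sqrt_pos.2 hw0
  convert h3 using 1
  · ext x
    field_simp
    ring
  · congr 1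
    rw [zero_add, ← hV, ← hW]
    have : 0 < √(√V * √V) := by rw [hV]; exact hV0
    have : 0 < √(√W * √W) := by rw [hW]; exact hW0
    rw [Real.sqrt_mul_self hV0.le, Real.sqrt_mul_self hW0.le]
    field_simp

lemma tendsto_im_div {ι : Type*} {F : Filter ι} {f : ι → ℂ} {v : Fin 2 → ℝ}
    (hv0 : 0 < v 0 ^ 2 + v 1 ^ 2)
    (hf : Tendsto (fun x => ‖(v 0 : ℂ) - v 1 * f x‖ / sph (f x)) F (𝓝 0)) :
    Tendsto (fun x => |(f x).im| / sph (f x) ^ 2) F (𝓝 0) := by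
  have h1 := hf.const_mul (√(v 0 ^ 2 + v 1 ^ 2) * 2 / (v 0 ^ 2 + v 1 ^ 2))
  rw [mul_zero] at h1
  refine squeeze_zero (fun x => by positivity) (fun x => ?_) h1
  have hs := sph_pos (f x)
  set a : ℂ := (v 0 : ℂ) - v 1 * f x with ha
  set b : ℂ := (v 1 : ℂ) + v 0 * f x with hb
  have hb1 : ‖b‖ ≤ √(v 0 ^ 2 + v 1 ^ 2) * sph (f x) := by
    have h := norm_perp_sq v (f x)
    have h2 : (‖b‖ / sph (f x)) ^ 2 ≤ v 0 ^ 2 + v 1 ^ 2 := by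
      rw [hb, h]; nlinarith [sq_nonneg (‖a‖ / sph (f x))]
    rw [← div_le_iff₀ hs]
    exact Real.le_sqrt_of_sq_le h2
  have him : (v 0 ^ 2 + v 1 ^ 2) * (f x).im = (conj a * b).im := by
    simp [ha, hb]; ring
  have h3 : (v 0 ^ 2 + v 1 ^ 2) * |(f x).im| ≤ ‖a‖ * ‖b‖ := by
    rw [← abs_of_pos hv0, ← abs_mul, him]
    refine (Complex.abs_im_le_norm _).trans ?_
    rw [norm_mul, Complex.norm_conj]
  have h4 := mul_le_mul_of_nonneg_left hb1 (norm_nonneg a)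
  rw [div_mul_div_comm, div_le_div_iff₀ (by positivity) (by positivity)]
  have h5 : 0 ≤ ‖a‖ * (√(v 0 ^ 2 + v 1 ^ 2) * sph (f x)) := by positivity
  have h6 := mul_le_mul_of_nonneg_right (h3.trans h4) hs.le
  nlinarith [mul_nonneg h5 hs.le]

lemma tendsto_psi (ξ : RP1) : Tendsto psi (bdryNhds ξ) atTop := by
  have h := tendsto_im_div (rep_sq_pos ξ) ((tendsto_lin ξ).mono_left
    (inf_le_left : bdryNhds ξ ≤ _))
  have h1 : Tendsto (fun z => (psi z)⁻¹) (bdryNhds ξ) (𝓝[>] 0) := by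
    rw [tendsto_nhdsWithin_iff]
    constructor
    · have h2 := h.const_mul 2
      rw [mul_zero] at h2
      refine h2.congr' ?_
      filter_upwards [bdryNhds_le ξ] with z hz
      have hz' : 0 < z.im := hz
      rw [sph_sq, abs_of_pos hz', psi, Complex.normSq_eq_norm_sq, inv_div]
      ring
    · filter_upwards [bdryNhds_le ξ] with z hz
      exact inv_pos.2 (psi_pos hz)
  have := h1.inv_tendsto_nhdsGT_zero
  refine this.congr fun z => ?_
  simp

end

section

lemma B4_add_left (P P' Q : Fin 4 → ℝ) : B4 (P + P') Q = B4 P Q + B4 P' Q := by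
  simp [B4]; ring

lemma B4_smul_left (c : ℝ) (P Q : Fin 4 → ℝ) : B4 (c • P) Q = c * B4 P Q := by
  simp [B4]; ring

lemma B4_add_right (P Q Q' : Fin 4 → ℝ) : B4 P (Q + Q') = B4 P Q + B4 P Q' := by
  simp [B4]; ring

lemma B4_smul_right (c : ℝ) (P Q : Fin 4 → ℝ) : B4 P (c • Q) = c * B4 P Q := by
  simp [B4]; ring

lemma det4_smul (c : ℝ) (P : Fin 4 → ℝ) : det4 (c • P) = c ^ 2 * det4 P := by
  simp [det4]; ring

namespace Surf
variable {S : Surf} {P Q W : Fin 4 → ℝ} {z : ℂ} {ℓ c : ℝ}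

lemma U_add (P Q : Fin 4 → ℝ) (z : ℂ) : S.U (P + Q) z = S.U P z + S.U Q z := by
  simp [U, bipoly]; ring

lemma U_smul (c : ℝ) (P : Fin 4 → ℝ) (z : ℂ) : S.U (c • P) z = c * S.U P z := by
  simp [U, bipoly]; ring

lemma u_add (P Q : Fin 4 → ℝ) (z : ℂ) : S.u (P + Q) z = S.u P z + S.u Q z := by
  simp [u, U_add]

lemma u_smul (c : ℝ) (P : Fin 4 → ℝ) (z : ℂ) : S.u (c • P) z = c * S.u P z := by
  simp [u, U_smul]

lemma n_add (P Q : Fin 4 → ℝ) (z : ℂ) : S.n (P + Q) z = S.n P z + S.n Q z := by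
  simp [n, U_add]

lemma n_smul (c : ℝ) (P : Fin 4 → ℝ) (z : ℂ) : S.n (c • P) z = c * S.n P z := by
  simp [n, U_smul]

lemma norm_U_le (hn : |S.n P z| ≤ S.u P z) : ‖S.U P z‖ ≤ 2 * S.u P z := by
  have h := Complex.norm_le_abs_re_add_abs_im (S.U P z)
  have h1 : |(S.U P z).re| = S.u P z := abs_of_nonneg ((abs_nonneg _).trans hn)
  have h2 : |(S.U P z).im| ≤ S.u P z := hn
  linarith

lemma u_le_norm_U : |S.u P z| ≤ ‖S.U P z‖ := Complex.abs_re_le_norm _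

lemma isLocalMax_neg_u {z₀ : ℂ} (hz : z₀ ∈ Hset) (h : ∀ z ∈ Hset, S.u P z₀ ≤ S.u P z) :
    IsLocalMax (fun z => -1 * S.u P z) z₀ := by
  filter_upwards [isOpen_Hset.mem_nhds hz] with z hz
  have := h z hz
  linarith

/-- The minimum principle: an interior minimum of a support function is nonnegative. -/
lemma u_nonneg_of_min {z₀ : ℂ} (hz : z₀ ∈ Hset) (h : ∀ z ∈ Hset, S.u P z₀ ≤ S.u P z) :
    0 ≤ S.u P z₀ := by
  have := ((S.lap_u P).const_mul (-1)).lap_nonpos isOpen_Hset hz hz (S.norm_t z₀ hz)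
    (S.dt z₀ hz).continuousAt (isLocalMax_neg_u hz h)
  linarith

lemma u_pos_of_null (hP : det4 P = 0) (h0 : P ≠ 0) (hu : ∀ z ∈ Hset, 0 ≤ S.u P z) :
    ∀ z ∈ Hset, 0 < S.u P z := by
  intro z hz
  by_contra! hneg
  have hu0 : S.u P z = 0 := le_antisymm hneg (hu z hz)
  have hg := ((S.lap_u P).const_mul (-1)).grad_eq_zero hz hz (S.norm_t z hz)
    (isLocalMax_neg_u hz fun w hw => by rw [hu0]; exact hu w hw)
  have hV : S.V P z = 0 := by simpa using hg
  have hn := normSq_V (S := S) P hz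
  rw [hV, hu0, hP] at hn
  have hn0 : S.n P z = 0 := by
    have : S.n P z ^ 2 = 0 := by simpa using hn.symm
    exact pow_eq_zero_iff two_ne_zero |>.1 this
  have hU : S.U P z = 0 := Complex.ext hu0 hn0
  have hk := k_ne (S := S) hz
  have e1 : bipoly P (conj z) (S.Φ z) = 0 := (mul_eq_zero.1 hU).resolve_left hk
  have e2 : bipoly P z (S.Φ z) = 0 := (mul_eq_zero.1 hV).resolve_left hk
  have hz0 : z - conj z ≠ 0 := by
    intro h
    have := congrArg Complex.im h
    have hz' : 0 < z.im := hz
    simp at this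
    linarith
  have hΦ := S.im_pos z hz
  have key : ∀ α β : ℝ, (α : ℂ) * S.Φ z + β = 0 → α = 0 ∧ β = 0 := by
    intro α β h
    have h1 := congrArg Complex.im h
    have h2 := congrArg Complex.re h
    simp at h1 h2
    have h3 := h1.resolve_right hΦ.ne'
    rw [h3] at h2
    exact ⟨h3, by linarith⟩
  have e3 : (P 0 : ℂ) * S.Φ z + P 1 = 0 := by
    refine (mul_eq_zero.1 (?_ : (z - conj z) * _ = 0)).resolve_left hz0
    unfold bipoly at e1 e2
    linear_combination e2 - e1
  have e4 : (P 2 : ℂ) * S.Φ z + P 3 = 0 := by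
    unfold bipoly at e2
    linear_combination e2 - z * e3
  obtain ⟨p0, p1⟩ := key _ _ e3
  obtain ⟨p2, p3⟩ := key _ _ e4
  apply h0
  ext i
  fin_cases i <;> simp [p0, p1, p2, p3]

/-- A functional whose support function is positive and dominates the normal part. -/
structure Good (S : Surf) (P : Fin 4 → ℝ) : Prop where
  u_pos : ∀ z ∈ Hset, 0 < S.u P z
  n_le : ∀ z ∈ Hset, |S.n P z| ≤ S.u P z

lemma Good.of_null (hℓ : ∀ z ∈ Hset, ‖S.t z‖ ≤ ℓ) (hℓ1 : ℓ ≤ 1) (hP : det4 P = 0)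
    (hu : ∀ z ∈ Hset, 0 < S.u P z) : S.Good P :=
  ⟨hu, fun z hz => (abs_n_le_of_null hℓ hP hu z hz).trans
    (by nlinarith [hu z hz])⟩

lemma Good.add (hP : S.Good P) (hQ : S.Good Q) : S.Good (P + Q) := by
  refine ⟨fun z hz => ?_, fun z hz => ?_⟩
  · rw [u_add]; exact add_pos (hP.u_pos z hz) (hQ.u_pos z hz)
  · rw [u_add, n_add]
    exact (abs_add_le _ _).trans (add_le_add (hP.n_le z hz) (hQ.n_le z hz))

lemma exists_null (S : Surf) : ∃ P : Fin 4 → ℝ, P ≠ 0 ∧ det4 P = 0 ∧ ∀ z ∈ Hset, 0 < S.u P z := by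
  obtain ⟨ξ⟩ : Nonempty RP1 := ⟨Projectivization.mk ℝ ![1, 0] (by simp)⟩
  set G := Ultrafilter.of (bdryNhds ξ)
  have hG : (G : Filter ℂ) ≤ bdryNhds ξ := Ultrafilter.of_le _
  have hH : ∀ᶠ z in (G : Filter ℂ), z ∈ Hset := hG (bdryNhds_le ξ)
  have hinf : Tendsto (fun z => ‖S.PF z‖) G atTop := by
    rw [tendsto_atTop]
    intro R
    obtain ⟨C, hC⟩ := exists_psi_le S R
    filter_upwards [hH, ((tendsto_psi ξ).mono_left hG).eventually_gt_atTop C] with z h1 h2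
    by_contra! h
    exact absurd (hC z h1 h.le) (not_le.2 h2)
  have hpos : ∀ᶠ z in (G : Filter ℂ), 0 < ‖S.PF z‖ := hinf.eventually_gt_atTop 0
  have hsph : ∀ᶠ z in (G : Filter ℂ), ‖S.PF z‖⁻¹ • S.PF z ∈ Metric.sphere (0 : Fin 4 → ℝ) 1 := by
    filter_upwards [hpos] with z hz
    rw [mem_sphere_zero_iff_norm, norm_smul, norm_inv, norm_norm, inv_mul_cancel₀ hz.ne']
  obtain ⟨P, hP, hlim⟩ := (isCompact_sphere (0 : Fin 4 → ℝ) 1).ultrafilter_le_nhds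
    (G.map fun z => ‖S.PF z‖⁻¹ • S.PF z) (by
      rw [le_principal_iff]; exact hsph)
  have hlim : Tendsto (fun z => ‖S.PF z‖⁻¹ • S.PF z) G (𝓝 P) := hlim
  have hP0 : P ≠ 0 := by
    rintro rfl
    simp at hP
  have hcont : Continuous (det4) := by unfold det4; fun_prop
  have hdet : det4 P = 0 := by
    have h1 := (hcont.tendsto P).comp hlim
    have h2 : Tendsto (fun z => (‖S.PF z‖⁻¹) ^ 2) G (𝓝 0) := by
      simpa using hinf.inv_tendsto_atTop.pow 2
    refine tendsto_nhds_unique h1 (h2.congr' ?_)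
    filter_upwards [hH] with z hz
    simp only [Function.comp, det4_smul, det4_PF hz, mul_one]
  refine ⟨P, hP0, hdet, u_pos_of_null hdet hP0 fun w hw => ?_⟩
  rw [u_eq_B4]
  have hcont : Continuous (fun Q => B4 Q (S.PF w)) := by unfold B4; fun_prop
  refine ge_of_tendsto ((hcont.tendsto P).comp hlim) ?_
  filter_upwards [hH] with z hz
  simp only [Function.comp, B4_smul_left]
  have := two_le_B4 (S := S) hz hw
  positivity

end Surf

/-- The null vector attached to a point of the graph of `φ`. -/
def Xi (φ : RP1 → RP1) (ξ : RP1) : Fin 4 → ℝ := rk ξ.rep (φ ξ).rep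

lemma det4_Xi (φ : RP1 → RP1) (ξ : RP1) : det4 (Xi φ ξ) = 0 := det4_rk _ _

lemma B4_Xi (φ : RP1 → RP1) (ξ ξ' : RP1) :
    B4 (Xi φ ξ) (Xi φ ξ') = det2 ξ.rep ξ'.rep * det2 (φ ξ).rep (φ ξ').rep := B4_rk_rk _ _ _ _

lemma rk_ne_zero {v w : Fin 2 → ℝ} (hv : v ≠ 0) (hw : w ≠ 0) : rk v w ≠ 0 := by
  intro h
  have h0 := congrFun h 0
  have h1 := congrFun h 1
  have h2 := congrFun h 2
  have h3 := congrFun h 3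
  simp [rk] at h0 h1 h2 h3
  apply hv
  by_contra hv'
  apply hw
  have : v 0 ≠ 0 ∨ v 1 ≠ 0 := by
    by_contra! hc
    apply hv'
    ext i
    fin_cases i
    · exact hc.1
    · exact hc.2
  ext i
  rcases this with h | h <;> fin_cases i <;> simp_all

lemma Xi_ne_zero (φ : RP1 → RP1) (ξ : RP1) : Xi φ ξ ≠ 0 :=
  rk_ne_zero ξ.rep_nonzero (φ ξ).rep_nonzero

lemma mk_eq_of_det2 {v w : Fin 2 → ℝ} (hv : v ≠ 0) (hw : w ≠ 0) (h : det2 v w = 0) :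
    Projectivization.mk ℝ v hv = Projectivization.mk ℝ w hw := by
  rw [Projectivization.mk_eq_mk_iff']
  have hw' : w 0 ≠ 0 ∨ w 1 ≠ 0 := by
    by_contra! hc
    apply hw
    ext i
    fin_cases i
    · exact hc.1
    · exact hc.2
  unfold det2 at h
  rcases hw' with h0 | h0
  · refine ⟨v 0 / w 0, ?_⟩
    ext i
    fin_cases i
    · simp [h0]
    · simp; field_simp; linarith
  · refine ⟨v 1 / w 1, ?_⟩
    ext i
    fin_cases i
    · simp; field_simp; linarith
    · simp [h0]

lemma det2_rep_ne {ξ ξ' : RP1} (h : ξ ≠ ξ') : det2 ξ.rep ξ'.rep ≠ 0 := by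
  intro h0
  apply h
  have := mk_eq_of_det2 ξ.rep_nonzero ξ'.rep_nonzero h0
  rwa [Projectivization.mk_rep, Projectivization.mk_rep] at this

lemma B4_Xi_ne {φ : RP1 → RP1} (hφ : Function.Injective φ) {ξ ξ' : RP1} (h : ξ ≠ ξ') :
    B4 (Xi φ ξ) (Xi φ ξ') ≠ 0 := by
  rw [B4_Xi]
  exact mul_ne_zero (det2_rep_ne h) (det2_rep_ne (hφ.ne h))

lemma exists_rk_of_null {P : Fin 4 → ℝ} (h : det4 P = 0) (h0 : P ≠ 0) :
    ∃ v w, v ≠ 0 ∧ w ≠ 0 ∧ P = rk v w := by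
  have key : ∀ v w, P = rk v w → ∃ v w, v ≠ 0 ∧ w ≠ 0 ∧ P = rk v w := by
    intro v w hvw
    refine ⟨v, w, ?_, ?_, hvw⟩
    · rintro rfl; apply h0; rw [hvw]; ext i; fin_cases i <;> simp [rk]
    · rintro rfl; apply h0; rw [hvw]; ext i; fin_cases i <;> simp [rk]
  unfold det4 at h
  by_cases h1 : P 0 = 0
  · by_cases h2 : P 1 = 0
    · refine key ![1, 0] ![P 3, -P 2] ?_
      ext i; fin_cases i <;> simp [rk, h1, h2]
    · refine key ![-P 3 / P 1, 1] ![-P 1, P 0] ?_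
      have : P 2 = 0 := by
        rw [h1] at h; have : P 1 * P 2 = 0 := by linarith
        exact (mul_eq_zero.1 this).resolve_left h2
      ext i; fin_cases i <;> simp [rk, h1, h2, this]
  · refine key ![-P 2 / P 0, 1] ![-P 1, P 0] ?_
    ext i; fin_cases i <;> simp [rk, h1]
    field_simp
    linarith

instance infinite_RP1 : Infinite RP1 := by
  refine Infinite.of_injective (fun x : ℝ => Projectivization.mk ℝ ![x, 1] (by simp)) ?_
  intro x y h
  simp only at h
  rw [Projectivization.mk_eq_mk_iff'] at h
  obtain ⟨a, ha⟩ := h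
  have h0 := congrFun ha 0
  have h1 := congrFun ha 1
  simp at h0 h1
  rw [h1, one_mul] at h0
  exact h0.symm

lemma exists_pair_B4_ne {φ : RP1 → RP1} (hφ : Function.Injective φ) {P : Fin 4 → ℝ}
    (h : det4 P = 0) (h0 : P ≠ 0) :
    ∃ ξ ξ', ξ ≠ ξ' ∧ B4 P (Xi φ ξ) ≠ 0 ∧ B4 P (Xi φ ξ') ≠ 0 := by
  obtain ⟨v, w, hv, hw, rfl⟩ := exists_rk_of_null h h0
  have hfin : {ξ | B4 (rk v w) (Xi φ ξ) = 0}.Finite := by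
    have : {ξ | B4 (rk v w) (Xi φ ξ) = 0} ⊆
        {Projectivization.mk ℝ v hv} ∪ φ ⁻¹' {Projectivization.mk ℝ w hw} := by
      intro ξ hξ
      simp only [mem_ofPred_eq, Xi, B4_rk_rk, mul_eq_zero] at hξ
      rcases hξ with hξ | hξ
      · left
        have := mk_eq_of_det2 hv ξ.rep_nonzero hξ
        rw [Projectivization.mk_rep] at this
        exact this.symm
      · right
        have := mk_eq_of_det2 hw (φ ξ).rep_nonzero hξ
        rw [Projectivization.mk_rep] at this
        exact this.symm
    refine Set.Finite.subset ?_ this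
    exact (finite_singleton _).union ((finite_singleton _).preimage hφ.injOn)
  have hinf : {ξ | B4 (rk v w) (Xi φ ξ) = 0}ᶜ.Infinite := hfin.infinite_compl
  obtain ⟨ξ, hξ⟩ := hinf.nonempty
  obtain ⟨ξ', hξ', hne⟩ := hinf.exists_notMem_finset {ξ}
  exact ⟨ξ, ξ', fun h => hne (by simp [h]), hξ, hξ'⟩

end

section

lemma mk_rep_apply {v : Fin 2 → ℝ} (hv : v ≠ 0) :
    ∃ c : ℝ, c ≠ 0 ∧ (Projectivization.mk ℝ v hv).rep = c • v := by
  obtain ⟨a, ha⟩ := Projectivization.exists_smul_eq_mk_rep ℝ v hv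
  exact ⟨a, a.ne_zero, ha.symm⟩

lemma exists_rp1ToSphere_eq_coe (x : ℝ) : ∃ ξ : RP1, rp1ToSphere ξ = OnePoint.some (x : ℂ) := by
  have hv : (![x, 1] : Fin 2 → ℝ) ≠ 0 := by simp
  refine ⟨Projectivization.mk ℝ ![x, 1] hv, ?_⟩
  obtain ⟨c, hc, h⟩ := mk_rep_apply hv
  unfold rp1ToSphere
  rw [h, if_neg (by simpa using hc)]
  simp [hc]

lemma exists_rp1ToSphere_eq_infty : ∃ ξ : RP1, rp1ToSphere ξ = OnePoint.infty := by
  have hv : (![1, 0] : Fin 2 → ℝ) ≠ 0 := by simp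
  refine ⟨Projectivization.mk ℝ ![1, 0] hv, ?_⟩
  obtain ⟨c, hc, h⟩ := mk_rep_apply hv
  unfold rp1ToSphere
  rw [h, if_pos (by simp)]

/-- Ultrafilters on the upper half-plane converge inside or to a boundary point. -/
lemma ultrafilter_Hset (G : Ultrafilter ℂ) (hG : ∀ᶠ z in (G : Filter ℂ), z ∈ Hset) :
    (∃ z ∈ Hset, (G : Filter ℂ) ≤ 𝓝 z) ∨ ∃ ξ, (G : Filter ℂ) ≤ bdryNhds ξ := by
  obtain ⟨p, -, hp⟩ := isCompact_univ.ultrafilter_le_nhds (G.map (OnePoint.some : ℂ → OnePoint ℂ))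
    (by simp)
  have hp : (G : Filter ℂ) ≤ comap OnePoint.some (𝓝 p) := tendsto_iff_comap.1 hp
  have hGH : (G : Filter ℂ) ≤ 𝓟 Hset := le_principal_iff.2 hG
  induction p using OnePoint.rec with
  | infty =>
    right
    obtain ⟨ξ, hξ⟩ := exists_rp1ToSphere_eq_infty
    refine ⟨ξ, le_inf ?_ hGH⟩
    rwa [hξ]
  | coe p =>
    have hp' := hp
    rw [comap_nhds_coe] at hp
    by_cases h : p ∈ Hset
    · exact Or.inl ⟨p, h, hp⟩
    · right
      have h1 : 0 ≤ p.im := by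
        have ht : Tendsto Complex.im G (𝓝 p.im) := (Complex.continuous_im.tendsto p).mono_left hp
        refine ge_of_tendsto ht ?_
        filter_upwards [hG] with z hz
        exact le_of_lt hz
      have h2 : p.im = 0 := le_antisymm (not_lt.1 h) h1
      obtain ⟨ξ, hξ⟩ := exists_rp1ToSphere_eq_coe p.re
      refine ⟨ξ, le_inf ?_ hGH⟩
      rw [hξ]
      convert hp'
      exact Complex.ext rfl (by simp [h2])

namespace Surf
variable {S : Surf} {P Q W : Fin 4 → ℝ} {z : ℂ} {ℓ c : ℝ} {φ : RP1 → RP1}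

lemma tendsto_ratio_bipoly (hext : ExtendsToBoundary S.Φ φ) (Q : Fin 4 → ℝ) (ξ : RP1) :
    Tendsto (fun z => ‖bipoly Q (conj z) (S.Φ z)‖ / (sph (conj z) * sph (S.Φ z))) (bdryNhds ξ)
      (𝓝 (|B4 Q (Xi φ ξ)| / (√(ξ.rep 0 ^ 2 + ξ.rep 1 ^ 2) *
        √((φ ξ).rep 0 ^ 2 + (φ ξ).rep 1 ^ 2)))) := by
  refine tendsto_norm_bipoly (rep_sq_pos ξ) (rep_sq_pos (φ ξ)) ?_ ?_ Q
  · refine ((tendsto_lin ξ).mono_left (inf_le_left : bdryNhds ξ ≤ _)).congr fun z => ?_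
    have h1 : sph (conj z) = sph z := by simp [sph]
    have h2 : (ξ.rep 0 : ℂ) - ξ.rep 1 * conj z = conj ((ξ.rep 0 : ℂ) - ξ.rep 1 * z) := by simp
    rw [h1, h2, Complex.norm_conj]
  · have h : Tendsto S.Φ (bdryNhds ξ) (comap OnePoint.some (𝓝 (rp1ToSphere (φ ξ)))) :=
      tendsto_comap_iff.2 (hext ξ)
    exact (tendsto_lin (φ ξ)).comp h

lemma tendsto_ratio_U (hext : ExtendsToBoundary S.Φ φ) (Q : Fin 4 → ℝ) {ξ : RP1}
    (hP : B4 P (Xi φ ξ) ≠ 0) :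
    Tendsto (fun z => ‖S.U Q z‖ / ‖S.U P z‖) (bdryNhds ξ)
      (𝓝 (|B4 Q (Xi φ ξ)| / |B4 P (Xi φ ξ)|)) := by
  have h1 := Real.sqrt_pos.2 (rep_sq_pos ξ)
  have h2 := Real.sqrt_pos.2 (rep_sq_pos (φ ξ))
  have h := (tendsto_ratio_bipoly hext Q ξ).div (tendsto_ratio_bipoly hext P ξ)
    (div_ne_zero (abs_ne_zero.2 hP) (mul_pos h1 h2).ne')
  rw [div_div_div_cancel_right₀ (mul_pos h1 h2).ne'] at h
  refine h.congr' ?_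
  filter_upwards [bdryNhds_le ξ] with z hz
  have hk : ‖S.k z‖ ≠ 0 := norm_ne_zero_iff.2 (k_ne hz)
  have h3 := sph_pos (conj z)
  have h4 := sph_pos (S.Φ z)
  simp only [Pi.div_apply]
  rw [div_div_div_cancel_right₀ (mul_pos h3 h4).ne', U, U, norm_mul, norm_mul,
    mul_div_mul_left _ _ hk]

lemma Good.div_le (hP : S.Good P) (hz : z ∈ Hset) :
    ‖S.U Q z‖ / S.u P z ≤ 2 * (‖S.U Q z‖ / ‖S.U P z‖) := by
  have h1 := hP.u_pos z hz
  have h2 := norm_U_le (hP.n_le z hz)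
  have h3 : 0 < ‖S.U P z‖ := h1.trans_le ((le_abs_self _).trans u_le_norm_U)
  rw [← mul_div_assoc, div_le_div_iff₀ h1 h3]
  nlinarith [norm_nonneg (S.U Q z)]

lemma Good.eventually_le (hext : ExtendsToBoundary S.Φ φ) (hP : S.Good P) (Q : Fin 4 → ℝ) {ξ : RP1}
    (hPξ : B4 P (Xi φ ξ) ≠ 0) :
    ∃ C, ∀ᶠ z in bdryNhds ξ, ‖S.U Q z‖ / S.u P z ≤ C := by
  obtain ⟨C, hC⟩ := (tendsto_ratio_U hext Q hPξ).isBoundedUnder_le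
  refine ⟨2 * C, ?_⟩
  filter_upwards [eventually_map.1 hC, bdryNhds_le ξ] with z h1 hz
  have := hP.div_le (Q := Q) hz
  linarith

lemma Good.tendsto (hext : ExtendsToBoundary S.Φ φ) (hP : S.Good P) (Q : Fin 4 → ℝ) {ξ : RP1}
    (hPξ : B4 P (Xi φ ξ) ≠ 0) :
    Tendsto (fun z => S.u Q z / S.u P z) (bdryNhds ξ)
      (𝓝 (B4 Q (Xi φ ξ) / B4 P (Xi φ ξ))) := by
  set β := B4 Q (Xi φ ξ) / B4 P (Xi φ ξ) with hβ
  have h := (tendsto_ratio_U hext (Q + (-β) • P) hPξ).const_mul 2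
  have h0 : B4 (Q + (-β) • P) (Xi φ ξ) = 0 := by
    rw [B4_add_left, B4_smul_left, hβ]; field_simp; ring
  rw [h0, abs_zero, zero_div, mul_zero] at h
  rw [tendsto_iff_norm_sub_tendsto_zero]
  refine squeeze_zero' (Eventually.of_forall fun _ => norm_nonneg _) ?_ h
  filter_upwards [bdryNhds_le ξ] with z hz
  have h1 := hP.u_pos z hz
  refine le_trans ?_ (hP.div_le (Q := Q + (-β) • P) hz)
  have e : S.u Q z / S.u P z - β = S.u (Q + (-β) • P) z / S.u P z := by
    rw [u_add, u_smul]; field_simp; ring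
  rw [e, Real.norm_eq_abs, abs_div, abs_of_pos h1]
  gcongr
  exact u_le_norm_U

lemma Good.u_Xi_pos (hext : ExtendsToBoundary S.Φ φ) (hP : S.Good P) {ξ : RP1}
    (hPξ : B4 P (Xi φ ξ) ≠ 0) :
    ∀ z ∈ Hset, 0 < S.u ((B4 P (Xi φ ξ))⁻¹ • Xi φ ξ) z := by
  refine u_pos_of_null (by rw [det4_smul, det4_Xi, mul_zero])
    (smul_ne_zero (inv_ne_zero hPξ) (Xi_ne_zero φ ξ)) fun z hz => ?_
  rw [u_eq_B4, B4_smul_left, B4_comm (Xi φ ξ), mul_comm, ← div_eq_mul_inv]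
  refine ge_of_tendsto (hP.tendsto hext (S.PF z) hPξ) ?_
  filter_upwards [bdryNhds_le ξ] with w hw
  rw [u_eq_B4 (S.PF z) w]
  have h1 := two_le_B4 (S := S) hz hw
  have h2 := hP.u_pos w hw
  positivity

lemma Good.B4_Xi_pos (hext : ExtendsToBoundary S.Φ φ) (hP : S.Good P) {ξ : RP1}
    (hPξ : B4 P (Xi φ ξ) ≠ 0) {s : ℝ} (hs : ∀ z ∈ Hset, 0 < S.u (s • Xi φ ξ) z) :
    0 < B4 P (s • Xi φ ξ) := by
  have hI : Complex.I ∈ Hset := by simp [Hset]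
  have h1 := hP.u_Xi_pos hext hPξ _ hI
  have h2 := hs _ hI
  rw [u_smul] at h1 h2
  rw [B4_smul_right]
  have h3 := mul_pos h1 h2
  have h4 : 0 < (B4 P (Xi φ ξ))⁻¹ * s := by
    by_contra! h
    nlinarith [mul_nonneg (neg_nonneg.2 h) (sq_nonneg (S.u (Xi φ ξ) Complex.I))]
  have h5 : s * B4 P (Xi φ ξ) = (B4 P (Xi φ ξ))⁻¹ * s * (B4 P (Xi φ ξ)) ^ 2 := by
    field_simp
  rw [h5]
  positivity

/-- The bounded surface data together with its boundary values. -/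
structure Ext (S : Surf) (φ : RP1 → RP1) (ℓ : ℝ) : Prop where
  lt_one : ℓ < 1
  t_le : ∀ z ∈ Hset, ‖S.t z‖ ≤ ℓ
  inj : Function.Injective φ
  ext : ExtendsToBoundary S.Φ φ

/-- The cone of positive null vectors over the graph of `φ`. -/
def Lam (S : Surf) (φ : RP1 → RP1) (ξ : RP1) (P : Fin 4 → ℝ) : Prop :=
  ∃ s : ℝ, P = s • Xi φ ξ ∧ ∀ z ∈ Hset, 0 < S.u P z

namespace Ext
variable (E : S.Ext φ ℓ) {ξ ξ' : RP1}
include E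

lemma good_of_lam (hP : S.Lam φ ξ P) : S.Good P := by
  obtain ⟨s, rfl, h⟩ := hP
  exact Good.of_null E.t_le E.lt_one.le (by rw [det4_smul, det4_Xi, mul_zero]) h

lemma lam_of_good (hP : S.Good P) (hPξ : B4 P (Xi φ ξ) ≠ 0) : ∃ Q, S.Lam φ ξ Q :=
  ⟨_, _, rfl, hP.u_Xi_pos E.ext hPξ⟩

lemma B4_pos_of_lam (hP : S.Lam φ ξ P) (hQ : S.Lam φ ξ' Q) (h : ξ ≠ ξ') : 0 < B4 P Q := by
  have hg := E.good_of_lam hP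
  obtain ⟨s, rfl, hs⟩ := hP
  obtain ⟨s', rfl, hs'⟩ := hQ
  refine hg.B4_Xi_pos E.ext ?_ hs'
  rw [B4_smul_left]
  refine mul_ne_zero ?_ (B4_Xi_ne E.inj h)
  rintro rfl
  have hI : Complex.I ∈ Hset := by simp [Hset]
  have := hs _ hI
  rw [u_smul, zero_mul] at this
  exact this.false

lemma B4_nonneg_of_lam (hP : S.Lam φ ξ P) (hQ : S.Lam φ ξ' Q) : 0 ≤ B4 P Q := by
  by_cases h : ξ = ξ'
  · subst h
    obtain ⟨s, rfl, -⟩ := hP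
    obtain ⟨s', rfl, -⟩ := hQ
    rw [B4_smul_left, B4_smul_right, B4_self, det4_Xi]
    simp
  · exact (E.B4_pos_of_lam hP hQ h).le

lemma exists_pair : ∃ ξ₁ ξ₂ P₁ P₂, ξ₁ ≠ ξ₂ ∧ S.Lam φ ξ₁ P₁ ∧ S.Lam φ ξ₂ P₂ := by
  obtain ⟨P, h0, hdet, hu⟩ := exists_null S
  obtain ⟨ξ₁, ξ₂, hne, h1, h2⟩ := exists_pair_B4_ne E.inj hdet h0
  have hg := Good.of_null E.t_le E.lt_one.le hdet hu
  obtain ⟨P₁, hP₁⟩ := E.lam_of_good hg h1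
  obtain ⟨P₂, hP₂⟩ := E.lam_of_good hg h2
  exact ⟨ξ₁, ξ₂, P₁, P₂, hne, hP₁, hP₂⟩

lemma exists_W : ∃ W, S.Good W ∧ (∃ c > 0, ∀ z ∈ Hset, c ≤ S.u W z) ∧
    ∀ ξ, B4 W (Xi φ ξ) ≠ 0 := by
  obtain ⟨ξ₁, ξ₂, P₁, P₂, hne, hP₁, hP₂⟩ := E.exists_pair
  have g₁ := E.good_of_lam hP₁
  have g₂ := E.good_of_lam hP₂
  have h12 := E.B4_pos_of_lam hP₁ hP₂ hne
  have hg := g₁.add g₂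
  have hex : ∀ ξ, ∃ Q, S.Lam φ ξ Q := by
    have key : ∀ ξ ξ' P, S.Lam φ ξ' P → ξ' ≠ ξ → ∃ Q, S.Lam φ ξ Q := by
      intro ξ ξ' P hP h
      have hg := E.good_of_lam hP
      obtain ⟨s, rfl, hs⟩ := hP
      refine E.lam_of_good hg ?_
      rw [B4_smul_left]
      refine mul_ne_zero ?_ (B4_Xi_ne E.inj h)
      rintro rfl
      have := hs Complex.I (by simp [Hset])
      rw [u_smul, zero_mul] at this
      exact this.false
    intro ξ
    by_cases h : ξ₁ = ξ
    · exact key ξ ξ₂ P₂ hP₂ (by rw [← h]; exact hne.symm)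
    · exact key ξ ξ₁ P₁ hP₁ h
  have hnull : ∀ {ξ P}, S.Lam φ ξ P → det4 P = 0 := by
    rintro ξ P ⟨s, rfl, -⟩
    rw [det4_smul, det4_Xi, mul_zero]
  refine ⟨P₁ + P₂, hg, ⟨√(2 * B4 P₁ P₂), by positivity, fun z hz => ?_⟩, fun ξ h0 => ?_⟩
  · have h1 := normSq_V (S := S) (P₁ + P₂) hz
    have h2 := Complex.normSq_nonneg (S.V (P₁ + P₂) z)
    have h3 := hg.n_le z hz
    have h4 := hg.u_pos z hz
    have h5 := sq_le_sq' (neg_le_of_abs_le h3) (le_of_abs_le h3)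
    have h6 : 2 * det4 (P₁ + P₂) = 2 * B4 P₁ P₂ := by
      rw [← B4_self, B4_add_left, B4_add_right, B4_add_right, B4_self, B4_self, hnull hP₁,
        hnull hP₂, B4_comm P₂]
      ring
    rw [Real.sqrt_le_left h4.le]
    nlinarith
  · obtain ⟨Q, hQ⟩ := hex ξ
    have h1 := E.B4_nonneg_of_lam hP₁ hQ
    have h2 := E.B4_nonneg_of_lam hP₂ hQ
    have h3 : B4 (P₁ + P₂) Q = 0 := by
      obtain ⟨s, rfl, -⟩ := hQ
      rw [B4_smul_right, h0, mul_zero]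
    rw [B4_add_left] at h3
    by_cases h : ξ₁ = ξ
    · have := E.B4_pos_of_lam hP₂ hQ (by rw [← h]; exact hne.symm)
      linarith
    · have := E.B4_pos_of_lam hP₁ hQ h
      linarith

lemma exists_lam (ξ : RP1) : ∃ P, S.Lam φ ξ P := by
  obtain ⟨W, hW, -, h⟩ := E.exists_W
  exact E.lam_of_good hW (h ξ)

/-- The boundary map preserves the cyclic orientation up to a positive factor. -/
lemma tripleOrient_pos {ξ₁ ξ₂ ξ₃ : RP1} (h12 : ξ₁ ≠ ξ₂) (h23 : ξ₂ ≠ ξ₃) (h31 : ξ₃ ≠ ξ₁) :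
    0 < tripleOrient ξ₁ ξ₂ ξ₃ * tripleOrient (φ ξ₁) (φ ξ₂) (φ ξ₃) := by
  obtain ⟨P₁, hP₁⟩ := E.exists_lam ξ₁
  obtain ⟨P₂, hP₂⟩ := E.exists_lam ξ₂
  obtain ⟨P₃, hP₃⟩ := E.exists_lam ξ₃
  have e12 := E.B4_pos_of_lam hP₁ hP₂ h12
  have e23 := E.B4_pos_of_lam hP₂ hP₃ h23
  have e31 := E.B4_pos_of_lam hP₃ hP₁ h31
  obtain ⟨s₁, rfl, -⟩ := hP₁
  obtain ⟨s₂, rfl, -⟩ := hP₂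
  obtain ⟨s₃, rfl, -⟩ := hP₃
  simp only [B4_smul_left, B4_smul_right, B4_Xi] at e12 e23 e31
  have h := mul_pos (mul_pos e12 e23) e31
  unfold tripleOrient
  by_contra! hc
  nlinarith [mul_nonneg (neg_nonneg.2 hc) (sq_nonneg (s₁ * s₂ * s₃))]

/-- Support functions are controlled by that of a positive functional. -/
lemma norm_U_le {W : Fin 4 → ℝ} (hW : S.Good W) (hWξ : ∀ ξ, B4 W (Xi φ ξ) ≠ 0) (Q : Fin 4 → ℝ) :
    ∃ C, ∀ z ∈ Hset, ‖S.U Q z‖ ≤ C * S.u W z := by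
  by_contra! hc
  have hne : NeBot (comap (fun z => ‖S.U Q z‖ / S.u W z) atTop ⊓ 𝓟 Hset) := by
    rw [inf_principal_neBot_iff]
    intro s hs
    obtain ⟨s', hs', hss⟩ := hs
    obtain ⟨C, hC⟩ := mem_atTop_sets.1 hs'
    obtain ⟨z, hz, h⟩ := hc C
    refine ⟨z, hss (hC _ ?_), hz⟩
    exact ((lt_div_iff₀ (hW.u_pos z hz)).2 h).le
  obtain ⟨G, hG⟩ := Ultrafilter.exists_le (comap (fun z => ‖S.U Q z‖ / S.u W z) atTop ⊓ 𝓟 Hset)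
  have hH : ∀ᶠ z in (G : Filter ℂ), z ∈ Hset := (hG.trans inf_le_right) (mem_principal_self _)
  have htop : Tendsto (fun z => ‖S.U Q z‖ / S.u W z) G atTop :=
    tendsto_iff_comap.2 (hG.trans inf_le_left)
  have hbd : ∃ C, ∀ᶠ z in (G : Filter ℂ), ‖S.U Q z‖ / S.u W z ≤ C := by
    rcases ultrafilter_Hset G hH with ⟨z, hz, h⟩ | ⟨ξ, h⟩
    · have hcont : ContinuousAt (fun z => ‖S.U Q z‖ / S.u W z) z :=
        (dU Q hz).continuousAt.norm.div (continuousAt_u hz) (hW.u_pos z hz).ne'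
      obtain ⟨C, hC⟩ := (hcont.tendsto.mono_left h).isBoundedUnder_le
      exact ⟨C, eventually_map.1 hC⟩
    · obtain ⟨C, hC⟩ := hW.eventually_le E.ext Q (hWξ ξ)
      exact ⟨C, h hC⟩
  obtain ⟨C, hC⟩ := hbd
  obtain ⟨z, h1, h2⟩ := (hC.and (htop.eventually_gt_atTop C)).exists
  linarith

/-- Functionals in the dual cone have nonnegative support functions. -/
lemma u_nonneg_of_dual (hQ : ∀ ξ P, S.Lam φ ξ P → 0 ≤ B4 Q P) : ∀ z ∈ Hset, 0 ≤ S.u Q z := by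
  intro z₀ hz₀
  by_contra! hneg
  obtain ⟨W, hW, -, hWξ⟩ := E.exists_W
  have hWz := hW.u_pos z₀ hz₀
  set ε := -S.u Q z₀ / (2 * S.u W z₀) with hε
  have hε0 : 0 < ε := by rw [hε]; apply div_pos <;> linarith
  set Q' := Q + ε • W with hQ'
  have hQz : S.u Q' z₀ < 0 := by
    rw [hQ', u_add, u_smul, hε]
    field_simp
    linarith
  have hbd : ∀ ξ, ∀ᶠ z in bdryNhds ξ, 0 < S.u Q' z := by
    intro ξ
    have h1 := hW.tendsto E.ext Q' (hWξ ξ)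
    have h2 : 0 < B4 Q' (Xi φ ξ) / B4 W (Xi φ ξ) := by
      have h3 := hQ ξ _ ⟨_, rfl, hW.u_Xi_pos E.ext (hWξ ξ)⟩
      rw [B4_smul_right, mul_comm, ← div_eq_mul_inv] at h3
      rw [hQ', B4_add_left, B4_smul_left, add_div, mul_div_assoc, div_self (hWξ ξ)]
      linarith
    filter_upwards [h1.eventually (lt_mem_nhds h2), bdryNhds_le ξ] with z h3 hz
    exact (div_pos_iff_of_pos_right (hW.u_pos z hz)).1 h3
  have hcomp : IsCompact {z | z ∈ Hset ∧ S.u Q' z ≤ S.u Q' z₀} := by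
    rw [isCompact_iff_ultrafilter_le_nhds]
    intro G hG
    have hG : ∀ᶠ z in (G : Filter ℂ), z ∈ Hset ∧ S.u Q' z ≤ S.u Q' z₀ := le_principal_iff.1 hG
    rcases ultrafilter_Hset G (hG.mono fun z h => h.1) with ⟨z, hz, h⟩ | ⟨ξ, h⟩
    · refine ⟨z, ⟨hz, ?_⟩, h⟩
      exact le_of_tendsto ((continuousAt_u (S := S) (P := Q') hz).tendsto.mono_left h)
        (hG.mono fun z h => h.2)
    · obtain ⟨z, h1, h2⟩ := (hG.and (h (hbd ξ))).exists
      linarith [h1.2]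
  obtain ⟨z₁, ⟨hz₁, hle⟩, hmin⟩ := hcomp.exists_isMinOn ⟨z₀, hz₀, le_refl _⟩
    ((continuousOn_u (S := S) (P := Q')).mono fun z h => h.1)
  have := u_nonneg_of_min (S := S) (P := Q') hz₁ fun z hz => by
    by_cases h : S.u Q' z ≤ S.u Q' z₀
    · exact hmin ⟨hz, h⟩
    · exact hle.trans (not_le.1 h).le
  linarith

/-- Dual functionals can be perturbed to functionals satisfying the maximum principle. -/
lemma exists_adm (hQ : ∀ ξ P, S.Lam φ ξ P → 0 ≤ B4 Q P) :
    ∃ W : Fin 4 → ℝ, ∀ ε : ℝ, 0 < ε → ∃ c C, S.Adm (Q + ε • W) c C := by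
  obtain ⟨W, hW, ⟨c, hc, hcW⟩, hWξ⟩ := E.exists_W
  have hu := E.u_nonneg_of_dual hQ
  refine ⟨W, fun ε hε => ?_⟩
  obtain ⟨C, hC⟩ := E.norm_U_le hW hWξ (Q + ε • W)
  have hu' : ∀ z ∈ Hset, ε * S.u W z ≤ S.u (Q + ε • W) z := by
    intro z hz
    rw [u_add, u_smul]
    linarith [hu z hz]
  have hC0 : 0 ≤ C := by
    have hI : Complex.I ∈ Hset := by simp [Hset]
    have h1 := hC _ hI
    have h2 := hW.u_pos _ hI
    by_contra! h
    nlinarith [norm_nonneg (S.U (Q + ε • W) Complex.I)]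
  refine ⟨ε * c, C / ε, by positivity, fun z hz => ?_, fun z hz => ?_⟩
  · exact (mul_le_mul_of_nonneg_left (hcW z hz) hε.le).trans (hu' z hz)
  · have h1 : |S.n (Q + ε • W) z| ≤ C * S.u W z :=
      (Complex.abs_im_le_norm _).trans (hC z hz)
    refine h1.trans ?_
    rw [div_mul_eq_mul_div, le_div_iff₀ hε]
    nlinarith [hu' z hz]

end Ext
end Surf

end

section

namespace Surf
variable {S : Surf} {P Q W : Fin 4 → ℝ} {z : ℂ} {ℓ c : ℝ} {φ : RP1 → RP1}

namespace Ext
variable (E : S.Ext φ ℓ)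
include E

lemma a_le (hz : z ∈ Hset) : S.a z ≤ ℓ ^ 2 := by
  unfold a
  rw [Complex.normSq_eq_norm_sq]
  exact pow_le_pow_left₀ (norm_nonneg _) (E.t_le z hz) 2

lemma tendsto_perturb (f : ℝ → ℝ) (hf : Continuous f) : Tendsto f (𝓝[>] 0) (𝓝 (f 0)) :=
  (hf.tendsto 0).mono_left nhdsWithin_le_nhds

/-- Bernstein-type estimate for dual functionals. -/
lemma a_mul_n_sq_le (hQ : ∀ ξ P, S.Lam φ ξ P → 0 ≤ B4 Q P) (hz : z ∈ Hset) :
    S.a z * S.n Q z ^ 2 ≤ 126 * S.u Q z ^ 2 := by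
  obtain ⟨W, hW⟩ := E.exists_adm hQ
  have h1 : ∀ ε > 0, S.a z * (S.n Q z + ε * S.n W z) ^ 2 ≤ 126 * (S.u Q z + ε * S.u W z) ^ 2 := by
    intro ε hε
    obtain ⟨c, C, A⟩ := hW ε hε
    have h := A.T_le (ς := 1) (by norm_num) hz
    have hu := A.u_pos z hz
    rw [r, one_mul, div_pow, ← mul_div_assoc, div_le_iff₀ (by positivity)] at h
    rwa [u_add, u_smul, n_add, n_smul] at h
  have hl := E.tendsto_perturb (fun ε => S.a z * (S.n Q z + ε * S.n W z) ^ 2) (by fun_prop)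
  have hr := E.tendsto_perturb (fun ε => 126 * (S.u Q z + ε * S.u W z) ^ 2) (by fun_prop)
  have := le_of_tendsto_of_tendsto hl hr (by
    filter_upwards [self_mem_nhdsWithin] with ε hε
    exact h1 ε hε)
  simpa using this

/-- Barrier estimate for dual functionals. -/
lemma barrier_le (hQ : ∀ ξ P, S.Lam φ ξ P → 0 ≤ B4 Q P) (hz : z ∈ Hset) {ς : ℝ} (hς : ς ^ 2 = 1)
    (hn : S.u Q z < ς * S.n Q z) (ha : 0 < S.a z) :
    (1 - S.u Q z / (ς * S.n Q z)) ^ 6000 ≤ 4000 * Real.exp 12 * (-Real.log (S.a z)) := by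
  obtain ⟨N, hN⟩ : ∃ N : ℕ, N = 6000 := ⟨_, rfl⟩
  have hNe : Even N := hN ▸ ⟨3000, rfl⟩
  rw [← hN]
  obtain ⟨W, hW⟩ := E.exists_adm hQ
  have ha1 := a_lt_one (S := S) hz
  have hlog : Real.log (S.a z) < 0 := Real.log_neg ha ha1
  have hu0 := E.u_nonneg_of_dual hQ z hz
  have hev : ∀ᶠ ε in 𝓝[>] (0 : ℝ), S.u Q z + ε * S.u W z < ς * (S.n Q z + ε * S.n W z) := by
    have hl := E.tendsto_perturb (fun ε => S.u Q z + ε * S.u W z) (by fun_prop)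
    have hr := E.tendsto_perturb (fun ε => ς * (S.n Q z + ε * S.n W z)) (by fun_prop)
    exact hl.eventually_lt hr (by simpa using hn)
  have hl : Tendsto (fun ε => (1 - (S.u Q z + ε * S.u W z) / (ς * (S.n Q z + ε * S.n W z))) ^ N)
      (𝓝[>] 0) (𝓝 ((1 - (S.u Q z + 0 * S.u W z) / (ς * (S.n Q z + 0 * S.n W z))) ^ N)) := by
    refine ((Tendsto.div (E.tendsto_perturb (fun ε => S.u Q z + ε * S.u W z) (by fun_prop))
      (E.tendsto_perturb (fun ε => ς * (S.n Q z + ε * S.n W z)) (by fun_prop)) ?_).const_sub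
        1).pow N
    simp only [zero_mul, add_zero]
    exact (hu0.trans_lt hn).ne'
  simp only [zero_mul, add_zero] at hl
  refine le_of_tendsto hl ?_
  filter_upwards [hev, self_mem_nhdsWithin] with ε h1 hε
  obtain ⟨c, C, A⟩ := hW ε hε
  have hℓ0 : 0 ≤ ℓ := (norm_nonneg _).trans (E.t_le z hz)
  have h := A.barF_le hς hz (ℓ := ℓ ^ 2) (fun z hz => E.a_le hz) (by nlinarith [E.lt_one])
  have hu := A.u_pos z hz
  have hr : S.r ς (Q + ε • W) z = (ς * (S.n Q z + ε * S.n W z)) / (S.u Q z + ε * S.u W z) := by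
    rw [r, u_add, u_smul, n_add, n_smul]
  rw [u_add, u_smul] at hu
  have hr1 : 1 < S.r ς (Q + ε • W) z := by rwa [hr, one_lt_div hu]
  have e1 : (S.r ς (Q + ε • W) z - 1) / S.r ς (Q + ε • W) z =
      1 - (S.u Q z + ε * S.u W z) / (ς * (S.n Q z + ε * S.n W z)) := by
    rw [sub_div, div_self (by linarith), hr, one_div_div]
  rw [barF, ← hN, max_eq_left (by linarith), max_eq_left hr1.le, e1] at h
  have hx : 0 ≤ (1 - (S.u Q z + ε * S.u W z) / (ς * (S.n Q z + ε * S.n W z))) ^ N :=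
    hNe.pow_nonneg _
  have hex : 1 ≤ Real.exp (2 * S.h (Q + ε • W) z) :=
    Real.one_le_exp (by have := h_nonneg (S := S) (P := Q + ε • W) (z := z); linarith)
  have hkap : kap (S.a z) = 2 / (-Real.log (S.a z)) := by
    unfold kap; rw [inv_div]
  rw [hkap, ← mul_div_assoc, div_le_iff₀ (by linarith)] at h
  nlinarith [mul_le_mul_of_nonneg_left hex hx]

end Ext
end Surf

end

section

/-- Quasisymmetry of an increasing function of the line, with constant `M`. -/
structure QSLine (f : ℝ → ℝ) (M : ℝ) : Prop where
  mono : StrictMono f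
  zero : f 0 = 0
  one : f 1 = 1
  right_le : ∀ x t, 0 < t → f (x + t) - f x ≤ M * (f x - f (x - t))
  left_le : ∀ x t, 0 < t → f x - f (x - t) ≤ M * (f (x + t) - f x)

namespace QSLine
variable {f : ℝ → ℝ} {M : ℝ} (h : QSLine f M)
include h

lemma one_le : 1 ≤ M := by
  have h1 := h.right_le 0 1 one_pos
  have h2 := h.left_le 0 1 one_pos
  have h3 := h.mono (show (-1 : ℝ) < 0 by norm_num)
  rw [zero_add, zero_sub, h.one, h.zero] at h1 h2
  rw [h.zero] at h3
  by_contra! hM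
  nlinarith

lemma half_bounds : 1 ≤ (1 + M) * f (1 / 2) ∧ 1 ≤ (1 + M) * (1 - f (1 / 2)) := by
  have h1 := h.right_le (1 / 2) (1 / 2) (by norm_num)
  have h2 := h.left_le (1 / 2) (1 / 2) (by norm_num)
  norm_num [h.zero, h.one] at h1 h2
  constructor <;> norm_num <;> linarith

/-- The central quadrilateral estimate. -/
lemma quad_le (x : ℝ) : 1 ≤ 2 * (1 + M) * (x * f x + (1 - x) * (1 - f x)) := by
  have hM := h.one_le
  obtain ⟨h1, h2⟩ := h.half_bounds
  rcases lt_or_ge x 0 with hx | hx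
  · have := h.mono hx
    rw [h.zero] at this
    nlinarith [mul_pos_of_neg_of_neg hx this]
  rcases lt_or_ge 1 x with hx1 | hx1
  · have := h.mono hx1
    rw [h.one] at this
    nlinarith [mul_pos (sub_pos.2 hx1) (sub_pos.2 this)]
  have f0 : 0 ≤ f x := by have := h.mono.monotone hx; rwa [h.zero] at this
  have f1 : f x ≤ 1 := by have := h.mono.monotone hx1; rwa [h.one] at this
  rcases le_total x (1 / 2) with hx2 | hx2
  · have h3 := h.mono.monotone hx2
    have h4 : 1 ≤ (1 + M) * (1 - f x) := h2.trans (by gcongr)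
    nlinarith [mul_nonneg hx f0, mul_nonneg (sub_nonneg.2 hx2) (by linarith : 0 ≤ (1 + M) * (1 - f x)),
      mul_nonneg (mul_nonneg hx f0) (by linarith : 0 ≤ 1 + M)]
  · have h3 := h.mono.monotone hx2
    have h4 : 1 ≤ (1 + M) * f x := h1.trans (by gcongr)
    nlinarith [mul_nonneg (sub_nonneg.2 hx1) (sub_nonneg.2 f1),
      mul_nonneg (sub_nonneg.2 hx2) (by linarith : 0 ≤ (1 + M) * f x),
      mul_nonneg (mul_nonneg (sub_nonneg.2 hx1) (sub_nonneg.2 f1)) (by linarith : 0 ≤ 1 + M)]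

lemma abs_sub_le_aux (k : ℕ) : ∀ x ∈ Icc (0 : ℝ) 1, |f x - x| ≤ (1 / 2) ^ k + (M - 1) / (M + 1) := by
  have hM := h.one_le
  have hδ : 0 ≤ (M - 1) / (M + 1) := div_nonneg (by linarith) (by linarith)
  set δ := (M - 1) / (M + 1) with hδdef
  have hδM : δ * (M + 1) = M - 1 := by rw [hδdef]; field_simp
  have hb : ∀ x ∈ Icc (0 : ℝ) 1, 0 ≤ f x ∧ f x ≤ 1 := by
    intro x hx
    refine ⟨?_, ?_⟩
    · have := h.mono.monotone hx.1; rwa [h.zero] at this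
    · have := h.mono.monotone hx.2; rwa [h.one] at this
  have key : ∀ p q : ℝ, 0 ≤ q → q ≤ 1 → q - p ≤ M * p → p ≤ M * (q - p) →
      |p - q / 2| ≤ δ / 2 := by
    intro p q hq hq1 e1 e2
    rw [abs_le]
    constructor
    · by_contra! hc
      nlinarith [mul_nonneg hδ hq, mul_nonneg hδ (sub_nonneg.2 hq1)]
    · by_contra! hc
      nlinarith [mul_nonneg hδ hq, mul_nonneg hδ (sub_nonneg.2 hq1)]
  induction k with
  | zero =>
    intro x hx
    obtain ⟨h0, h1⟩ := hb x hx
    rw [abs_le]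
    constructor <;> simp only [pow_zero] <;> linarith [hx.1, hx.2]
  | succ k ih =>
    intro x hx
    rw [pow_succ]
    rcases le_total x (1 / 2) with hx2 | hx2
    · rcases hx.1.eq_or_lt with rfl | hx0
      · rw [h.zero]; simp; positivity
      have h2x : 2 * x ∈ Icc (0 : ℝ) 1 := ⟨by linarith, by linarith⟩
      have e1 := h.right_le x x hx0
      have e2 := h.left_le x x hx0
      rw [sub_self, h.zero, sub_zero, ← two_mul] at e1 e2
      obtain ⟨b0, b1⟩ := hb _ h2x
      have e3 := key (f x) (f (2 * x)) b0 b1 e1 e2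
      have e4 := ih _ h2x
      rw [abs_le] at e3 e4 ⊢
      constructor <;> linarith [e3.1, e3.2, e4.1, e4.2]
    · rcases hx.2.eq_or_lt with rfl | hx0
      · rw [h.one]; simp; positivity
      have h2x : 2 * x - 1 ∈ Icc (0 : ℝ) 1 := ⟨by linarith, by linarith⟩
      have e1 := h.right_le x (1 - x) (by linarith)
      have e2 := h.left_le x (1 - x) (by linarith)
      rw [add_sub_cancel, h.one, show x - (1 - x) = 2 * x - 1 by ring] at e1 e2
      obtain ⟨b0, b1⟩ := hb _ h2x
      have e3 := key (1 - f x) (1 - f (2 * x - 1)) (by linarith) (by linarith) (by linarith)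
        (by linarith)
      have e4 := ih _ h2x
      rw [abs_le] at e3 e4 ⊢
      constructor <;> linarith [e3.1, e3.2, e4.1, e4.2]

lemma abs_sub_le {x : ℝ} (hx : x ∈ Icc (0 : ℝ) 1) : |f x - x| ≤ (M - 1) / (M + 1) := by
  have h1 : Tendsto (fun k : ℕ => (1 / 2 : ℝ) ^ k + (M - 1) / (M + 1)) atTop
      (𝓝 (0 + (M - 1) / (M + 1))) :=
    (tendsto_pow_atTop_nhds_zero_of_lt_one (by norm_num) (by norm_num)).add_const _
  rw [zero_add] at h1
  exact ge_of_tendsto' h1 fun k => h.abs_sub_le_aux k x hx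

end QSLine

/-- The coordinate of `d` for which `b, a, c` have coordinates `0, 1, ∞`. -/
def coord (a b c d : Fin 2 → ℝ) : ℝ := det2 a c * det2 b d / (det2 a b * det2 c d)

lemma coord_sub {a b c d e : Fin 2 → ℝ} (hab : det2 a b ≠ 0) (hd : det2 c d ≠ 0)
    (he : det2 c e ≠ 0) : coord a b c d - coord a b c e =
      det2 a c * det2 b c * det2 d e / (det2 a b * det2 c d * det2 c e) := by
  unfold coord
  field_simp
  unfold det2
  ring

lemma det2_self (a : Fin 2 → ℝ) : det2 a a = 0 := by unfold det2; ring

lemma det2_swap (a b : Fin 2 → ℝ) : det2 a b = -det2 b a := by unfold det2; ring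

lemma det2_smul_right (c : ℝ) (a b : Fin 2 → ℝ) : det2 a (c • b) = c * det2 a b := by
  simp [det2]; ring

/-- The volume form on `ℝ⁴`. -/
def vol (P Q R T : Fin 4 → ℝ) : ℝ :=
  (P 0 * Q 1 - P 1 * Q 0) * (R 2 * T 3 - R 3 * T 2) - (P 0 * Q 2 - P 2 * Q 0) * (R 1 * T 3 - R 3 * T 1)
  + (P 0 * Q 3 - P 3 * Q 0) * (R 1 * T 2 - R 2 * T 1) + (P 1 * Q 2 - P 2 * Q 1) * (R 0 * T 3 - R 3 * T 0)
  - (P 1 * Q 3 - P 3 * Q 1) * (R 0 * T 2 - R 2 * T 0) + (P 2 * Q 3 - P 3 * Q 2) * (R 0 * T 1 - R 1 * T 0)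

lemma vol_rk (a b c d a' b' c' d' : Fin 2 → ℝ) :
    vol (rk a a') (rk b b') (rk c c') (rk d d') =
      det2 a d * det2 b c * (det2 a' c' * det2 b' d') -
      det2 a c * det2 b d * (det2 a' d' * det2 b' c') := by
  simp [vol, rk, det2]; ring

end

section

lemma coord_smul_right {a b c d : Fin 2 → ℝ} {k : ℝ} (hk : k ≠ 0) :
    coord a b c (k • d) = coord a b c d := by
  unfold coord
  rw [det2_smul_right, det2_smul_right,
    show det2 a c * (k * det2 b d) = k * (det2 a c * det2 b d) by ring,
    show det2 a b * (k * det2 c d) = k * (det2 a b * det2 c d) by ring, mul_div_mul_left _ _ hk]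

lemma coord_sub_one {a b c d : Fin 2 → ℝ} (hab : det2 a b ≠ 0) (hd : det2 c d ≠ 0) :
    coord a b c d - 1 = det2 a d * det2 b c / (det2 a b * det2 c d) := by
  unfold coord
  field_simp
  unfold det2
  ring

lemma crossRatio_mul_coord {a b c d₁ d₂ d₄ : RP1} (hab : det2 a.rep b.rep ≠ 0)
    (hac : det2 a.rep c.rep ≠ 0) (hbc : det2 b.rep c.rep ≠ 0)
    (h1 : det2 c.rep d₁.rep ≠ 0) (h2 : det2 c.rep d₂.rep ≠ 0) (h4 : det2 c.rep d₄.rep ≠ 0)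
    (h21 : det2 d₂.rep d₁.rep ≠ 0) :
    crossRatio d₁ d₂ c d₄ * (coord a.rep b.rep c.rep d₂.rep - coord a.rep b.rep c.rep d₁.rep) =
      coord a.rep b.rep c.rep d₄.rep - coord a.rep b.rep c.rep d₁.rep := by
  rw [coord_sub hab h2 h1, coord_sub hab h4 h1]
  unfold crossRatio
  field_simp

/-- The point with a given coordinate. -/
lemma exists_coord_eq {a b c : RP1} (hab : a ≠ b) (hac : a ≠ c) (hbc : b ≠ c) (x : ℝ) :
    ∃ d, d ≠ c ∧ coord a.rep b.rep c.rep d.rep = x := by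
  have h1 := det2_rep_ne hab
  have h2 := det2_rep_ne hac
  have h3 := det2_rep_ne hbc
  set v : Fin 2 → ℝ := det2 a.rep c.rep • b.rep - (x * det2 a.rep b.rep) • c.rep with hv
  have hcv : det2 c.rep v = -(det2 a.rep c.rep * det2 b.rep c.rep) := by
    simp [hv, det2]; ring
  have hbv : det2 b.rep v = -(x * det2 a.rep b.rep * det2 b.rep c.rep) := by
    simp [hv, det2]; ring
  have hv0 : v ≠ 0 := by
    intro h0
    rw [h0] at hcv
    have : det2 a.rep c.rep * det2 b.rep c.rep = 0 := by
      have h4 : det2 c.rep 0 = 0 := by simp [det2]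
      rw [h4] at hcv
      linarith
    exact mul_ne_zero h2 h3 this
  obtain ⟨k, hk, hrep⟩ := mk_rep_apply hv0
  refine ⟨Projectivization.mk ℝ v hv0, ?_, ?_⟩
  · intro h
    have h5 : det2 c.rep (Projectivization.mk ℝ v hv0).rep = 0 := by rw [h, det2_self]
    rw [hrep, det2_smul_right, hcv] at h5
    have := mul_ne_zero h2 h3
    simp_all
  · rw [hrep, coord_smul_right hk]
    unfold coord
    rw [hcv, hbv]
    field_simp

lemma coord_inj {a b c d e : RP1} (hab : a ≠ b) (hac : a ≠ c) (hbc : b ≠ c) (hd : d ≠ c) (he : e ≠ c)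
    (h : coord a.rep b.rep c.rep d.rep = coord a.rep b.rep c.rep e.rep) : d = e := by
  by_contra hde
  have h0 := coord_sub (det2_rep_ne hab) (det2_rep_ne hd.symm) (det2_rep_ne he.symm)
  rw [h, sub_self] at h0
  have h1 := det2_rep_ne hab
  have h2 := det2_rep_ne hac
  have h3 := det2_rep_ne hbc
  have h4 := det2_rep_ne hd.symm
  have h5 := det2_rep_ne he.symm
  have h6 := det2_rep_ne hde
  have : det2 a.rep c.rep * det2 b.rep c.rep * det2 d.rep e.rep /
      (det2 a.rep b.rep * det2 c.rep d.rep * det2 c.rep e.rep) ≠ 0 := by positivity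
  exact this h0.symm

namespace Surf
namespace Ext
variable {S : Surf} {φ : RP1 → RP1} {ℓ M : ℝ} {ξ : RP1} {P Q : Fin 4 → ℝ}

lemma coord_mul_coord_pos (E : S.Ext φ ℓ) {a b c d e : RP1} (hab : a ≠ b) (hac : a ≠ c) (hbc : b ≠ c)
    (hd : d ≠ c) (he : e ≠ c) (hde : d ≠ e) :
    0 < (coord a.rep b.rep c.rep d.rep - coord a.rep b.rep c.rep e.rep) *
      (coord (φ a).rep (φ b).rep (φ c).rep (φ d).rep -
        coord (φ a).rep (φ b).rep (φ c).rep (φ e).rep) := by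
  have inj : ∀ {x y : RP1}, x ≠ y → det2 (φ x).rep (φ y).rep ≠ 0 :=
    fun h => det2_rep_ne (E.inj.ne h)
  rw [coord_sub (det2_rep_ne hab) (det2_rep_ne hd.symm) (det2_rep_ne he.symm),
    coord_sub (inj hab) (inj hd.symm) (inj he.symm)]
  obtain ⟨A, hA⟩ := E.exists_lam a
  obtain ⟨B, hB⟩ := E.exists_lam b
  obtain ⟨C, hC⟩ := E.exists_lam c
  obtain ⟨D, hD⟩ := E.exists_lam d
  obtain ⟨F, hF⟩ := E.exists_lam e
  have i1 := E.B4_pos_of_lam hA hC hac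
  have i2 := E.B4_pos_of_lam hB hC hbc
  have i3 := E.B4_pos_of_lam hD hF hde
  have i4 := E.B4_pos_of_lam hA hB hab
  have i5 := E.B4_pos_of_lam hC hD hd.symm
  have i6 := E.B4_pos_of_lam hC hF he.symm
  obtain ⟨sa, rfl, -⟩ := hA
  obtain ⟨sb, rfl, -⟩ := hB
  obtain ⟨sc, rfl, -⟩ := hC
  obtain ⟨sd, rfl, -⟩ := hD
  obtain ⟨se, rfl, -⟩ := hF
  simp only [B4_smul_left, B4_smul_right, Xi, B4_rk_rk] at i1 i2 i3 i4 i5 i6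
  have hsa : sa ≠ 0 := by rintro rfl; simp at i1
  have hsb : sb ≠ 0 := by rintro rfl; simp at i2
  have hsc : sc ≠ 0 := by rintro rfl; simp at i2
  have hsd : sd ≠ 0 := by rintro rfl; simp at i3
  have hse : se ≠ 0 := by rintro rfl; simp at i3
  have j1 := det2_rep_ne hab
  have j2 := det2_rep_ne hd.symm
  have j3 := det2_rep_ne he.symm
  have j4 := inj hab
  have j5 := inj hd.symm
  have j6 := inj he.symm
  have key := div_pos (mul_pos (mul_pos i1 i2) i3) (mul_pos (mul_pos i4 i5) i6)
  refine lt_of_lt_of_eq key ?_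
  field_simp

lemma qsLine (E : S.Ext φ ℓ) (hM : ∀ z₁ z₂ z₃ z₄, crossRatio z₁ z₂ z₃ z₄ = -1 →
      |crossRatio (φ z₁) (φ z₂) (φ z₃) (φ z₄)| ≤ M)
    {a b c : RP1} (hab : a ≠ b) (hac : a ≠ c) (hbc : b ≠ c) :
    ∃ f, QSLine f M ∧ ∀ d, d ≠ c → coord (φ a).rep (φ b).rep (φ c).rep (φ d).rep =
      f (coord a.rep b.rep c.rep d.rep) := by
  choose D hDc hD using exists_coord_eq hab hac hbc
  have inj : ∀ {x y : RP1}, x ≠ y → det2 (φ x).rep (φ y).rep ≠ 0 :=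
    fun h => det2_rep_ne (E.inj.ne h)
  have hDp : ∀ d, d ≠ c → D (coord a.rep b.rep c.rep d.rep) = d := fun d hd =>
    coord_inj hab hac hbc (hDc _) hd (hD _)
  have hDne : ∀ {x y}, x ≠ y → D x ≠ D y := by
    intro x y hxy h
    exact hxy (by rw [← hD x, ← hD y, h])
  have mono : StrictMono fun x => coord (φ a).rep (φ b).rep (φ c).rep (φ (D x)).rep := by
    intro x y hxy
    have := E.coord_mul_coord_pos hab hac hbc (hDc y) (hDc x) (hDne hxy.ne')
    rw [hD, hD] at this
    exact sub_pos.1 ((pos_iff_pos_of_mul_pos this).1 (sub_pos.2 hxy))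
  have cr : ∀ x t u, x ≠ t → crossRatio (D x) (D t) c (D u) * (t - x) = u - x ∧
      crossRatio (φ (D x)) (φ (D t)) (φ c) (φ (D u)) *
        (coord (φ a).rep (φ b).rep (φ c).rep (φ (D t)).rep -
          coord (φ a).rep (φ b).rep (φ c).rep (φ (D x)).rep) =
        coord (φ a).rep (φ b).rep (φ c).rep (φ (D u)).rep -
          coord (φ a).rep (φ b).rep (φ c).rep (φ (D x)).rep := by
    intro x t u hxt
    have h1 := crossRatio_mul_coord (det2_rep_ne hab) (det2_rep_ne hac) (det2_rep_ne hbc)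
      (det2_rep_ne (hDc x).symm) (det2_rep_ne (hDc t).symm) (det2_rep_ne (hDc u).symm)
      (det2_rep_ne (hDne hxt.symm))
    rw [hD, hD, hD] at h1
    exact ⟨h1, crossRatio_mul_coord (inj hab) (inj hac) (inj hbc)
      (inj (hDc x).symm) (inj (hDc t).symm) (inj (hDc u).symm) (inj (hDne hxt.symm))⟩
  have bound : ∀ x t, t ≠ 0 →
      |coord (φ a).rep (φ b).rep (φ c).rep (φ (D (x + t))).rep -
          coord (φ a).rep (φ b).rep (φ c).rep (φ (D x)).rep| ≤
      M * |coord (φ a).rep (φ b).rep (φ c).rep (φ (D (x - t))).rep -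
          coord (φ a).rep (φ b).rep (φ c).rep (φ (D x)).rep| := by
    intro x t ht
    obtain ⟨h1, h2⟩ := cr x (x - t) (x + t) (by intro h; apply ht; linarith)
    have h3 : crossRatio (D x) (D (x - t)) c (D (x + t)) = -1 := by
      apply mul_right_cancel₀ ht
      linarith
    rw [← h2, abs_mul]
    gcongr
    exact hM _ _ _ _ h3
  refine ⟨fun x => coord (φ a).rep (φ b).rep (φ c).rep (φ (D x)).rep, ⟨mono, ?_, ?_, ?_, ?_⟩, ?_⟩
  · have h0 : coord a.rep b.rep c.rep b.rep = 0 := by simp [coord, det2_self]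
    have := hDp b hbc
    rw [h0] at this
    simp [this, coord, det2_self]
  · have h0 : ∀ {a b c : Fin 2 → ℝ}, det2 a b ≠ 0 → det2 a c ≠ 0 → coord a b c a = 1 := by
      intro a b c h1 h2
      unfold coord
      rw [det2_swap b a, det2_swap c a, div_eq_one_iff_eq (by simp [h1, h2])]
      ring
    have := hDp a hac
    rw [h0 (det2_rep_ne hab) (det2_rep_ne hac)] at this
    simp only [this]
    exact h0 (inj hab) (inj hac)
  · intro x t ht
    have h1 := bound x t ht.ne'
    have h2 := mono (show x < x + t by linarith)
    have h3 := mono (show x - t < x by linarith)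
    rw [abs_of_pos (sub_pos.2 h2), abs_of_neg (sub_neg.2 h3)] at h1
    linarith
  · intro x t ht
    have h1 := bound x (-t) (neg_ne_zero.2 ht.ne')
    rw [sub_neg_eq_add, ← sub_eq_add_neg] at h1
    have h2 := mono (show x < x + t by linarith)
    have h3 := mono (show x - t < x by linarith)
    rw [abs_of_pos (sub_pos.2 h2), abs_of_neg (sub_neg.2 h3)] at h1
    linarith
  · intro d hd
    simp only [hDp d hd]

lemma B4_self_of_lam {P P' : Fin 4 → ℝ} (hP : S.Lam φ ξ P) (hP' : S.Lam φ ξ P') : B4 P P' = 0 := by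
  obtain ⟨s, rfl, -⟩ := hP
  obtain ⟨s', rfl, -⟩ := hP'
  simp [B4_smul_left, B4_smul_right, Xi, B4_rk_rk, det2_self]

end Ext
end Surf

end

section

namespace Surf
namespace Ext
variable {S : Surf} {φ : RP1 → RP1} {ℓ M : ℝ} {ξ : RP1}

/-- The four-point relations between the pairings of null vectors and the coordinates. -/
lemma four_point (E : S.Ext φ ℓ) {a b c d : RP1} {A B C D : Fin 4 → ℝ} (hA : S.Lam φ a A)
    (hB : S.Lam φ b B) (hC : S.Lam φ c C) (hD : S.Lam φ d D) (hab : a ≠ b) (hac : a ≠ c)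
    (hbc : b ≠ c) (hd : d ≠ c) {p p' : ℝ} (hp : p = coord a.rep b.rep c.rep d.rep)
    (hp' : p' = coord (φ a).rep (φ b).rep (φ c).rep (φ d).rep) :
    B4 A C * B4 B D = p * p' * (B4 A B * B4 C D) ∧
    B4 A D * B4 B C = (p - 1) * (p' - 1) * (B4 A B * B4 C D) ∧
    vol A B C D = (p - p') * (B4 A B * B4 C D) := by
  have inj : ∀ {x y : RP1}, x ≠ y → det2 (φ x).rep (φ y).rep ≠ 0 :=
    fun h => det2_rep_ne (E.inj.ne h)
  have hq := coord_sub_one (det2_rep_ne hab) (det2_rep_ne hd.symm)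
  have hq' := coord_sub_one (inj hab) (inj hd.symm)
  have e1 : p * (det2 a.rep b.rep * det2 c.rep d.rep) = det2 a.rep c.rep * det2 b.rep d.rep := by
    rw [hp, coord, div_mul_cancel₀ _ (mul_ne_zero (det2_rep_ne hab) (det2_rep_ne hd.symm))]
  have e2 : (p - 1) * (det2 a.rep b.rep * det2 c.rep d.rep) = det2 a.rep d.rep * det2 b.rep c.rep := by
    rw [hp, hq, div_mul_cancel₀ _ (mul_ne_zero (det2_rep_ne hab) (det2_rep_ne hd.symm))]
  have e3 : p' * (det2 (φ a).rep (φ b).rep * det2 (φ c).rep (φ d).rep) =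
      det2 (φ a).rep (φ c).rep * det2 (φ b).rep (φ d).rep := by
    rw [hp', coord, div_mul_cancel₀ _ (mul_ne_zero (inj hab) (inj hd.symm))]
  have e4 : (p' - 1) * (det2 (φ a).rep (φ b).rep * det2 (φ c).rep (φ d).rep) =
      det2 (φ a).rep (φ d).rep * det2 (φ b).rep (φ c).rep := by
    rw [hp', hq', div_mul_cancel₀ _ (mul_ne_zero (inj hab) (inj hd.symm))]
  obtain ⟨sa, rfl, -⟩ := hA
  obtain ⟨sb, rfl, -⟩ := hB
  obtain ⟨sc, rfl, -⟩ := hC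
  obtain ⟨sd, rfl, -⟩ := hD
  have hv : vol (sa • Xi φ a) (sb • Xi φ b) (sc • Xi φ c) (sd • Xi φ d) =
      sa * sb * sc * sd * vol (Xi φ a) (Xi φ b) (Xi φ c) (Xi φ d) := by
    simp [vol]; ring
  rw [hv]
  simp only [B4_smul_left, B4_smul_right, Xi, B4_rk_rk, vol_rk]
  refine ⟨?_, ?_, ?_⟩
  · linear_combination (-(sa * sb * sc * sd)) * (det2 (φ a).rep (φ c).rep * det2 (φ b).rep (φ d).rep) * e1 +
      (-(sa * sb * sc * sd)) * p * (det2 a.rep b.rep * det2 c.rep d.rep) * e3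
  · linear_combination (-(sa * sb * sc * sd)) * (det2 (φ a).rep (φ d).rep * det2 (φ b).rep (φ c).rep) * e2 +
      (-(sa * sb * sc * sd)) * (p - 1) * (det2 a.rep b.rep * det2 c.rep d.rep) * e4
  · linear_combination (-(sa * sb * sc * sd)) * (det2 (φ a).rep (φ c).rep * det2 (φ b).rep (φ d).rep) * e2 +
      (-(sa * sb * sc * sd)) * (p - 1) * (det2 a.rep b.rep * det2 c.rep d.rep) * e3 +
      (sa * sb * sc * sd) * (det2 (φ a).rep (φ d).rep * det2 (φ b).rep (φ c).rep) * e1 +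
      (sa * sb * sc * sd) * p * (det2 a.rep b.rep * det2 c.rep d.rep) * e4

variable (E : S.Ext φ ℓ) (hM : ∀ z₁ z₂ z₃ z₄, crossRatio z₁ z₂ z₃ z₄ = -1 →
      |crossRatio (φ z₁) (φ z₂) (φ z₃) (φ z₄)| ≤ M) (hM1 : 1 ≤ M)
include E hM hM1

/-- The quadrilateral inequality for null vectors over the boundary curve. -/
lemma quad_le {a b c d : RP1} {A B C D : Fin 4 → ℝ} (hA : S.Lam φ a A)
    (hB : S.Lam φ b B) (hC : S.Lam φ c C) (hD : S.Lam φ d D) :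
    B4 A B * B4 C D ≤ 2 * (1 + M) * (B4 A C * B4 B D + B4 A D * B4 B C) := by
  have hAB := E.B4_nonneg_of_lam hA hB
  have hCD := E.B4_nonneg_of_lam hC hD
  have h1 := mul_nonneg (E.B4_nonneg_of_lam hA hC) (E.B4_nonneg_of_lam hB hD)
  have h2 := mul_nonneg (E.B4_nonneg_of_lam hA hD) (E.B4_nonneg_of_lam hB hC)
  have h0 : 0 ≤ 2 * (1 + M) * (B4 A C * B4 B D + B4 A D * B4 B C) := by positivity
  by_cases hab : a = b
  · subst hab
    rw [B4_self_of_lam hA hB]; linarith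
  by_cases hd : d = c
  · subst hd
    rw [B4_self_of_lam hC hD]; linarith
  have prop : ∀ {ξ : RP1} {P P' Q R : Fin 4 → ℝ}, S.Lam φ ξ P → S.Lam φ ξ P' →
      B4 P Q * B4 P' R = B4 P R * B4 P' Q := by
    rintro ξ P P' Q R ⟨s, rfl, -⟩ ⟨s', rfl, -⟩
    simp only [B4_smul_left]; ring
  by_cases hac : a = c
  · subst hac
    rw [prop hA hC, B4_comm C B]
    nlinarith
  by_cases hbc : b = c
  · subst hbc
    rw [B4_comm A B, prop hB hC, B4_comm C A]
    nlinarith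
  obtain ⟨f, hf, hfd⟩ := E.qsLine hM hab hac hbc
  obtain ⟨e1, e2, -⟩ := E.four_point hA hB hC hD hab hac hbc hd rfl (hfd d hd).symm
  rw [e1, e2]
  have := hf.quad_le (coord a.rep b.rep c.rep d.rep)
  nlinarith [mul_le_mul_of_nonneg_right this (mul_nonneg hAB hCD)]

lemma vol_le_aux {a b c d : RP1} {A B C D : Fin 4 → ℝ} (hA : S.Lam φ a A)
    (hB : S.Lam φ b B) (hC : S.Lam φ c C) (hD : S.Lam φ d D) (hab : a ≠ b) (hac : a ≠ c)
    (hbc : b ≠ c) (hd : d ≠ c) (hp : coord a.rep b.rep c.rep d.rep ∈ Icc (0 : ℝ) 1) :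
    |vol A B C D| ≤ (M - 1) / (M + 1) * (B4 A B * B4 C D) := by
  have h := mul_nonneg (E.B4_nonneg_of_lam hA hB) (E.B4_nonneg_of_lam hC hD)
  obtain ⟨f, hf, hfd⟩ := E.qsLine hM hab hac hbc
  obtain ⟨-, -, e⟩ := E.four_point hA hB hC hD hab hac hbc hd rfl (hfd d hd).symm
  rw [e, abs_mul, abs_of_nonneg h, abs_sub_comm]
  gcongr
  exact hf.abs_sub_le hp

/-- The volume spanned by four null vectors over the boundary curve. -/
lemma vol_le {a b c d : RP1} {A B C D : Fin 4 → ℝ} (hA : S.Lam φ a A)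
    (hB : S.Lam φ b B) (hC : S.Lam φ c C) (hD : S.Lam φ d D) :
    |vol A B C D| ≤ (M - 1) / (M + 1) * (B4 A B * B4 C D + B4 A C * B4 B D + B4 A D * B4 B C) := by
  have hδ : 0 ≤ (M - 1) / (M + 1) := div_nonneg (by linarith) (by linarith)
  have h0 := mul_nonneg (E.B4_nonneg_of_lam hA hB) (E.B4_nonneg_of_lam hC hD)
  have h1 := mul_nonneg (E.B4_nonneg_of_lam hA hC) (E.B4_nonneg_of_lam hB hD)
  have h2 := mul_nonneg (E.B4_nonneg_of_lam hA hD) (E.B4_nonneg_of_lam hB hC)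
  have hR : 0 ≤ (M - 1) / (M + 1) * (B4 A B * B4 C D + B4 A C * B4 B D + B4 A D * B4 B C) := by
    positivity
  have prop : ∀ {ξ : RP1} {P P' : Fin 4 → ℝ}, S.Lam φ ξ P → S.Lam φ ξ P' →
      ∃ s s' : ℝ, P = s • Xi φ ξ ∧ P' = s' • Xi φ ξ := by
    rintro ξ P P' ⟨s, rfl, -⟩ ⟨s', rfl, -⟩
    exact ⟨s, s', rfl, rfl⟩
  by_cases hab : a = b
  · subst hab
    obtain ⟨s, s', rfl, rfl⟩ := prop hA hB
    convert hR
    rw [abs_eq_zero]; simp [vol]; ring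
  by_cases hac : a = c
  · subst hac
    obtain ⟨s, s', rfl, rfl⟩ := prop hA hC
    convert hR
    rw [abs_eq_zero]; simp [vol]; ring
  by_cases had : a = d
  · subst had
    obtain ⟨s, s', rfl, rfl⟩ := prop hA hD
    convert hR
    rw [abs_eq_zero]; simp [vol]; ring
  by_cases hbc : b = c
  · subst hbc
    obtain ⟨s, s', rfl, rfl⟩ := prop hB hC
    convert hR
    rw [abs_eq_zero]; simp [vol]; ring
  by_cases hbd : b = d
  · subst hbd
    obtain ⟨s, s', rfl, rfl⟩ := prop hB hD
    convert hR
    rw [abs_eq_zero]; simp [vol]; ring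
  by_cases hcd : c = d
  · subst hcd
    obtain ⟨s, s', rfl, rfl⟩ := prop hC hD
    convert hR
    rw [abs_eq_zero]; simp [vol]; ring
  set p := coord a.rep b.rep c.rep d.rep with hp
  have j1 := det2_rep_ne hab
  have j2 := det2_rep_ne hac
  have j3 := det2_rep_ne had
  have j4 := det2_rep_ne hbc
  have j5 := det2_rep_ne hbd
  have j6 := det2_rep_ne hcd
  rcases lt_or_ge p 0 with hp0 | hp0
  · have hq : coord a.rep d.rep c.rep b.rep = p / (p - 1) := by
      rw [hp, coord_sub_one j1 j6, coord, coord, det2_swap d.rep b.rep, det2_swap c.rep b.rep]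
      field_simp
    have := E.vol_le_aux hM hM1 hA hD hC hB had hac (Ne.symm hcd) hbc
      (by
        rw [hq, ← neg_div_neg_eq]
        exact ⟨div_nonneg (by linarith) (by linarith), (div_le_one (by linarith)).2 (by linarith)⟩)
    rw [show vol A D C B = -vol A B C D by unfold vol; ring, abs_neg, B4_comm C B] at this
    refine this.trans ?_
    gcongr
    linarith
  rcases lt_or_ge 1 p with hp1 | hp1
  · have hq : coord d.rep b.rep c.rep a.rep = 1 / p := by
      rw [hp, coord, coord, det2_swap d.rep b.rep, det2_swap c.rep a.rep, det2_swap d.rep c.rep,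
        det2_swap b.rep a.rep]
      field_simp
    have := E.vol_le_aux hM hM1 hD hB hC hA (Ne.symm hbd) (Ne.symm hcd) hbc hac
      (by
        rw [hq]
        exact ⟨by positivity, (div_le_one (by linarith)).2 (by linarith)⟩)
    rw [show vol D B C A = -vol A B C D by unfold vol; ring, abs_neg, B4_comm C A, B4_comm D B] at this
    refine this.trans ?_
    gcongr
    linarith
  · refine (E.vol_le_aux hM hM1 hA hB hC hD hab hac hbc (Ne.symm hcd) ⟨hp0, hp1⟩).trans ?_
    gcongr
    linarith

end Ext
end Surf

end

section

namespace Surf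
variable {S : Surf} {φ : RP1 → RP1} {ℓ M : ℝ} {z : ℂ}

/-- The unit vector representing `n`. -/
def NF (S : Surf) (z : ℂ) : Fin 4 → ℝ :=
  ![(S.k z).im, -(S.k z * S.Φ z).im, -(S.k z * conj z).im, (S.k z * (conj z * S.Φ z)).im]

lemma n_eq_B4 (P : Fin 4 → ℝ) (z : ℂ) : S.n P z = B4 P (S.NF z) := by
  simp [n, U, bipoly, B4, NF]; ring

lemma B4_NF (hz : z ∈ Hset) : B4 (S.NF z) (S.NF z) = 2 ∧ B4 (S.PF z) (S.NF z) = 0 := by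
  have h := S.normSq_k hz
  rw [Complex.normSq_apply] at h
  constructor
  · simp [B4, NF]
    linear_combination 2 * h
  · simp [B4, NF, PF]
    ring

lemma vol_PF_NF (P Q : Fin 4 → ℝ) (z : ℂ) :
    vol (S.PF z) (S.NF z) P Q = (conj (S.V P z) * S.V Q z).im := by
  simp [vol, PF, NF, V, bipoly]
  ring

/-- The vectors on which every functional nonnegative along the boundary curve is nonnegative. -/
def InHull (S : Surf) (φ : RP1 → RP1) (Y : Fin 4 → ℝ) : Prop :=
  ∀ Q, (∀ ξ P, S.Lam φ ξ P → 0 ≤ B4 Q P) → 0 ≤ B4 Q Y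

lemma InHull.nonneg {Y : Fin 4 → ℝ} (hY : S.InHull φ Y) (L : (Fin 4 → ℝ) → ℝ)
    (hadd : ∀ P Q, L (P + Q) = L P + L Q) (hsmul : ∀ (c : ℝ) P, L (c • P) = c * L P)
    (hL : ∀ ξ P, S.Lam φ ξ P → 0 ≤ L P) : 0 ≤ L Y := by
  set Q : Fin 4 → ℝ := ![L ![0, 0, 0, 1], -L ![0, 0, 1, 0], -L ![0, 1, 0, 0], L ![1, 0, 0, 0]] with hQ
  have key : ∀ P, B4 Q P = L P := by
    intro P
    have : P = P 0 • ![1, 0, 0, 0] + P 1 • ![0, 1, 0, 0] + P 2 • ![0, 0, 1, 0] + P 3 • ![0, 0, 0, 1] := by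
      ext i; fin_cases i <;> simp
    conv_rhs => rw [this]
    rw [hadd, hadd, hadd, hsmul, hsmul, hsmul, hsmul]
    simp [B4, hQ]; ring
  rw [← key]
  apply hY
  intro ξ P hP
  rw [key]
  exact hL ξ P hP

namespace Ext

lemma exists_lam_frame (E : S.Ext φ ℓ) (hz : z ∈ Hset) {ζ : ℂ} (hζ : ζ ≠ 0) :
    ∃ ξ P, S.Lam φ ξ P ∧ S.u P z = 1 ∧ conj ζ * S.V P z = ζ * S.U P z := by
  have hy : z.im ≠ 0 := ne_of_gt hz
  set v : Fin 2 → ℝ := ![ζ.im / z.im * z.re - ζ.re, ζ.im / z.im] with hv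
  have hv0 : v ≠ 0 := by
    intro h
    have h0 := congrFun h 0
    have h1 := congrFun h 1
    simp [hv, hy] at h0 h1
    rw [h1] at h0
    simp at h0
    exact hζ (Complex.ext h0 h1)
  have e1 : (v 1 : ℂ) * z - v 0 = ζ := by
    apply Complex.ext <;> simp [hv] <;> field_simp
  have e2 : (v 1 : ℂ) * conj z - v 0 = conj ζ := by
    rw [← e1]; simp
  obtain ⟨c, hc, hrep⟩ := mk_rep_apply hv0
  obtain ⟨P, hP⟩ := E.exists_lam (Projectivization.mk ℝ v hv0)
  have hV : conj ζ * S.V P z = ζ * S.U P z := by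
    obtain ⟨s, rfl, -⟩ := hP
    simp only [V, U, bipoly, Xi, rk, hrep, ← e1, ← e2]
    simp
    ring
  obtain ⟨s, hs, hpos⟩ := hP
  have hu := hpos z hz
  refine ⟨_, (S.u P z)⁻¹ • P, ⟨(S.u P z)⁻¹ * s, by rw [mul_smul, ← hs], fun w hw => ?_⟩, ?_, ?_⟩
  · rw [u_smul]
    exact mul_pos (inv_pos.2 hu) (hpos w hw)
  · rw [u_smul, inv_mul_cancel₀ hu.ne']
  · rw [U_smul, show S.V ((S.u P z)⁻¹ • P) z = (S.u P z)⁻¹ * S.V P z by simp [V, bipoly]; ring]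
    push_cast
    linear_combination (S.u P z : ℂ)⁻¹ * hV

variable (E : S.Ext φ ℓ) (hM : ∀ z₁ z₂ z₃ z₄, crossRatio z₁ z₂ z₃ z₄ = -1 →
      |crossRatio (φ z₁) (φ z₂) (φ z₃) (φ z₄)| ≤ M) (hM1 : 1 ≤ M)
include E hM hM1

lemma quad_le_hull {A B C D : Fin 4 → ℝ} (hA : S.InHull φ A) (hB : S.InHull φ B) (hC : S.InHull φ C)
    (hD : S.InHull φ D) :
    0 ≤ 2 * (1 + M) * (B4 A C * B4 B D + B4 A D * B4 B C) - B4 A B * B4 C D := by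
  refine hA.nonneg (fun A => 2 * (1 + M) * (B4 A C * B4 B D + B4 A D * B4 B C) - B4 A B * B4 C D)
    (fun _ _ => by simp only [B4_add_left]; ring) (fun _ _ => by simp only [B4_smul_left]; ring)
    fun ξa A hA => ?_
  refine hB.nonneg (fun B => 2 * (1 + M) * (B4 A C * B4 B D + B4 A D * B4 B C) - B4 A B * B4 C D)
    (fun _ _ => by simp only [B4_add_left, B4_add_right]; ring)
    (fun _ _ => by simp only [B4_smul_left, B4_smul_right]; ring)
    fun ξb B hB => ?_
  refine hC.nonneg (fun C => 2 * (1 + M) * (B4 A C * B4 B D + B4 A D * B4 B C) - B4 A B * B4 C D)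
    (fun _ _ => by simp only [B4_add_left, B4_add_right]; ring)
    (fun _ _ => by simp only [B4_smul_left, B4_smul_right]; ring)
    fun ξc C hC => ?_
  refine hD.nonneg (fun D => 2 * (1 + M) * (B4 A C * B4 B D + B4 A D * B4 B C) - B4 A B * B4 C D)
    (fun _ _ => by simp only [B4_add_right]; ring)
    (fun _ _ => by simp only [B4_smul_right]; ring)
    fun ξd D hD => ?_
  exact sub_nonneg.2 (E.quad_le hM hM1 hA hB hC hD)

lemma vol_le_hull {ξc ξd : RP1} {A B C D : Fin 4 → ℝ} (hA : S.InHull φ A) (hB : S.InHull φ B)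
    (hC : S.Lam φ ξc C) (hD : S.Lam φ ξd D) (ς : ℝ) (hς : ς = 1 ∨ ς = -1) :
    0 ≤ (M - 1) / (M + 1) * (B4 A B * B4 C D + B4 A C * B4 B D + B4 A D * B4 B C) -
      ς * vol A B C D := by
  refine hA.nonneg (fun A => (M - 1) / (M + 1) * (B4 A B * B4 C D + B4 A C * B4 B D + B4 A D * B4 B C) -
      ς * vol A B C D)
    (fun _ _ => by simp only [B4_add_left]; simp only [vol, Pi.add_apply]; ring)
    (fun _ _ => by simp only [B4_smul_left]; simp only [vol, Pi.smul_apply, smul_eq_mul]; ring)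
    fun ξa A hA => ?_
  refine hB.nonneg (fun B => (M - 1) / (M + 1) * (B4 A B * B4 C D + B4 A C * B4 B D + B4 A D * B4 B C) -
      ς * vol A B C D)
    (fun _ _ => by simp only [B4_add_left, B4_add_right]; simp only [vol, Pi.add_apply]; ring)
    (fun _ _ => by
      simp only [B4_smul_left, B4_smul_right]; simp only [vol, Pi.smul_apply, smul_eq_mul]; ring)
    fun ξb B hB => ?_
  have := abs_le.1 (E.vol_le hM hM1 hA hB hC hD)
  rcases hς with rfl | rfl <;> linarith [this.1, this.2]

lemma exists_dual_large (hz : z ∈ Hset) {s : ℝ} (hs0 : 0 ≤ s)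
    (hs : 4 * (1 + M) * (2 - 2 * s ^ 2) ^ 2 < (2 + 2 * s ^ 2) ^ 2) :
    ∃ Q, (∀ ξ P, S.Lam φ ξ P → 0 ≤ B4 Q P) ∧ S.u Q z < s * |S.n Q z| := by
  by_contra! hc
  have hY : ∀ r : ℝ, |r| = s → S.InHull φ (S.PF z + r • S.NF z) := by
    intro r hr Q hQ
    have h1 := hc Q hQ
    rw [B4_add_right, B4_smul_right, ← u_eq_B4, ← n_eq_B4]
    have := neg_abs_le (r * S.n Q z)
    rw [abs_mul, hr] at this
    linarith
  have h1 := hY s (abs_of_nonneg hs0)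
  have h2 := hY (-s) (by rw [abs_neg, abs_of_nonneg hs0])
  have h3 := E.quad_le_hull hM hM1 h1 h1 h2 h2
  obtain ⟨b1, b2⟩ := B4_NF (S := S) hz
  have b3 := B4_PF_self (S := S) hz
  simp only [B4_add_left, B4_add_right, B4_smul_left, B4_smul_right, B4_comm (S.NF z) (S.PF z),
    b1, b2, b3] at h3
  linarith

lemma exists_dual_small (hz : z ∈ Hset) {K : ℝ} (hK : 1 ≤ K) (hδ : 18 * ((M - 1) / (M + 1)) * K < 1) :
    ∃ Q, (∀ ξ P, S.Lam φ ξ P → 0 ≤ B4 Q P) ∧ K * S.u Q z < |S.n Q z| := by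
  by_contra! hc
  set δ := (M - 1) / (M + 1) with hδdef
  have hδ0 : 0 ≤ δ := div_nonneg (by linarith) (by linarith)
  have hY : ∀ r : ℝ, |r| = 1 → S.InHull φ (K • S.PF z + r • S.NF z) := by
    intro r hr Q hQ
    have h1 := hc Q hQ
    rw [B4_add_right, B4_smul_right, B4_smul_right, ← u_eq_B4, ← n_eq_B4]
    have := neg_abs_le (r * S.n Q z)
    rw [abs_mul, hr] at this
    linarith
  obtain ⟨b1, b2⟩ := B4_NF (S := S) hz
  have b3 := B4_PF_self (S := S) hz
  have key : ∀ ξ ξ' P Q, S.Lam φ ξ P → S.Lam φ ξ' Q → S.u P z = 1 → S.u Q z = 1 →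
      (conj (S.V P z) * S.V Q z).im ≤ 6 * δ * K := by
    intro ξ ξ' P Q hP hQ huP huQ
    have h := E.vol_le_hull hM hM1 (hY 1 (by simp)) (hY (-1) (by simp)) hP hQ (-1) (Or.inr rfl)
    have hv : vol (K • S.PF z + (1 : ℝ) • S.NF z) (K • S.PF z + (-1 : ℝ) • S.NF z) P Q =
        -2 * K * vol (S.PF z) (S.NF z) P Q := by
      simp only [vol, Pi.add_apply, Pi.smul_apply, smul_eq_mul]; ring
    rw [hv, vol_PF_NF] at h
    have hnP := abs_le.1 ((E.good_of_lam hP).n_le z hz)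
    have hnQ := abs_le.1 ((E.good_of_lam hQ).n_le z hz)
    rw [huP] at hnP
    rw [huQ] at hnQ
    have hPQ : B4 P Q ≤ 2 := by
      have h1 := S.normSq_V (P + Q) hz
      have h2 : 2 * det4 (P + Q) = 2 * B4 P Q + 2 * det4 P + 2 * det4 Q := by
        rw [← B4_self, ← B4_self, ← B4_self, B4_add_left, B4_add_right, B4_add_right, B4_comm Q P]
        ring
      have h3 : ∀ {ξ P}, S.Lam φ ξ P → det4 P = 0 := by
        rintro ξ P ⟨s, rfl, -⟩
        rw [det4_smul, det4_Xi, mul_zero]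
      rw [h3 hP, h3 hQ] at h2
      rw [u_add, n_add, huP, huQ] at h1
      have h4 := Complex.normSq_nonneg (S.V (P + Q) z)
      nlinarith [hnP.1, hnP.2, hnQ.1, hnQ.2]
    have hPQ0 := E.B4_nonneg_of_lam hP hQ
    simp only [B4_add_left, B4_add_right, B4_smul_left, B4_smul_right, B4_comm (S.NF z) (S.PF z),
      b1, b2, b3, B4_comm (S.PF z) P, B4_comm (S.PF z) Q, B4_comm (S.NF z) P, B4_comm (S.NF z) Q] at h
    simp only [← u_eq_B4, ← n_eq_B4, huP, huQ] at h
    rw [← hδdef] at h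
    have g1 : (K * (K * 2 + -1 * 0) + 1 * (K * 0 + -1 * 2)) * B4 P Q ≤ 4 * K ^ 2 := by
      nlinarith
    have g2 : (K * 1 + 1 * S.n P z) * (K * 1 + -1 * S.n Q z) ≤ 4 * K ^ 2 := by
      have h1 : 0 ≤ K + S.n P z := by linarith
      have h2 : 0 ≤ K - S.n Q z := by linarith
      nlinarith [mul_le_mul (show K + S.n P z ≤ 2 * K by linarith)
        (show K - S.n Q z ≤ 2 * K by linarith) h2 (by linarith)]
    have g3 : (K * 1 + 1 * S.n Q z) * (K * 1 + -1 * S.n P z) ≤ 4 * K ^ 2 := by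
      have h1 : 0 ≤ K + S.n Q z := by linarith
      have h2 : 0 ≤ K - S.n P z := by linarith
      nlinarith [mul_le_mul (show K + S.n Q z ≤ 2 * K by linarith)
        (show K - S.n P z ≤ 2 * K by linarith) h2 (by linarith)]
    have g4 := mul_le_mul_of_nonneg_left (add_le_add (add_le_add g1 g2) g3) hδ0
    have g5 : 2 * K * (conj (S.V P z) * S.V Q z).im ≤ 2 * K * (6 * δ * K) := by
      linarith
    exact le_of_mul_le_mul_left g5 (by linarith)
  obtain ⟨ξ₀, P₀, h0, u0, v0⟩ := E.exists_lam_frame hz (ζ := 1) one_ne_zero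
  obtain ⟨ξ₁, P₁, h1, u1, v1⟩ := E.exists_lam_frame hz (ζ := ⟨1, √3⟩) (by
    intro h; have := congrArg Complex.re h; simp at this)
  obtain ⟨ξ₂, P₂, h2, u2, v2⟩ := E.exists_lam_frame hz (ζ := ⟨-1, √3⟩) (by
    intro h; have := congrArg Complex.re h; simp at this)
  have k1 := key _ _ _ _ h0 h1 u0 u1
  have k2 := key _ _ _ _ h1 h2 u1 u2
  have k3 := key _ _ _ _ h2 h0 u2 u0
  have m0 := abs_le.1 ((E.good_of_lam h0).n_le z hz)
  have m1 := abs_le.1 ((E.good_of_lam h1).n_le z hz)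
  have m2 := abs_le.1 ((E.good_of_lam h2).n_le z hz)
  rw [u0] at m0
  rw [u1] at m1
  rw [u2] at m2
  have hr : √3 ^ 2 = 3 := Real.sq_sqrt (by norm_num)
  have hr0 : 1 ≤ √3 := Real.one_le_sqrt.2 (by norm_num)
  have re1 := congrArg Complex.re v1
  have im1 := congrArg Complex.im v1
  have re2 := congrArg Complex.re v2
  have im2 := congrArg Complex.im v2
  have re0 := congrArg Complex.re v0
  have im0 := congrArg Complex.im v0
  have e0 : (S.U P₀ z).re = 1 := u0
  have e1 : (S.U P₁ z).re = 1 := u1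
  have e2 : (S.U P₂ z).re = 1 := u2
  have f0 : (S.U P₀ z).im = S.n P₀ z := rfl
  have f1 : (S.U P₁ z).im = S.n P₁ z := rfl
  have f2 : (S.U P₂ z).im = S.n P₂ z := rfl
  simp only [Complex.mul_re, Complex.mul_im, Complex.conj_re, Complex.conj_im, Complex.one_re,
    Complex.one_im, e0, e1, e2, f0, f1, f2] at re0 im0 re1 im1 re2 im2 k1 k2 k3
  generalize S.n P₀ z = n0 at *
  generalize S.n P₁ z = n1 at *
  generalize S.n P₂ z = n2 at *
  generalize (S.V P₀ z).re = p0 at *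
  generalize (S.V P₀ z).im = q0 at *
  generalize (S.V P₁ z).re = p1 at *
  generalize (S.V P₁ z).im = q1 at *
  generalize (S.V P₂ z).re = p2 at *
  generalize (S.V P₂ z).im = q2 at *
  generalize √3 = r at *
  have a0 : p0 = 1 := by linarith
  have b0 : q0 = n0 := by linarith
  have a1 : p1 = (-1 - r * n1) / 2 := by
    linear_combination re1 / 4 - r * im1 / 4 - p1 * hr / 4 - hr / 4
  have b1 : q1 = (r - n1) / 2 := by
    linear_combination r * re1 / 4 + im1 / 4 - q1 * hr / 4 - n1 * hr / 4
  have a2 : p2 = (-1 + r * n2) / 2 := by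
    linear_combination -re2 / 4 - r * im2 / 4 - p2 * hr / 4 - hr / 4
  have b2 : q2 = (-r - n2) / 2 := by
    linear_combination r * re2 / 4 - im2 / 4 - q2 * hr / 4 - n2 * hr / 4
  subst a0 b0 a1 b1 a2 b2
  have hs : (1 * ((r - n1) / 2) + -q0 * ((-1 - r * n1) / 2)) +
      ((-1 - r * n1) / 2 * ((-r - n2) / 2) + -((r - n1) / 2) * ((-1 + r * n2) / 2)) +
      ((-1 + r * n2) / 2 * q0 + -((-r - n2) / 2) * 1) =
      r / 2 * (3 + q0 * n1 + n1 * n2 + n2 * q0) := by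
    linear_combination (n1 - n2) / 4 * hr
  have hp : 2 ≤ 3 + q0 * n1 + n1 * n2 + n2 * q0 := by
    nlinarith [mul_nonneg (mul_nonneg (sub_nonneg.2 m0.2) (sub_nonneg.2 m1.2)) (sub_nonneg.2 m2.2),
      mul_nonneg (mul_nonneg (sub_nonneg.2 m0.1) (sub_nonneg.2 m1.1)) (sub_nonneg.2 m2.1)]
  nlinarith
lemma dual_a_le (hz : z ∈ Hset) {K : ℝ} (hK : 1 ≤ K) (hδ : 18 * ((M - 1) / (M + 1)) * K < 1) :
    S.a z * K ^ 2 ≤ 126 := by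
  obtain ⟨Q, hQ, h⟩ := E.exists_dual_small hM hM1 hz hK hδ
  have h1 := E.a_mul_n_sq_le hQ hz
  have hu := E.u_nonneg_of_dual hQ z hz
  have ha := S.a_nonneg (z := z)
  have hn : 0 < |S.n Q z| := lt_of_le_of_lt (by positivity) h
  have h2 : (K * S.u Q z) ^ 2 ≤ |S.n Q z| ^ 2 := by gcongr
  rw [sq_abs] at h2
  have hn2 : 0 < S.n Q z ^ 2 := by rw [← sq_abs]; positivity
  have h3 : S.a z * K ^ 2 * S.n Q z ^ 2 ≤ 126 * S.n Q z ^ 2 := by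
    nlinarith [mul_le_mul_of_nonneg_right h1 (sq_nonneg K)]
  exact le_of_mul_le_mul_right h3 hn2

lemma neg_log_a_ge (hz : z ∈ Hset) (ha : 0 < S.a z) :
    (1 / (4 * √(1 + M))) ^ 6000 ≤ 4000 * Real.exp 12 * (-Real.log (S.a z)) := by
  obtain ⟨N, hN⟩ : ∃ N : ℕ, N = 6000 := ⟨_, rfl⟩
  rw [← hN]
  set r := √(1 + M) with hr
  have hr2 : r ^ 2 = 1 + M := Real.sq_sqrt (by linarith)
  have hr1 : 1 ≤ r := Real.one_le_sqrt.2 (by linarith)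
  have hw : 0 < 1 / (4 * r) := by positivity
  have hw1 : 1 / (4 * r) ≤ 1 / 4 := by
    rw [div_le_div_iff₀ (by linarith) (by norm_num)]; linarith
  have hwr : 1 / (4 * r) * r = 1 / 4 := by field_simp
  generalize 1 / (4 * r) = w at hw hw1 hwr ⊢
  obtain ⟨Q, hQ, h⟩ := E.exists_dual_large hM hM1 hz (s := 1 - w) (by linarith) (by
    rw [← hr2]
    have h1 : 2 - 2 * (1 - w) ^ 2 ≤ 4 * w := by nlinarith
    have h0 : 0 ≤ 2 - 2 * (1 - w) ^ 2 := by nlinarith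
    have h2 : 4 * r ^ 2 * (2 - 2 * (1 - w) ^ 2) ^ 2 ≤ 4 * r ^ 2 * (4 * w) ^ 2 := by gcongr
    have h3 : 4 * r ^ 2 * (4 * w) ^ 2 = 4 := by
      linear_combination 64 * (w * r + 1 / 4) * hwr
    have h4 : 0 < (1 - w) ^ 2 := by apply pow_pos; linarith
    nlinarith)
  have hu := E.u_nonneg_of_dual hQ z hz
  have hn : 0 < |S.n Q z| := by
    have := lt_of_le_of_lt hu h
    exact (pos_iff_pos_of_mul_pos this).1 (by linarith)
  obtain ⟨ς, hς, hςn⟩ : ∃ ς : ℝ, ς ^ 2 = 1 ∧ ς * S.n Q z = |S.n Q z| := by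
    rcases abs_cases (S.n Q z) with ⟨h1, -⟩ | ⟨h1, -⟩
    · exact ⟨1, by norm_num, by rw [h1, one_mul]⟩
    · exact ⟨-1, by norm_num, by rw [h1]; ring⟩
  have h5 := E.barrier_le hQ hz hς (by rw [hςn]; nlinarith) ha
  rw [← hN, hςn] at h5
  refine le_trans (pow_le_pow_left₀ hw.le ?_ _) h5
  have : S.u Q z / |S.n Q z| ≤ 1 - w := by rw [div_le_iff₀ hn]; exact h.le
  linarith

end Ext
end Surf

end

section

/-- The Wirtinger derivative `∂f/∂z`. -/
def dz (f : ℂ → ℂ) (z : ℂ) : ℂ := (fderiv ℝ f z 1 - Complex.I * fderiv ℝ f z Complex.I) / 2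

/-- The Wirtinger derivative `∂f/∂z̄`. -/
def dzb (f : ℂ → ℂ) (z : ℂ) : ℂ := (fderiv ℝ f z 1 + Complex.I * fderiv ℝ f z Complex.I) / 2

variable {t f p q : ℂ → ℂ} {z : ℂ}

lemma fderiv_eq_dz (f : ℂ → ℂ) (z v : ℂ) : fderiv ℝ f z v = dz f z * v + dzb f z * conj v := by
  have h : v = v.re • (1 : ℂ) + v.im • Complex.I := by
    apply Complex.ext <;> simp
  conv_lhs => rw [h]
  rw [map_add, map_smul, map_smul]
  unfold dz dzb
  generalize fderiv ℝ f z 1 = A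
  generalize fderiv ℝ f z Complex.I = B
  apply Complex.ext <;> simp <;> ring

lemma hasDD_of_differentiableAt (hy : 0 < z.im) (ht : ‖t z‖ < 1) (h : DifferentiableAt ℝ f z) :
    HasDD t f z (z.im * (dz f z - conj (t z) * dzb f z)) (z.im * (dzb f z - t z * dz f z)) :=
  hasDD_of_hasFDerivAt hy ht h.hasFDerivAt

lemma HasDD.eq (hy : 0 < z.im) (ht : ‖t z‖ < 1) {p q : ℂ} (h : HasDD t f z p q) :
    p = z.im * (dz f z - conj (t z) * dzb f z) ∧ q = z.im * (dzb f z - t z * dz f z) :=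
  h.unique hy ht (hasDD_of_differentiableAt hy ht h.differentiableAt)

lemma contDiffAt_dz {n : WithTop ℕ∞} (h : ContDiffAt ℝ (n + 1) f z) : ContDiffAt ℝ n (dz f) z := by
  have h1 := h.fderiv_right (m := n) le_rfl
  unfold dz
  fun_prop

lemma contDiffAt_dzb {n : WithTop ℕ∞} (h : ContDiffAt ℝ (n + 1) f z) : ContDiffAt ℝ n (dzb f) z := by
  have h1 := h.fderiv_right (m := n) le_rfl
  unfold dzb
  fun_prop

lemma dzb_dz (h : ContDiffAt ℝ 2 f z) : dzb (dz f) z = dz (dzb f) z := by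
  have h1 : DifferentiableAt ℝ (fderiv ℝ f) z := by
    have := h.fderiv_right (m := 1) (by norm_num)
    exact this.differentiableAt (by norm_num)
  have hs := second_derivative_symmetric_of_eventually (f' := fderiv ℝ f) (f'' := fderiv ℝ (fderiv ℝ f) z)
    (x := z) (f := f) ?_ h1.hasFDerivAt 1 Complex.I
  · have e1 : ∀ v w, fderiv ℝ (fun u => fderiv ℝ f u w) z v = fderiv ℝ (fderiv ℝ f) z v w := by
      intro v w
      have := h1.hasFDerivAt.clm_apply (hasFDerivAt_const w z)
      rw [this.fderiv]
      simp
    have d1 : ∀ w, DifferentiableAt ℝ (fun u => fderiv ℝ f u w) z := fun w =>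
      h1.clm_apply (differentiableAt_const w)
    have e2 : ∀ v, fderiv ℝ (dz f) z v =
        (fderiv ℝ (fderiv ℝ f) z v 1 - Complex.I * fderiv ℝ (fderiv ℝ f) z v Complex.I) / 2 := by
      intro v
      have := (((d1 1).hasFDerivAt.sub ((d1 Complex.I).hasFDerivAt.const_mul Complex.I)).mul_const
        (2 : ℂ)⁻¹)
      have h2 : HasFDerivAt (dz f) _ z := this
      rw [h2.fderiv]
      simp [e1]
      ring
    have e3 : ∀ v, fderiv ℝ (dzb f) z v =
        (fderiv ℝ (fderiv ℝ f) z v 1 + Complex.I * fderiv ℝ (fderiv ℝ f) z v Complex.I) / 2 := by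
      intro v
      have := (((d1 1).hasFDerivAt.add ((d1 Complex.I).hasFDerivAt.const_mul Complex.I)).mul_const
        (2 : ℂ)⁻¹)
      have h2 : HasFDerivAt (dzb f) _ z := this
      rw [h2.fderiv]
      simp [e1]
      ring
    rw [dz, dzb, e2, e2, e3, e3, hs]
    ring
  · have := h.eventually (by simp)
    filter_upwards [this] with w hw
    exact (hw.differentiableAt (by norm_num)).hasFDerivAt

/-- The commutation relation of the two frame derivatives. -/
lemma HasDD.commutator (hy : 0 < z.im) (ht : ‖t z‖ < 1) {τ p₁ p₂ q₁ q₂ : ℂ}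
    (htt : HasDD t t z (-Complex.I * (1 - conj (t z)) * t z) τ) (htn : ∀ᶠ w in 𝓝 z, ‖t w‖ < 1)
    (hf : ContDiffAt ℝ 2 f z) (hfd : ∀ᶠ w in 𝓝 z, HasDD t f w (p w) (q w))
    (hp : HasDD t p z p₁ p₂) (hq : HasDD t q z q₁ q₂) :
    q₁ - p₂ = -(Complex.I / 2) * ((1 - conj (t z)) * q z + (1 - t z) * p z) := by
  have hd1 : DifferentiableAt ℝ (dz f) z :=
    (contDiffAt_dz (n := 1) (by norm_num; exact hf)).differentiableAt (by norm_num)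
  have hd2 : DifferentiableAt ℝ (dzb f) z :=
    (contDiffAt_dzb (n := 1) (by norm_num; exact hf)).differentiableAt (by norm_num)
  have hF := hasDD_of_differentiableAt (t := t) hy ht hd1
  have hG := hasDD_of_differentiableAt (t := t) hy ht hd2
  have hev : ∀ᶠ w in 𝓝 z, p w = w.im * (dz f w - conj (t w) * dzb f w) ∧
      q w = w.im * (dzb f w - t w * dz f w) := by
    filter_upwards [hfd, htn, isOpen_Hset.mem_nhds (show z ∈ Hset from hy)] with w h1 h2 h3
    exact h1.eq h3 h2
  have hY := (hasGrad_im (t := t) hy ht).ofReal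
  have hp' := (hY.mul (hF.sub (htt.conj.mul hG))).congr_of_eventuallyEq
    (hev.mono fun w hw => hw.1)
  have hq' := (hY.mul (hG.sub (htt.mul hF))).congr_of_eventuallyEq (hev.mono fun w hw => hw.2)
  obtain ⟨-, hp2⟩ := hp.unique hy ht hp'
  obtain ⟨hq1, -⟩ := hq.unique hy ht hq'
  obtain ⟨e1, e2⟩ := hev.self_of_nhds
  rw [hp2, hq1, e1, e2, dzb_dz hf]
  simp
  ring

end

section

lemma clm_apply_eq (L : ℂ →L[ℝ] ℂ) (v : ℂ) :
    L v = (L 1 - Complex.I * L Complex.I) / 2 * v + (L 1 + Complex.I * L Complex.I) / 2 * conj v := by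
  have h : v = v.re • (1 : ℂ) + v.im • Complex.I := by
    apply Complex.ext <;> simp
  conv_lhs => rw [h]
  rw [map_add, map_smul, map_smul]
  generalize L 1 = A
  generalize L Complex.I = B
  apply Complex.ext <;> simp <;> ring

lemma det_clm (L : ℂ →L[ℝ] ℂ) : LinearMap.det ((L : ℂ →L[ℝ] ℂ) : ℂ →ₗ[ℝ] ℂ) =
    (L 1).re * (L Complex.I).im - (L 1).im * (L Complex.I).re := by
  rw [← LinearMap.det_toMatrix Complex.basisOneI, Matrix.det_fin_two]
  simp [LinearMap.toMatrix_apply]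
  ring

/-- The data of a minimal Lagrangian map preserving the orientation. -/
structure OrientedData (Φ : ℂ → ℂ) (b : ℂ → (ℂ →L[ℝ] ℂ)) : Prop where
  smooth : ContDiffOn ℝ (⊤ : ℕ∞) Φ Hset
  mapsTo : MapsTo Φ Hset Hset
  adj : ∀ z ∈ Hset, ∀ v w : ℂ, rinner (b z v) w = rinner v (b z w)
  det : ∀ z ∈ Hset, LinearMap.det ((b z : ℂ →L[ℝ] ℂ) : ℂ →ₗ[ℝ] ℂ) = 1
  metric : ∀ z ∈ Hset, ∀ v w : ℂ,
      rinner (fderiv ℝ Φ z v) (fderiv ℝ Φ z w) / (Φ z).im ^ 2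
        = rinner (b z v) (b z w) / z.im ^ 2
  codazzi : ∀ z ∈ Hset, ∀ v w : ℂ,
      fderiv ℝ (fun u => b u w) z v + Gamma z v (b z w) - b z (Gamma z v w)
        = fderiv ℝ (fun u => b u v) z w + Gamma z w (b z v) - b z (Gamma z w v)
  pos : ∀ z ∈ Hset, Complex.normSq (dzb Φ z) < Complex.normSq (dz Φ z)

/-- The real coefficient of `b`. -/
def coefC (L : ℂ →L[ℝ] ℂ) : ℝ := ((L 1).re + (L Complex.I).im) / 2

/-- The antilinear coefficient of `b`. -/
def coefS (L : ℂ →L[ℝ] ℂ) : ℂ := (L 1 + Complex.I * L Complex.I) / 2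

lemma apply_eq_coef {L : ℂ →L[ℝ] ℂ} (h : ∀ v w, rinner (L v) w = rinner v (L w)) (v : ℂ) :
    L v = coefC L * v + coefS L * conj v := by
  have h1 := h 1 Complex.I
  rw [clm_apply_eq L v]
  unfold coefC coefS
  unfold rinner at h1
  simp at h1
  congr 2
  apply Complex.ext <;> simp [h1]

lemma coef_det {L : ℂ →L[ℝ] ℂ} (h : ∀ v w, rinner (L v) w = rinner v (L w))
    (hd : LinearMap.det ((L : ℂ →L[ℝ] ℂ) : ℂ →ₗ[ℝ] ℂ) = 1) :
    coefC L ^ 2 - Complex.normSq (coefS L) = 1 := by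
  have h1 := h 1 Complex.I
  rw [det_clm] at hd
  unfold rinner at h1
  simp at h1
  unfold coefC coefS
  rw [← hd]
  simp [Complex.normSq_apply]
  rw [h1]
  ring

/-- The relations between the derivative of `Φ` and `b`. -/
lemma coef_metric {Φ : ℂ → ℂ} {L : ℂ →L[ℝ] ℂ} {z : ℂ} (hz : 0 < z.im) (hΦ : 0 < (Φ z).im)
    (h : ∀ v w, rinner (L v) w = rinner v (L w))
    (hm : ∀ v w : ℂ, rinner (fderiv ℝ Φ z v) (fderiv ℝ Φ z w) / (Φ z).im ^ 2
        = rinner (L v) (L w) / z.im ^ 2) :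
    Complex.normSq (dz Φ z) + Complex.normSq (dzb Φ z) =
      ((Φ z).im / z.im) ^ 2 * (coefC L ^ 2 + Complex.normSq (coefS L)) ∧
    conj (dz Φ z) * dzb Φ z = ((((Φ z).im / z.im) ^ 2 * coefC L : ℝ) : ℂ) * coefS L := by
  have hm' : ∀ v w : ℂ, rinner (fderiv ℝ Φ z v) (fderiv ℝ Φ z w) =
      ((Φ z).im / z.im) ^ 2 * rinner (L v) (L w) := by
    intro v w
    have := hm v w
    field_simp at this ⊢
    linarith
  have h1 := hm' 1 1
  have h2 := hm' Complex.I Complex.I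
  have h3 := hm' 1 Complex.I
  rw [fderiv_eq_dz, apply_eq_coef h] at h1
  rw [fderiv_eq_dz, apply_eq_coef h] at h2
  rw [fderiv_eq_dz Φ z 1, fderiv_eq_dz Φ z Complex.I, apply_eq_coef h 1, apply_eq_coef h Complex.I]
    at h3
  generalize dz Φ z = A at *
  generalize dzb Φ z = B at *
  generalize coefC L = c at *
  generalize coefS L = s at *
  generalize ((Φ z).im / z.im) ^ 2 = r at *
  unfold rinner at h1 h2 h3
  simp at h1 h2 h3
  refine ⟨?_, ?_⟩
  · simp only [Complex.normSq_apply]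
    linarith
  · apply Complex.ext
    · simp
      linarith
    · simp
      linarith

end

section

/-- The Beltrami coefficient of the square root of `Φ`. -/
def halfBeltrami (Φ : ℂ → ℂ) (z : ℂ) : ℂ :=
  conj (dz Φ z) * dzb Φ z / ((‖dz Φ z‖ * ((Φ z).im / z.im + ‖dz Φ z‖) : ℝ) : ℂ)

/-- The frame derivative of `Φ`. -/
def frameDeriv (Φ : ℂ → ℂ) (z : ℂ) : ℂ := (Φ z).im * dz Φ z / (‖dz Φ z‖ : ℂ)

namespace OrientedData

variable {Φ : ℂ → ℂ} {b : ℂ → (ℂ →L[ℝ] ℂ)} {z : ℂ}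

lemma jac (h : OrientedData Φ b) (hz : z ∈ Hset) :
    ‖dz Φ z‖ ^ 2 - ‖dzb Φ z‖ ^ 2 = ((Φ z).im / z.im) ^ 2 := by
  have hy : 0 < z.im := hz
  have hη : 0 < (Φ z).im := h.mapsTo hz
  obtain ⟨h1, h2⟩ := coef_metric hy hη (h.adj z hz) (h.metric z hz)
  have h3 := coef_det (h.adj z hz) (h.det z hz)
  have h4 := congrArg Complex.normSq h2
  have hp := h.pos z hz
  simp only [Complex.normSq_mul, Complex.normSq_conj, Complex.normSq_ofReal] at h4
  rw [← Complex.normSq_eq_norm_sq, ← Complex.normSq_eq_norm_sq]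
  generalize Complex.normSq (dz Φ z) = A at *
  generalize Complex.normSq (dzb Φ z) = B at *
  generalize coefC (b z) = c at *
  generalize Complex.normSq (coefS (b z)) = s at *
  have hr : 0 < ((Φ z).im / z.im) ^ 2 := by positivity
  generalize ((Φ z).im / z.im) ^ 2 = r at *
  have h5 : (A - B) ^ 2 = r ^ 2 := by
    have e1 : (A - B) ^ 2 = (A + B) ^ 2 - 4 * (A * B) := by ring
    have e2 : r ^ 2 = r ^ 2 * (c ^ 2 - s) ^ 2 := by rw [h3]; ring
    rw [e1, h1, h4, e2]
    ring
  have := (sq_eq_sq₀ (by linarith) hr.le).1 h5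
  exact this

lemma ratio_pos (h : OrientedData Φ b) (hz : z ∈ Hset) : 0 < (Φ z).im / z.im :=
  div_pos (h.mapsTo hz) hz

lemma norm_dz_pos (h : OrientedData Φ b) (hz : z ∈ Hset) : 0 < ‖dz Φ z‖ := by
  have h1 := h.jac hz
  have h2 := h.ratio_pos hz
  rcases (norm_nonneg (dz Φ z)).eq_or_lt with h0 | h0
  · rw [← h0] at h1
    nlinarith [sq_nonneg ‖dzb Φ z‖]
  · exact h0

lemma norm_halfBeltrami_eq (h : OrientedData Φ b) (hz : z ∈ Hset) :
    ‖halfBeltrami Φ z‖ = ‖dzb Φ z‖ / ((Φ z).im / z.im + ‖dz Φ z‖) := by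
  have h1 := h.ratio_pos hz
  have h2 := h.norm_dz_pos hz
  unfold halfBeltrami
  rw [norm_div, norm_mul, Complex.norm_conj, Complex.norm_real, Real.norm_of_nonneg (by positivity)]
  field_simp

lemma normSq_halfBeltrami_eq (h : OrientedData Φ b) (hz : z ∈ Hset) :
    Complex.normSq (halfBeltrami Φ z) =
      (‖dz Φ z‖ - (Φ z).im / z.im) / (‖dz Φ z‖ + (Φ z).im / z.im) := by
  have h1 := h.ratio_pos hz
  have h2 := h.norm_dz_pos hz
  have h3 := h.jac hz
  rw [Complex.normSq_eq_norm_sq, h.norm_halfBeltrami_eq hz, div_pow, div_eq_div_iff (by positivity)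
    (by positivity)]
  have : ‖dzb Φ z‖ ^ 2 = ‖dz Φ z‖ ^ 2 - ((Φ z).im / z.im) ^ 2 := by linarith
  rw [this]
  ring

lemma norm_halfBeltrami_lt (h : OrientedData Φ b) (hz : z ∈ Hset) : ‖halfBeltrami Φ z‖ < 1 := by
  have h1 := h.ratio_pos hz
  have h2 := h.norm_dz_pos hz
  have h3 := h.normSq_halfBeltrami_eq hz
  rw [Complex.normSq_eq_norm_sq] at h3
  have : ‖halfBeltrami Φ z‖ ^ 2 < 1 := by
    rw [h3, div_lt_one (by positivity)]
    linarith
  nlinarith [norm_nonneg (halfBeltrami Φ z)]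

lemma contDiffAt_Phi (h : OrientedData Φ b) (hz : z ∈ Hset) : ContDiffAt ℝ (⊤ : ℕ∞) Φ z :=
  h.smooth.contDiffAt (isOpen_Hset.mem_nhds hz)

lemma contDiffAt_dz_Phi (h : OrientedData Φ b) (hz : z ∈ Hset) :
    ContDiffAt ℝ (⊤ : ℕ∞) (dz Φ) z := contDiffAt_dz (h.contDiffAt_Phi hz)

lemma contDiffAt_dzb_Phi (h : OrientedData Φ b) (hz : z ∈ Hset) :
    ContDiffAt ℝ (⊤ : ℕ∞) (dzb Φ) z := contDiffAt_dzb (h.contDiffAt_Phi hz)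

lemma contDiffAt_norm_dz (h : OrientedData Φ b) (hz : z ∈ Hset) :
    ContDiffAt ℝ (⊤ : ℕ∞) (fun z => ‖dz Φ z‖) z :=
  (h.contDiffAt_dz_Phi hz).norm ℝ (norm_pos_iff.1 (h.norm_dz_pos hz))

lemma contDiffAt_im (h : OrientedData Φ b) (hz : z ∈ Hset) :
    ContDiffAt ℝ (⊤ : ℕ∞) (fun z => (Φ z).im) z :=
  Complex.imCLM.contDiff.contDiffAt.comp z (h.contDiffAt_Phi hz)

lemma contDiffAt_halfBeltrami (h : OrientedData Φ b) (hz : z ∈ Hset) :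
    ContDiffAt ℝ (⊤ : ℕ∞) (halfBeltrami Φ) z := by
  have hy : 0 < z.im := hz
  have h1 := h.ratio_pos hz
  have h2 := h.norm_dz_pos hz
  unfold halfBeltrami
  have i1 : ContDiffAt ℝ (⊤ : ℕ∞) (fun z : ℂ => z.im) z := Complex.imCLM.contDiff.contDiffAt
  have i2 := (h.contDiffAt_norm_dz hz).mul
    (((h.contDiffAt_im hz).div i1 hy.ne').add (h.contDiffAt_norm_dz hz))
  have i3 : ContDiffAt ℝ (⊤ : ℕ∞) (fun z => ((‖dz Φ z‖ * ((Φ z).im / z.im + ‖dz Φ z‖) : ℝ) : ℂ)) z :=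
    Complex.ofRealCLM.contDiff.contDiffAt.comp z i2
  simp only [div_eq_mul_inv (_ * _ : ℂ)]
  refine ((Complex.conjCLE.contDiff.contDiffAt.comp z (h.contDiffAt_dz_Phi hz)).mul
    (h.contDiffAt_dzb_Phi hz)).mul (i3.inv ?_)
  rw [Ne, Complex.ofReal_eq_zero]
  positivity

lemma contDiffAt_frameDeriv (h : OrientedData Φ b) (hz : z ∈ Hset) :
    ContDiffAt ℝ (⊤ : ℕ∞) (frameDeriv Φ) z := by
  have h2 := h.norm_dz_pos hz
  unfold frameDeriv
  have i3 : ContDiffAt ℝ (⊤ : ℕ∞) (fun z => ((‖dz Φ z‖ : ℝ) : ℂ)) z :=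
    Complex.ofRealCLM.contDiff.contDiffAt.comp z (h.contDiffAt_norm_dz hz)
  have i4 : ContDiffAt ℝ (⊤ : ℕ∞) (fun z => (((Φ z).im : ℝ) : ℂ)) z :=
    Complex.ofRealCLM.contDiff.contDiffAt.comp z (h.contDiffAt_im hz)
  simp only [div_eq_mul_inv (_ * _ : ℂ)]
  refine (i4.mul (h.contDiffAt_dz_Phi hz)).mul (i3.inv ?_)
  rw [Ne, Complex.ofReal_eq_zero]
  positivity

lemma norm_frameDeriv (h : OrientedData Φ b) (hz : z ∈ Hset) : ‖frameDeriv Φ z‖ = (Φ z).im := by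
  have h2 := h.norm_dz_pos hz
  have hη : 0 < (Φ z).im := h.mapsTo hz
  unfold frameDeriv
  rw [norm_div, norm_mul, Complex.norm_real, Complex.norm_real, norm_norm,
    Real.norm_of_nonneg hη.le]
  field_simp

lemma hasDD_Phi (h : OrientedData Φ b) (hz : z ∈ Hset) :
    HasDD (halfBeltrami Φ) Φ z (frameDeriv Φ z) (halfBeltrami Φ z * frameDeriv Φ z) := by
  have hy : 0 < z.im := hz
  have hη : 0 < (Φ z).im := h.mapsTo hz
  have h1 := h.ratio_pos hz
  have h2 := h.norm_dz_pos hz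
  have h3 := h.jac hz
  have e1 := Complex.conj_mul' (dz Φ z)
  have e2 := Complex.conj_mul' (dzb Φ z)
  have h3' : (‖dzb Φ z‖ : ℂ) ^ 2 = (‖dz Φ z‖ : ℂ) ^ 2 - ((Φ z).im / z.im : ℂ) ^ 2 := by
    have : ‖dzb Φ z‖ ^ 2 = ‖dz Φ z‖ ^ 2 - ((Φ z).im / z.im) ^ 2 := by linarith
    exact_mod_cast this
  have hR : ((Φ z).im : ℂ) = z.im * ((Φ z).im / z.im : ℝ) := by
    push_cast
    have : (z.im : ℂ) ≠ 0 := by exact_mod_cast hy.ne'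
    field_simp
  have hn : (‖dz Φ z‖ : ℂ) ≠ 0 := by exact_mod_cast h2.ne'
  have hm : (((Φ z).im / z.im : ℝ) : ℂ) + (‖dz Φ z‖ : ℂ) ≠ 0 := by
    rw [← Complex.ofReal_add, Ne, Complex.ofReal_eq_zero]
    positivity
  refine (hasDD_of_differentiableAt hy (h.norm_halfBeltrami_lt hz)
    ((h.contDiffAt_Phi hz).differentiableAt (by simp))).congr ?_ ?_
  all_goals
    unfold halfBeltrami frameDeriv
    rw [hR]
    rw [← Complex.ofReal_div] at h3'
    generalize ((Φ z).im / z.im : ℝ) = R at *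
    generalize dz Φ z = A at *
    generalize dzb Φ z = B at *
    simp only [map_div₀, map_mul, Complex.conj_conj, Complex.conj_ofReal, map_add, Complex.ofReal_mul,
      Complex.ofReal_add]
    field_simp
  · linear_combination (-z.im * A) * e2 - z.im * A * h3'
  · linear_combination (-z.im * B * ((‖A‖:ℂ)+R) ) * e1

/-- Up to sign, `b` is determined by `halfBeltrami`. -/
lemma coef_eq (h : OrientedData Φ b) (hz : z ∈ Hset) :
    (coefC (b z) = (1 + Complex.normSq (halfBeltrami Φ z)) / (1 - Complex.normSq (halfBeltrami Φ z)) ∧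
      coefS (b z) = 2 * halfBeltrami Φ z / (1 - Complex.normSq (halfBeltrami Φ z) : ℝ)) ∨
    (coefC (b z) = -((1 + Complex.normSq (halfBeltrami Φ z)) / (1 - Complex.normSq (halfBeltrami Φ z))) ∧
      coefS (b z) = -(2 * halfBeltrami Φ z / (1 - Complex.normSq (halfBeltrami Φ z) : ℝ))) := by
  have hy : 0 < z.im := hz
  have hη : 0 < (Φ z).im := h.mapsTo hz
  have h1 := h.ratio_pos hz
  have h2 := h.norm_dz_pos hz
  have h3 := h.jac hz
  obtain ⟨h4, h5⟩ := coef_metric hy hη (h.adj z hz) (h.metric z hz)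
  have h6 := coef_det (h.adj z hz) (h.det z hz)
  rw [h.normSq_halfBeltrami_eq hz]
  unfold halfBeltrami
  rw [Complex.normSq_eq_norm_sq, Complex.normSq_eq_norm_sq] at h4
  rw [h5]
  generalize ((Φ z).im / z.im : ℝ) = R at *
  generalize ‖dz Φ z‖ = ρ at *
  have e1 : (1 + (ρ - R) / (ρ + R)) / (1 - (ρ - R) / (ρ + R)) = ρ / R := by
    have : 1 - (ρ - R) / (ρ + R) = 2 * R / (ρ + R) := by field_simp; ring
    rw [this]
    field_simp
    ring
  have e2 : 1 - (ρ - R) / (ρ + R) = 2 * R / (ρ + R) := by field_simp; ring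
  rw [e1, e2]
  have e3 : coefC (b z) ^ 2 = (ρ / R) ^ 2 := by
    rw [div_pow, eq_div_iff (by positivity)]
    nlinarith
  have hn : (ρ : ℂ) ≠ 0 := by exact_mod_cast h2.ne'
  have hR : (R : ℂ) ≠ 0 := by exact_mod_cast h1.ne'
  have hm : (R : ℂ) + (ρ : ℂ) ≠ 0 := by
    rw [← Complex.ofReal_add, Ne, Complex.ofReal_eq_zero]
    positivity
  rcases sq_eq_sq_iff_eq_or_eq_neg.1 e3 with e | e
  · left
    refine ⟨e, ?_⟩
    rw [e]
    push_cast
    field_simp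
    ring
  · right
    refine ⟨e, ?_⟩
    rw [e]
    push_cast
    field_simp
    ring
end OrientedData

end

section

/-- `b` is, up to the sign `ε`, the bundle map determined by the coefficient `t`. -/
def SignedBy (b : ℂ → (ℂ →L[ℝ] ℂ)) (t : ℂ → ℂ) (ε : ℝ) (z : ℂ) : Prop :=
  ∀ v, b z v = ε * (((1 + t z * conj (t z)) * v + 2 * t z * conj v) * (1 - t z * conj (t z))⁻¹)

/-- Solution of `X - t X̄ = g` when `|t| < 1`. -/
lemma eq_zero_of_eq_mul_conj {t X : ℂ} (ht : ‖t‖ < 1) (h : X = t * conj X) : X = 0 := by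
  have h1 := congrArg norm h
  rw [norm_mul, Complex.norm_conj] at h1
  have : ‖X‖ = 0 := by nlinarith [norm_nonneg X]
  exact norm_eq_zero.1 this

namespace OrientedData

variable {Φ : ℂ → ℂ} {b : ℂ → (ℂ →L[ℝ] ℂ)} {z : ℂ}

lemma signedBy (h : OrientedData Φ b) (hz : z ∈ Hset) :
    SignedBy b (halfBeltrami Φ) 1 z ∨ SignedBy b (halfBeltrami Φ) (-1) z := by
  rcases h.coef_eq hz with ⟨h1, h2⟩ | ⟨h1, h2⟩
  · left
    intro v
    rw [apply_eq_coef (h.adj z hz), h1, h2, Complex.mul_conj]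
    push_cast
    ring
  · right
    intro v
    rw [apply_eq_coef (h.adj z hz), h1, h2, Complex.mul_conj]
    push_cast
    ring

end OrientedData

lemma one_sub_ne {t : ℂ} (ht : ‖t‖ < 1) : (1 - t * conj t) ≠ 0 := by
  rw [Complex.mul_conj, Complex.normSq_eq_norm_sq]
  norm_cast
  nlinarith [norm_nonneg t]

lemma SignedBy.re_one {b : ℂ → (ℂ →L[ℝ] ℂ)} {t : ℂ → ℂ} {ε : ℝ} {z : ℂ} (h : SignedBy b t ε z) :
    (b z 1).re = ε * (Complex.normSq (1 + t z) / (1 - Complex.normSq (t z))) := by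
  rw [h 1]
  have : (((1 + t z * conj (t z)) * 1 + 2 * t z * conj 1) * (1 - t z * conj (t z))⁻¹) =
      ((1 + Complex.normSq (t z) : ℝ) + 2 * t z) * (((1 - Complex.normSq (t z))⁻¹ : ℝ) : ℂ) := by
    rw [Complex.mul_conj]; push_cast; simp
  rw [this, Complex.re_ofReal_mul, Complex.re_mul_ofReal]
  simp [Complex.normSq_apply]
  left
  ring

lemma SignedBy.im_I {b : ℂ → (ℂ →L[ℝ] ℂ)} {t : ℂ → ℂ} {ε : ℝ} {z : ℂ} (h : SignedBy b t ε z) :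
    (b z Complex.I).im = ε * (Complex.normSq (1 - t z) / (1 - Complex.normSq (t z))) := by
  rw [h Complex.I]
  have : (((1 + t z * conj (t z)) * Complex.I + 2 * t z * conj Complex.I) * (1 - t z * conj (t z))⁻¹) =
      (((1 + Complex.normSq (t z) : ℝ) - 2 * t z) * Complex.I) * (((1 - Complex.normSq (t z))⁻¹ : ℝ) : ℂ) := by
    rw [Complex.mul_conj, Complex.conj_I]; push_cast; ring
  rw [this, Complex.im_ofReal_mul, Complex.im_mul_ofReal, Complex.mul_I_im]
  simp [Complex.normSq_apply]
  left
  ring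

lemma normSq_div_pos {t w : ℂ} (ht : ‖t‖ < 1) (hw : ‖w‖ < 1) :
    0 < Complex.normSq (1 + w) / (1 - Complex.normSq t) := by
  refine div_pos (Complex.normSq_pos.2 ?_) ?_
  · intro h0
    have : w = -1 := by linear_combination h0
    rw [this] at hw
    simp at hw
  · rw [Complex.normSq_eq_norm_sq]
    nlinarith [norm_nonneg t]

namespace OrientedData

variable {Φ : ℂ → ℂ} {b : ℂ → (ℂ →L[ℝ] ℂ)} {z : ℂ}

lemma eventually_signedBy (h : OrientedData Φ b) (hz : z ∈ Hset) {g P : ℂ → ℝ} (hg : ContinuousAt g z)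
    (hP : ∀ w ∈ Hset, 0 < P w)
    (hgP : ∀ ε : ℝ, ∀ w, SignedBy b (halfBeltrami Φ) ε w → g w = ε * P w) :
    ∃ ε : ℝ, ε ^ 2 = 1 ∧ ∀ᶠ w in 𝓝 z, SignedBy b (halfBeltrami Φ) ε w := by
  rcases h.signedBy hz with h1 | h1
  · refine ⟨1, by norm_num, ?_⟩
    have h2 : 0 < g z := by
      rw [hgP 1 z h1]
      linarith [hP z hz]
    filter_upwards [hg.eventually (lt_mem_nhds h2), isOpen_Hset.mem_nhds hz] with w hw hwz
    rcases h.signedBy hwz with h3 | h3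
    · exact h3
    · have := hgP _ w h3
      have := hP w hwz
      linarith
  · refine ⟨-1, by norm_num, ?_⟩
    have h2 : g z < 0 := by
      rw [hgP _ z h1]
      linarith [hP z hz]
    filter_upwards [hg.eventually (gt_mem_nhds h2), isOpen_Hset.mem_nhds hz] with w hw hwz
    rcases h.signedBy hwz with h3 | h3
    · have := hgP _ w h3
      have := hP w hwz
      linarith
    · exact h3

lemma hasDD_halfBeltrami (h : OrientedData Φ b) (hz : z ∈ Hset) {t : ℂ → ℂ} (ht : ‖t z‖ < 1) :
    HasDD t (halfBeltrami Φ) z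
      (z.im * (dz (halfBeltrami Φ) z - conj (t z) * dzb (halfBeltrami Φ) z))
      (z.im * (dzb (halfBeltrami Φ) z - t z * dz (halfBeltrami Φ) z)) :=
  hasDD_of_differentiableAt hz ht ((h.contDiffAt_halfBeltrami hz).differentiableAt (by simp))

/-- The Codazzi equation in a neighbourhood where the sign is constant. -/
lemma codazzi_frame_of_signedBy (h : OrientedData Φ b) (hz : z ∈ Hset) {ε : ℝ} (hε : ε ^ 2 = 1)
    (hs : ∀ᶠ w in 𝓝 z, SignedBy b (halfBeltrami Φ) ε w) :
    z.im * (dz (halfBeltrami Φ) z - conj (halfBeltrami Φ z) * dzb (halfBeltrami Φ) z) =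
      -Complex.I * (1 - conj (halfBeltrami Φ z)) * halfBeltrami Φ z := by
  have hy : 0 < z.im := hz
  have hn := h.norm_halfBeltrami_lt hz
  have hne := one_sub_ne hn
  have h0 : ‖(fun _ : ℂ => (0 : ℂ)) z‖ < 1 := by simp
  have hT := (h.hasDD_halfBeltrami hz (t := fun _ => 0) h0)
  have hcod := h.codazzi z hz 1 Complex.I
  have hs0 := hs.self_of_nhds
  have e1 : (fun u => b u 1) =ᶠ[𝓝 z] fun u => ε * (((1 + halfBeltrami Φ u * conj (halfBeltrami Φ u)) * 1
      + 2 * halfBeltrami Φ u * conj 1) * (1 - halfBeltrami Φ u * conj (halfBeltrami Φ u))⁻¹) :=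
    hs.mono fun w hw => hw 1
  have e2 : (fun u => b u Complex.I) =ᶠ[𝓝 z] fun u => ε * (((1 + halfBeltrami Φ u *
      conj (halfBeltrami Φ u)) * Complex.I + 2 * halfBeltrami Φ u * conj Complex.I) *
        (1 - halfBeltrami Φ u * conj (halfBeltrami Φ u))⁻¹) :=
    hs.mono fun w hw => hw Complex.I
  have key : ∀ v, HasDD (fun _ => 0) (fun u => (ε : ℂ) * (((1 + halfBeltrami Φ u * conj (halfBeltrami Φ u)) * v
      + 2 * halfBeltrami Φ u * conj v) * (1 - halfBeltrami Φ u * conj (halfBeltrami Φ u))⁻¹)) z _ _ :=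
    fun v => (((((hasDD_const 1).add (hT.mul hT.conj)).mul (hasDD_const v)).add
      ((hT.const_mul 2).mul (hasDD_const (conj v)))).mul
        (((hasDD_const 1).sub (hT.mul hT.conj)).inv hne)).const_mul (ε : ℂ)
  obtain ⟨k1, k2⟩ := ((key 1).congr_of_eventuallyEq e1).eq hy h0
  obtain ⟨k3, k4⟩ := ((key Complex.I).congr_of_eventuallyEq e2).eq hy h0
  rw [fderiv_eq_dz, fderiv_eq_dz, hs0 1, hs0 Complex.I] at hcod
  generalize dz (fun u => b u 1) z = f1 at *
  generalize dzb (fun u => b u 1) z = f2 at *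
  generalize dz (fun u => b u Complex.I) z = f3 at *
  generalize dzb (fun u => b u Complex.I) z = f4 at *
  simp only [Gamma] at hcod
  have hy0 : (z.im : ℂ) ≠ 0 := by exact_mod_cast hy.ne'
  simp only [map_zero, zero_mul, sub_zero, map_one, Complex.conj_I, mul_one] at k1 k2 k3 k4 hcod
  have hε0 : (ε : ℂ) ≠ 0 := by
    rintro h0
    have : ε = 0 := by exact_mod_cast h0
    rw [this] at hε
    norm_num at hε
  have htr : conj (halfBeltrami Φ z) = conj (halfBeltrami Φ z) := rfl
  generalize dz (halfBeltrami Φ) z = tp at *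
  generalize dzb (halfBeltrami Φ) z = tq at *
  generalize halfBeltrami Φ z = t at *
  have hcc : conj (1 - t * conj t) = 1 - t * conj t := by simp; ring
  simp only [map_mul, Complex.conj_ofReal] at k1 k2 k3 k4
  rw [div_eq_mul_inv _ ((1 - t * conj t) ^ 2), ← inv_pow] at k1 k2 k3 k4
  have hu : (1 - t * conj t)⁻¹ * (1 - t * conj t) = 1 := inv_mul_cancel₀ hne
  generalize (1 - t * conj t)⁻¹ = u at *
  have hu0 : u ≠ 0 := left_ne_zero_of_mul_eq_one hu
  have hcod' : z.im * (f3 + f4) - Complex.I * (z.im * (f1 - f2)) + 4 * ε * u * t = 0 := by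
    rw [one_mul] at hcod
    field_simp at hcod
    linear_combination hcod + 4 * ε * u * t * Complex.I_sq
  rw [← sub_eq_zero]
  refine eq_zero_of_eq_mul_conj hn (sub_eq_zero.1 ?_)
  have hmain : (4 * Complex.I * ε * u ^ 2) * ((z.im * (tp - conj t * tq) -
      -Complex.I * (1 - conj t) * t) - t * conj (z.im * (tp - conj t * tq) -
      -Complex.I * (1 - conj t) * t)) = 0 := by
    simp only [map_sub, map_mul, map_neg, map_one, Complex.conj_ofReal, Complex.conj_conj,
      Complex.conj_I]
    linear_combination (-1 : ℂ) * hcod' - k3 - k4 + Complex.I * k1 - Complex.I * k2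
      - (2 * Complex.I * ε * u * z.im * (conj t * tq + t * conj tp - 2 * tp) + 4 * ε * u * t) * hu
      + (4 * ε * u ^ 2 * t - 4 * ε * u ^ 2 * conj t * t ^ 2) * Complex.I_sq
  refine (mul_eq_zero.1 hmain).resolve_left ?_
  simp [hε0, hu0]


lemma codazzi_frame_or (h : OrientedData Φ b) (hz : z ∈ Hset) :
    z.im * (dz (halfBeltrami Φ) z - conj (halfBeltrami Φ z) * dzb (halfBeltrami Φ) z) =
      -Complex.I * (1 - conj (halfBeltrami Φ z)) * halfBeltrami Φ z ∨ halfBeltrami Φ z = 0 := by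
  have hy : 0 < z.im := hz
  have hy0 : (z.im : ℂ) ≠ 0 := by exact_mod_cast hy.ne'
  have hn := h.norm_halfBeltrami_lt hz
  have hne := one_sub_ne hn
  by_cases h1 : DifferentiableAt ℝ (fun u => b u 1) z
  · obtain ⟨ε, hε, hs⟩ := h.eventually_signedBy hz (g := fun u => (b u 1).re)
      (P := fun u => Complex.normSq (1 + halfBeltrami Φ u) / (1 - Complex.normSq (halfBeltrami Φ u)))
      (Complex.continuous_re.continuousAt.comp h1.continuousAt)
      (fun w hw => normSq_div_pos (h.norm_halfBeltrami_lt hw) (h.norm_halfBeltrami_lt hw))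
      (fun ε w hw => hw.re_one)
    exact Or.inl (h.codazzi_frame_of_signedBy hz hε hs)
  by_cases h2 : DifferentiableAt ℝ (fun u => b u Complex.I) z
  · obtain ⟨ε, hε, hs⟩ := h.eventually_signedBy hz (g := fun u => (b u Complex.I).im)
      (P := fun u => Complex.normSq (1 - halfBeltrami Φ u) / (1 - Complex.normSq (halfBeltrami Φ u)))
      (Complex.continuous_im.continuousAt.comp h2.continuousAt)
      (fun w hw => by
        have := normSq_div_pos (h.norm_halfBeltrami_lt hw) (w := -halfBeltrami Φ w)
          (by rw [norm_neg]; exact h.norm_halfBeltrami_lt hw)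
        rwa [← sub_eq_add_neg] at this)
      (fun ε w hw => hw.im_I)
    exact Or.inl (h.codazzi_frame_of_signedBy hz hε hs)
  right
  have hcod := h.codazzi z hz 1 Complex.I
  rw [fderiv_zero_of_not_differentiableAt h1, fderiv_zero_of_not_differentiableAt h2] at hcod
  have key : ∀ ε : ℝ, ε ≠ 0 → SignedBy b (halfBeltrami Φ) ε z → halfBeltrami Φ z = 0 := by
    intro ε hε hs
    rw [hs 1, hs Complex.I] at hcod
    simp only [Gamma, map_one, Complex.conj_I, one_mul, mul_one, ContinuousLinearMap.zero_apply,
      zero_add] at hcod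
    have hu0 : (1 - halfBeltrami Φ z * conj (halfBeltrami Φ z))⁻¹ ≠ 0 := inv_ne_zero hne
    generalize (1 - halfBeltrami Φ z * conj (halfBeltrami Φ z))⁻¹ = u at *
    generalize halfBeltrami Φ z = t at *
    have hε0 : (ε : ℂ) ≠ 0 := by exact_mod_cast hε
    have h3 := sub_left_inj.1 hcod
    field_simp at h3
    linear_combination (-1 / 4 : ℂ) * h3
  rcases h.signedBy hz with h3 | h3
  · exact key _ (by norm_num) h3
  · exact key _ (by norm_num) h3

/-- The Codazzi equation in the moving frame. -/
lemma codazzi_frame (h : OrientedData Φ b) (hz : z ∈ Hset) :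
    z.im * (dz (halfBeltrami Φ) z - conj (halfBeltrami Φ z) * dzb (halfBeltrami Φ) z) =
      -Complex.I * (1 - conj (halfBeltrami Φ z)) * halfBeltrami Φ z := by
  by_contra hne
  have hc : ContinuousAt (fun z : ℂ => (z.im : ℂ) * (dz (halfBeltrami Φ) z -
      conj (halfBeltrami Φ z) * dzb (halfBeltrami Φ) z) -
      -Complex.I * (1 - conj (halfBeltrami Φ z)) * halfBeltrami Φ z) z := by
    have c1 := (h.contDiffAt_halfBeltrami hz).continuousAt
    have c2 := (contDiffAt_dz (n := 0) ((h.contDiffAt_halfBeltrami hz).of_le (by simp))).continuousAt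
    have c3 := (contDiffAt_dzb (n := 0) ((h.contDiffAt_halfBeltrami hz).of_le (by simp))).continuousAt
    fun_prop
  have hev : ∀ᶠ w in 𝓝 z, halfBeltrami Φ w = 0 := by
    filter_upwards [hc.eventually_ne (sub_ne_zero.2 hne), isOpen_Hset.mem_nhds hz] with w hw hwz
    exact (h.codazzi_frame_or hwz).resolve_left (sub_ne_zero.1 hw)
  have hd : fderiv ℝ (halfBeltrami Φ) z = 0 := by
    have : halfBeltrami Φ =ᶠ[𝓝 z] fun _ => 0 := hev
    rw [this.fderiv_eq]
    simp
  apply hne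
  rw [hev.self_of_nhds]
  simp [dz, dzb, hd]

end OrientedData

end

section

lemma isSimplyConnected_Hset : IsSimplyConnected Hset := by
  have h1 : Convex ℝ Hset := convex_halfSpace_im_gt 0
  have : ContractibleSpace Hset := h1.contractibleSpace ⟨Complex.I, by simp [Hset]⟩
  exact SimplyConnectedSpace.ofContractible Hset

/-- A continuous logarithm is differentiable where its exponential is. -/
lemma HasDD.of_exp {t F g : ℂ → ℂ} {z p q : ℂ} (hF : HasDD t F z p q) (hg : ContinuousAt g z)
    (he : ∀ᶠ w in 𝓝 z, Complex.exp (g w) = F w) :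
    HasDD t g z (p / F z) (q / F z) := by
  have h0 : F z ≠ 0 := by
    rw [← he.self_of_nhds]
    exact Complex.exp_ne_zero _
  have h1 := (hF.const_mul (F z)⁻¹).comp (h := Complex.log) (d := 1) (by
    have := Complex.hasDerivAt_log (z := (F z)⁻¹ * F z) (by simp [h0])
    have h1 : (F z)⁻¹ * F z = 1 := inv_mul_cancel₀ h0
    rw [h1] at this ⊢
    simpa using this)
  have h2 := ((hasDD_const (t := t) (z := z) (g z)).add h1)
  refine (h2.congr (p' := p / F z) (q' := q / F z) (by ring) (by ring)).congr_of_eventuallyEq ?_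
  have h3 : Tendsto (fun w => (g w - g z).im) (𝓝 z) (𝓝 0) := by
    have : ContinuousAt (fun w => (g w - g z).im) z := by fun_prop
    have h4 := this.tendsto
    simpa using h4
  filter_upwards [he, h3.eventually (Ioo_mem_nhds (neg_lt_zero.2 Real.pi_pos) Real.pi_pos)]
    with w hw hw2
  have : (F z)⁻¹ * F w = Complex.exp (g w - g z) := by
    rw [← hw, ← he.self_of_nhds, Complex.exp_sub]
    ring
  rw [this, Complex.log_exp hw2.1 hw2.2.le]
  ring

namespace OrientedData

variable {Φ : ℂ → ℂ} {b : ℂ → (ℂ →L[ℝ] ℂ)} {z : ℂ}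

/-- The second frame derivative of the coefficient. -/
def sigma (Φ : ℂ → ℂ) (z : ℂ) : ℂ :=
  z.im * (dzb (halfBeltrami Φ) z - halfBeltrami Φ z * dz (halfBeltrami Φ) z)

lemma hasDD_t (h : OrientedData Φ b) (hz : z ∈ Hset) :
    HasDD (halfBeltrami Φ) (halfBeltrami Φ) z
      (-Complex.I * (1 - conj (halfBeltrami Φ z)) * halfBeltrami Φ z) (sigma Φ z) :=
  (h.hasDD_halfBeltrami hz (h.norm_halfBeltrami_lt hz)).congr (h.codazzi_frame hz) rfl

lemma eventually_norm_lt (h : OrientedData Φ b) (hz : z ∈ Hset) :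
    ∀ᶠ w in 𝓝 z, ‖halfBeltrami Φ w‖ < 1 :=
  (isOpen_Hset.eventually_mem hz).mono fun _ hw => h.norm_halfBeltrami_lt hw

lemma hasDD_sigma (h : OrientedData Φ b) (hz : z ∈ Hset) :
    ∃ m, HasDD (halfBeltrami Φ) (sigma Φ) z (-(1 - halfBeltrami Φ z) *
        (halfBeltrami Φ z * conj (halfBeltrami Φ z))
      - (3 * Complex.I / 2) * (1 - conj (halfBeltrami Φ z)) * sigma Φ z
      - (1 - halfBeltrami Φ z) * (1 - conj (halfBeltrami Φ z)) * halfBeltrami Φ z / 2) m := by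
  have hn := h.norm_halfBeltrami_lt hz
  have hd : DifferentiableAt ℝ (sigma Φ) z := by
    have c0 := h.contDiffAt_halfBeltrami hz
    have c1 := c0.differentiableAt (by simp)
    have c2 := (contDiffAt_dz (n := 1) (c0.of_le (by norm_cast))).differentiableAt (by simp)
    have c3 := (contDiffAt_dzb (n := 1) (c0.of_le (by norm_cast))).differentiableAt (by simp)
    have c4 : DifferentiableAt ℝ (fun z : ℂ => (z.im : ℂ)) z :=
      (Complex.ofRealCLM.comp Complex.imCLM).differentiableAt
    exact c4.mul (c3.sub (c1.mul c2))
  have hσ := hasDD_of_differentiableAt (t := halfBeltrami Φ) hz hn hd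
  have hT := h.hasDD_t hz
  have hp := (((hasDD_const 1).sub hT.conj).const_mul (-Complex.I)).mul hT
  have := HasDD.commutator hz hn hT (h.eventually_norm_lt hz)
    ((h.contDiffAt_halfBeltrami hz).of_le (by norm_cast))
    ((isOpen_Hset.eventually_mem hz).mono fun w hw => h.hasDD_t hw) hp hσ
  refine ⟨_, hσ.congr ?_ rfl⟩
  rw [sub_eq_iff_eq_add] at this
  rw [this]
  simp
  linear_combination ((1 - halfBeltrami Φ z) * halfBeltrami Φ z * conj (halfBeltrami Φ z)
    + (1 - conj (halfBeltrami Φ z)) * (1 - halfBeltrami Φ z) * halfBeltrami Φ z / 2) * Complex.I_sq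

lemma hasDD_e (h : OrientedData Φ b) (hz : z ∈ Hset) :
    HasDD (halfBeltrami Φ) (frameDeriv Φ) z
      (frameDeriv Φ z * ((Complex.I / 2) * (1 - conj (halfBeltrami Φ z)) -
        Complex.I * frameDeriv Φ z / (Φ z).im))
      (frameDeriv Φ z * ((Complex.I / 2) * (1 - halfBeltrami Φ z) -
        Complex.I * frameDeriv Φ z * halfBeltrami Φ z / (Φ z).im)) := by
  have hn := h.norm_halfBeltrami_lt hz
  have hη : 0 < (Φ z).im := h.mapsTo hz
  have hη0 : ((Φ z).im : ℂ) ≠ 0 := by exact_mod_cast hη.ne'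
  have hE := hasDD_of_differentiableAt (t := halfBeltrami Φ) hz hn
    ((h.contDiffAt_frameDeriv hz).differentiableAt (by simp))
  have hT := h.hasDD_t hz
  have hΦ := h.hasDD_Phi hz
  have c1 := HasDD.commutator hz hn hT (h.eventually_norm_lt hz)
    ((h.contDiffAt_Phi hz).of_le (by norm_cast))
    ((isOpen_Hset.eventually_mem hz).mono fun w hw => h.hasDD_Phi hw) hE (hT.mul hE)
  have hN := (hΦ.im.ofReal).mul (hΦ.im.ofReal)
  have hN' : HasDD (halfBeltrami Φ) (fun w => ((Φ w).im : ℂ) * (Φ w).im) z _ _ :=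
    (hE.mul hE.conj).congr_of_eventuallyEq ((isOpen_Hset.eventually_mem hz).mono fun w hw => by
      show _ = frameDeriv Φ w * conj (frameDeriv Φ w)
      rw [Complex.mul_conj, Complex.normSq_eq_norm_sq, h.norm_frameDeriv hw]
      push_cast; ring)
  obtain ⟨c2, -⟩ := hN.unique hz hn hN'
  have c3 : frameDeriv Φ z * conj (frameDeriv Φ z) = ((Φ z).im : ℂ) ^ 2 := by
    rw [Complex.mul_conj, Complex.normSq_eq_norm_sq, h.norm_frameDeriv hz]
    push_cast; ring
  have he0 : frameDeriv Φ z ≠ 0 := by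
    rw [← norm_pos_iff, h.norm_frameDeriv hz]
    exact hη
  have main : z.im * (dz (frameDeriv Φ) z - conj (halfBeltrami Φ z) * dzb (frameDeriv Φ) z) =
      (frameDeriv Φ z * ((Complex.I / 2) * (1 - conj (halfBeltrami Φ z)) -
        Complex.I * frameDeriv Φ z / (Φ z).im)) := by
    generalize (z.im : ℂ) * (dz (frameDeriv Φ) z - conj (halfBeltrami Φ z) * dzb (frameDeriv Φ) z) = X at *
    generalize (z.im : ℂ) * (dzb (frameDeriv Φ) z - (halfBeltrami Φ z) * dz (frameDeriv Φ) z) = Y at *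
    have hηr : conj ((Φ z).im : ℂ) = ((Φ z).im : ℂ) := Complex.conj_ofReal _
    generalize ((Φ z).im : ℂ) = η at *
    generalize frameDeriv Φ z = e at *
    generalize halfBeltrami Φ z = t at *
    have hY : Y = t * X - e * (Complex.I / 2) * (2 * t - t * conj t - 1) := by
      linear_combination -c1
    have hYc := congrArg conj hY
    simp only [map_sub, map_mul, map_div₀, map_one, map_ofNat, Complex.conj_I, Complex.conj_conj] at hYc
    rw [← sub_eq_zero]
    have hec : conj e ≠ 0 := (map_ne_zero _).2 he0
    refine (mul_eq_zero.1 (?_ : (X - e * (Complex.I / 2 * (1 - conj t) - Complex.I * e / η)) * conj e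
      = 0)).resolve_right hec
    refine eq_zero_of_eq_mul_conj (t := -conj t) (by simpa using hn) ?_
    simp only [map_sub, map_mul, map_div₀, map_one, map_ofNat, Complex.conj_I, Complex.conj_conj, hηr]
    rw [hYc] at c2
    simp only [map_mul] at c2
    have c4 : e * conj e * (η)⁻¹ = η := by rw [c3]; field_simp
    linear_combination -c2 + (Complex.I * e - Complex.I * conj t * conj e) * c4
  refine hE.congr main ?_
  rw [main] at c1
  linear_combination -c1
end OrientedData

end

section

namespace OrientedData

variable {Φ : ℂ → ℂ} {b : ℂ → (ℂ →L[ℝ] ℂ)} {z : ℂ}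

lemma exists_spin (h : OrientedData Φ b) : ∃ k : ℂ → ℂ,
    (∀ z ∈ Hset, HasDD (halfBeltrami Φ) k z
      (k z * (Complex.I / 2) * (conj (halfBeltrami Φ z) + frameDeriv Φ z / (Φ z).im))
      (k z * (Complex.I / 2) * (frameDeriv Φ z * halfBeltrami Φ z / (Φ z).im - 1))) ∧
    ∀ z ∈ Hset, k z ^ 2 * (z.im * frameDeriv Φ z) = 1 := by
  have he0 : ∀ z ∈ Hset, frameDeriv Φ z ≠ 0 := fun z hz => by
    rw [← norm_pos_iff, h.norm_frameDeriv hz]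
    exact h.mapsTo hz
  have hy0 : ∀ z ∈ Hset, (z.im : ℂ) ≠ 0 := fun z hz => by
    have : 0 < z.im := hz
    exact_mod_cast this.ne'
  have hF : ∀ z ∈ Hset, HasDD (halfBeltrami Φ) (fun w => (w.im : ℂ) * frameDeriv Φ w) z _ _ :=
    fun z hz => ((hasGrad_im hz (h.norm_halfBeltrami_lt hz)).ofReal).mul (h.hasDD_e hz)
  obtain ⟨g, hg1, hg2⟩ := Complex.exists_continuousOn_eqOn_exp_comp isSimplyConnected_Hset isOpen_Hset
    (g := fun w => (w.im : ℂ) * frameDeriv Φ w) (fun z hz => (hF z hz).continuousAt.continuousWithinAt)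
    (by
      rintro ⟨z, hz, h0⟩
      exact mul_ne_zero (hy0 z hz) (he0 z hz) h0)
  refine ⟨fun w => Complex.exp (-(1 / 2) * g w), fun z hz => ?_, fun z hz => ?_⟩
  · have hG := (hF z hz).of_exp (hg1.continuousAt (isOpen_Hset.mem_nhds hz))
      ((isOpen_Hset.eventually_mem hz).mono fun w hw => hg2 hw)
    have e0 := he0 z hz
    have y0 := hy0 z hz
    have η0 : ((Φ z).im : ℂ) ≠ 0 := by
      have : 0 < (Φ z).im := h.mapsTo hz
      exact_mod_cast this.ne'
    refine ((hG.const_mul (-(1 / 2))).comp (Complex.hasDerivAt_exp _)).congr ?_ ?_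
    · field_simp
      ring
    · simp only [map_mul, map_neg, map_add, map_one, Complex.conj_I, Complex.conj_conj,
        Complex.conj_ofReal]
      field_simp
      ring
  · have := hg2 hz
    simp only [Function.comp_apply] at this
    rw [← this, ← Complex.exp_nat_mul, ← Complex.exp_add]
    have h0 : ((2 : ℕ) : ℂ) * (-(1 / 2) * g z) + g z = 0 := by
      push_cast
      ring
    rw [h0, Complex.exp_zero]

/-- The moving frame of an orientation-preserving minimal Lagrangian map. -/
def toSurf (h : OrientedData Φ b) : Surf where
  Φ := Φ
  t := halfBeltrami Φ
  σ := sigma Φ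
  e := frameDeriv Φ
  k := h.exists_spin.choose
  im_pos := fun _ hz => h.mapsTo hz
  norm_t := fun _ hz => h.norm_halfBeltrami_lt hz
  dt := fun _ hz => h.hasDD_t hz
  dσ := fun _ hz => h.hasDD_sigma hz
  dΦ := fun _ hz => h.hasDD_Phi hz
  norm_e := fun _ hz => h.norm_frameDeriv hz
  dk := h.exists_spin.choose_spec.1
  k_sq := h.exists_spin.choose_spec.2

end OrientedData

/-! ### Dilatation -/

lemma norm_add_conj_le (p q v : ℂ) (hv : ‖v‖ = 1) : ‖p * v + q * conj v‖ ≤ ‖p‖ + ‖q‖ := by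
  refine (norm_add_le _ _).trans ?_
  simp [hv]

lemma le_norm_add_conj (p q v : ℂ) (hv : ‖v‖ = 1) : |‖p‖ - ‖q‖| ≤ ‖p * v + q * conj v‖ := by
  have := abs_norm_sub_norm_le (p * v) (-(q * conj v))
  rw [sub_neg_eq_add, norm_neg, norm_mul, norm_mul, Complex.norm_conj, hv, mul_one, mul_one] at this
  exact this

lemma exists_align (p q : ℂ) : ∃ v u : ℂ, ‖v‖ = 1 ∧ ‖u‖ = 1 ∧
    p * v = ‖p‖ * u ∧ q * conj v = ‖q‖ * u := by
  have polar : ∀ w : ℂ, w = ‖w‖ * Complex.exp (w.arg * Complex.I) := fun w =>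
    (Complex.norm_mul_exp_arg_mul_I w).symm
  refine ⟨Complex.exp (((q.arg - p.arg) / 2 : ℝ) * Complex.I), Complex.exp (((q.arg + p.arg) / 2 : ℝ) * Complex.I),
    Complex.norm_exp_ofReal_mul_I _, Complex.norm_exp_ofReal_mul_I _, ?_⟩
  have hc : conj (Complex.exp (((q.arg - p.arg) / 2 : ℝ) * Complex.I)) =
      Complex.exp (-((q.arg - p.arg) / 2 : ℝ) * Complex.I) := by
    rw [← Complex.exp_conj]
    simp [map_ofNat]
  have h1 : p * Complex.exp (((q.arg - p.arg) / 2 : ℝ) * Complex.I) =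
      ‖p‖ * Complex.exp (((q.arg + p.arg) / 2 : ℝ) * Complex.I) := by
    conv_lhs => rw [polar p]
    rw [mul_assoc, ← Complex.exp_add]
    congr 2
    push_cast
    simp
    ring
  have h2 : q * Complex.exp (-((q.arg - p.arg) / 2 : ℝ) * Complex.I) =
      ‖q‖ * Complex.exp (((q.arg + p.arg) / 2 : ℝ) * Complex.I) := by
    conv_lhs => rw [polar q]
    rw [mul_assoc, ← Complex.exp_add]
    congr 2
    push_cast
    simp
    ring
  exact ⟨h1, hc ▸ h2⟩

lemma dilatationAt_eq (Φ : ℂ → ℂ) (z : ℂ) :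
    dilatationAt Φ z = (‖dz Φ z‖ + ‖dzb Φ z‖) / |‖dz Φ z‖ - ‖dzb Φ z‖| := by
  unfold dilatationAt
  simp only [fderiv_eq_dz]
  have : Nonempty {v : ℂ // ‖v‖ = 1} := ⟨⟨1, by simp⟩⟩
  congr 1
  · obtain ⟨v, u, hv, hu, h1, h2⟩ := exists_align (dz Φ z) (dzb Φ z)
    have h : ‖dz Φ z * v + dzb Φ z * conj v‖ = ‖dz Φ z‖ + ‖dzb Φ z‖ := by
      rw [h1, h2, ← add_mul, norm_mul, hu, mul_one, ← Complex.ofReal_add, Complex.norm_real,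
        Real.norm_of_nonneg (by positivity)]
    refine le_antisymm (ciSup_le fun v => norm_add_conj_le _ _ _ v.2) ?_
    rw [← h]
    exact le_ciSup (f := fun v : {v : ℂ // ‖v‖ = 1} => ‖dz Φ z * (v : ℂ) + dzb Φ z * conj (v : ℂ)‖)
      ⟨_, by rintro _ ⟨w, rfl⟩; exact norm_add_conj_le _ _ _ w.2⟩ ⟨v, hv⟩
  · obtain ⟨v, u, hv, hu, h1, h2⟩ := exists_align (dz Φ z) (-dzb Φ z)
    have h : ‖dz Φ z * v + dzb Φ z * conj v‖ = |‖dz Φ z‖ - ‖dzb Φ z‖| := by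
      rw [← sub_neg_eq_add, ← neg_mul, h1, h2, ← sub_mul, norm_mul, hu, mul_one, norm_neg,
        ← Complex.ofReal_sub, Complex.norm_real, Real.norm_eq_abs]
    refine le_antisymm ?_ (le_ciInf fun v => le_norm_add_conj _ _ _ v.2)
    rw [← h]
    exact ciInf_le (f := fun v : {v : ℂ // ‖v‖ = 1} => ‖dz Φ z * (v : ℂ) + dzb Φ z * conj (v : ℂ)‖)
      ⟨_, by rintro _ ⟨w, rfl⟩; exact le_norm_add_conj _ _ _ w.2⟩ ⟨v, hv⟩

end

section

lemma OrientedData.dilatationAt_eq {Φ : ℂ → ℂ} {b : ℂ → (ℂ →L[ℝ] ℂ)} {z : ℂ} (h : OrientedData Φ b)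
    (hz : z ∈ Hset) : dilatationAt Φ z =
      ((1 + ‖halfBeltrami Φ z‖) / (1 - ‖halfBeltrami Φ z‖)) ^ 2 := by
  rw [AdSPaper.dilatationAt_eq]
  have h1 := h.ratio_pos hz
  have h2 := h.norm_dz_pos hz
  have h3 := h.norm_halfBeltrami_eq hz
  have h4 := h.normSq_halfBeltrami_eq hz
  have h5 := h.norm_halfBeltrami_lt hz
  have h6 := norm_nonneg (halfBeltrami Φ z)
  rw [Complex.normSq_eq_norm_sq] at h4
  generalize ‖halfBeltrami Φ z‖ = l at *
  generalize ((Φ z).im / z.im : ℝ) = R at *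
  generalize ‖dz Φ z‖ = ρ at *
  generalize ‖dzb Φ z‖ = β at *
  have hl : 0 < 1 - l := by linarith
  rw [eq_div_iff (by positivity)] at h3 h4
  have hs : 0 < R + ρ := by positivity
  have e1 : ρ + β = (R + ρ) * (1 + l) ^ 2 / 2 := by
    rw [← h3]; linear_combination -(1 / 2 : ℝ) * h4
  have e2 : ρ - β = (R + ρ) * (1 - l) ^ 2 / 2 := by
    rw [← h3]; linear_combination -(1 / 2 : ℝ) * h4
  rw [e1, e2, abs_of_pos (by positivity)]
  field_simp

/-- The reflection `z ↦ -z̄`. -/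
def mirror (z : ℂ) : ℂ := -conj z

lemma fderiv_mirror_comp {Φ : ℂ → ℂ} {z : ℂ} (h : DifferentiableAt ℝ Φ z) (v : ℂ) :
    fderiv ℝ (fun w => mirror (Φ w)) z v = mirror (fderiv ℝ Φ z v) := by
  have h1 := (((Complex.conjCLE : ℂ →L[ℝ] ℂ).hasFDerivAt).comp z h.hasFDerivAt).neg
  have : HasFDerivAt (fun w => mirror (Φ w)) _ z := h1
  rw [this.fderiv]
  simp [mirror]

lemma dz_mirror_comp {Φ : ℂ → ℂ} {z : ℂ} (h : DifferentiableAt ℝ Φ z) :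
    dz (fun w => mirror (Φ w)) z = mirror (dzb Φ z) := by
  unfold dz dzb
  rw [fderiv_mirror_comp h, fderiv_mirror_comp h]
  simp only [mirror, map_div₀, map_ofNat, map_sub, map_add, map_mul, map_neg, Complex.conj_I]
  ring

lemma dzb_mirror_comp {Φ : ℂ → ℂ} {z : ℂ} (h : DifferentiableAt ℝ Φ z) :
    dzb (fun w => mirror (Φ w)) z = mirror (dz Φ z) := by
  unfold dz dzb
  rw [fderiv_mirror_comp h, fderiv_mirror_comp h]
  simp only [mirror, map_div₀, map_ofNat, map_sub, map_add, map_mul, map_neg, Complex.conj_I]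
  ring

lemma norm_mirror (z : ℂ) : ‖mirror z‖ = ‖z‖ := by simp [mirror]

lemma normSq_mirror (z : ℂ) : Complex.normSq (mirror z) = Complex.normSq z := by simp [mirror]

lemma im_mirror (z : ℂ) : (mirror z).im = z.im := by simp [mirror]

lemma dilatationAt_mirror_comp {Φ : ℂ → ℂ} {z : ℂ} (h : DifferentiableAt ℝ Φ z) :
    dilatationAt (fun w => mirror (Φ w)) z = dilatationAt Φ z := by
  rw [dilatationAt_eq, dilatationAt_eq, dz_mirror_comp h, dzb_mirror_comp h, norm_mirror, norm_mirror,
    add_comm, abs_sub_comm]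

/-- Up to a reflection, a minimal Lagrangian map preserves the orientation. -/
lemma IsMinimalLagrangian.oriented {Φ : ℂ → ℂ} (h : IsMinimalLagrangian Φ) :
    ∃ b, OrientedData Φ b ∨ OrientedData (fun z => mirror (Φ z)) b := by
  obtain ⟨hs, hb, -, b, h1, h2, h3, h4⟩ := h
  have hne : ∀ z ∈ Hset, Complex.normSq (dz Φ z) - Complex.normSq (dzb Φ z) ≠ 0 := by
    intro z hz h0
    have hy : 0 < z.im := hz
    have hη : 0 < (Φ z).im := hb.1 hz
    obtain ⟨m1, m2⟩ := coef_metric hy hη (h1 z hz) (h3 z hz)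
    have m3 := coef_det (h1 z hz) (h2 z hz)
    have m4 := congrArg Complex.normSq m2
    simp only [Complex.normSq_mul, Complex.normSq_conj, Complex.normSq_ofReal] at m4
    generalize Complex.normSq (dz Φ z) = A at *
    generalize Complex.normSq (dzb Φ z) = B at *
    generalize coefC (b z) = c at *
    generalize Complex.normSq (coefS (b z)) = s at *
    have hr : 0 < ((Φ z).im / z.im) ^ 2 := by positivity
    generalize ((Φ z).im / z.im) ^ 2 = r at *
    have h5 : (A - B) ^ 2 = r ^ 2 := by
      have e1 : (A - B) ^ 2 = (A + B) ^ 2 - 4 * (A * B) := by ring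
      have e2 : r ^ 2 = r ^ 2 * (c ^ 2 - s) ^ 2 := by rw [m3]; ring
      rw [e1, m1, m4, e2]
      ring
    rw [h0] at h5
    nlinarith
  have hsm : ∀ z ∈ Hset, ContDiffAt ℝ (⊤ : ℕ∞) Φ z := fun z hz =>
    hs.contDiffAt (isOpen_Hset.mem_nhds hz)
  have hcont : ContinuousOn (fun z => Complex.normSq (dz Φ z) - Complex.normSq (dzb Φ z)) Hset := by
    intro z hz
    have c1 : ContinuousAt (dz Φ) z := (contDiffAt_dz (n := (⊤ : ℕ∞)) (hsm z hz)).continuousAt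
    have c2 : ContinuousAt (dzb Φ) z := (contDiffAt_dzb (n := (⊤ : ℕ∞)) (hsm z hz)).continuousAt
    exact ((Complex.continuous_normSq.continuousAt.comp c1).sub
      (Complex.continuous_normSq.continuousAt.comp c2)).continuousWithinAt
  have hdiff : ∀ z ∈ Hset, DifferentiableAt ℝ Φ z := fun z hz => (hsm z hz).differentiableAt (by simp)
  have hpre : IsPreconnected Hset := (convex_halfSpace_im_gt 0).isPreconnected
  refine ⟨b, ?_⟩
  by_cases hpos : ∀ z ∈ Hset, Complex.normSq (dzb Φ z) < Complex.normSq (dz Φ z)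
  · exact Or.inl ⟨hs, hb.1, h1, h2, h3, h4, hpos⟩
  right
  push Not at hpos
  obtain ⟨z₀, hz₀, hle⟩ := hpos
  have hneg : ∀ z ∈ Hset, Complex.normSq (dz Φ z) < Complex.normSq (dzb Φ z) := by
    intro z hz
    by_contra! hcon
    obtain ⟨w, hw, hw0⟩ := hpre.intermediate_value hz₀ hz hcont
      (show (0 : ℝ) ∈ Icc _ _ from ⟨by linarith, by linarith⟩)
    exact hne w hw hw0
  refine ⟨?_, ?_, h1, h2, ?_, h4, ?_⟩
  · exact (Complex.conjCLE.contDiff.comp_contDiffOn hs).neg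
  · intro z hz
    have : 0 < (Φ z).im := hb.1 hz
    show 0 < (mirror (Φ z)).im
    rwa [im_mirror]
  · intro z hz v w
    rw [← h3 z hz v w, fderiv_mirror_comp (hdiff z hz), fderiv_mirror_comp (hdiff z hz), im_mirror]
    congr 1
    simp [mirror, rinner]
  · intro z hz
    rw [dz_mirror_comp (hdiff z hz), dzb_mirror_comp (hdiff z hz), normSq_mirror, normSq_mirror]
    exact hneg z hz

lemma mirror_rep_ne (ξ : RP1) : ![-ξ.rep 0, ξ.rep 1] ≠ 0 := by
  intro h
  apply ξ.rep_nonzero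
  ext i
  fin_cases i
  · simpa using congrFun h 0
  · simpa using congrFun h 1

/-- The reflection of the projective line. -/
def mirrorRP (ξ : RP1) : RP1 := Projectivization.mk ℝ ![-ξ.rep 0, ξ.rep 1] (mirror_rep_ne ξ)

lemma mirrorRP_rep (ξ : RP1) : ∃ c : ℝ, c ≠ 0 ∧ (mirrorRP ξ).rep 0 = -(c * ξ.rep 0) ∧
    (mirrorRP ξ).rep 1 = c * ξ.rep 1 := by
  obtain ⟨c, hc⟩ := Projectivization.exists_smul_eq_mk_rep ℝ ![-ξ.rep 0, ξ.rep 1] (mirror_rep_ne ξ)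
  refine ⟨c, c.ne_zero, ?_, ?_⟩
  · have := congrFun hc 0
    rw [mirrorRP, ← this]
    simp [Units.smul_def]
  · have := congrFun hc 1
    rw [mirrorRP, ← this]
    simp [Units.smul_def]

lemma mirrorRP_injective : Function.Injective mirrorRP := by
  intro ξ ξ' h
  by_contra hne
  obtain ⟨c, hc, h0, h1⟩ := mirrorRP_rep ξ
  obtain ⟨c', hc', h0', h1'⟩ := mirrorRP_rep ξ'
  rw [← h] at h0' h1'
  apply mul_ne_zero (mul_ne_zero hc hc') (det2_rep_ne hne)
  unfold det2
  linear_combination (c' * ξ'.rep 1) * h0 + (mirrorRP ξ).rep 0 * h1' + (c' * ξ'.rep 0) * h1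
    - (mirrorRP ξ).rep 1 * h0'

lemma rp1ToSphere_mirrorRP (ξ : RP1) : rp1ToSphere (mirrorRP ξ) = OnePoint.map mirror (rp1ToSphere ξ) := by
  obtain ⟨c, hc, h0, h1⟩ := mirrorRP_rep ξ
  unfold rp1ToSphere
  rw [h0, h1]
  by_cases h : ξ.rep 1 = 0
  · simp [h]
  · rw [if_neg h, if_neg (mul_ne_zero hc h)]
    rw [OnePoint.map_some]
    congr 1
    simp only [mirror, Complex.conj_ofReal]
    rw [neg_div, mul_div_mul_left _ _ hc]
    push_cast
    rfl

lemma tripleOrient_mirrorRP (ξ₁ ξ₂ ξ₃ : RP1) : ∃ c : ℝ, 0 < c ∧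
    tripleOrient (mirrorRP ξ₁) (mirrorRP ξ₂) (mirrorRP ξ₃) = -(c * tripleOrient ξ₁ ξ₂ ξ₃) := by
  obtain ⟨c, hc, h0, h1⟩ := mirrorRP_rep ξ₁
  obtain ⟨c', hc', h0', h1'⟩ := mirrorRP_rep ξ₂
  obtain ⟨c'', hc'', h0'', h1''⟩ := mirrorRP_rep ξ₃
  refine ⟨(c * c' * c'') ^ 2, by positivity, ?_⟩
  unfold tripleOrient det2
  rw [h0, h1, h0', h1', h0'', h1'']
  ring

lemma continuous_map_mirror : Continuous (OnePoint.map mirror : OnePoint ℂ → OnePoint ℂ) := by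
  have : mirror = ((Complex.conjCLE : ℂ ≃L[ℝ] ℂ).toHomeomorph.trans (Homeomorph.neg ℂ)) := rfl
  refine OnePoint.continuous_map (by rw [this]; exact Homeomorph.continuous _) ?_
  rw [coclosedCompact_eq_cocompact, this]
  exact (Homeomorph.isClosedEmbedding _).tendsto_cocompact

lemma ExtendsToBoundary.mirror_comp {Φ : ℂ → ℂ} {φ : RP1 → RP1} (h : ExtendsToBoundary Φ φ) :
    ExtendsToBoundary (fun z => mirror (Φ z)) (fun ξ => mirrorRP (φ ξ)) := by
  intro ξ
  have := (continuous_map_mirror.tendsto _).comp (h ξ)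
  rw [rp1ToSphere_mirrorRP]
  exact this

/-- A frame with boundary values bounded away from degeneration, from a bound on dilatations. -/
lemma OrientedData.ext {Φ : ℂ → ℂ} {b : ℂ → (ℂ →L[ℝ] ℂ)} (h : OrientedData Φ b) {φ : RP1 → RP1}
    (hφ : Function.Injective φ) (hext : ExtendsToBoundary Φ φ) {K : ℝ}
    (hK : ∀ z ∈ Hset, dilatationAt Φ z ≤ K) : ∃ ℓ, h.toSurf.Ext φ ℓ := by
  set K' := max K 1 with hK'
  have h1 : 1 ≤ K' := le_max_right _ _
  refine ⟨(K' - 1) / (K' + 1), ?_, ?_, hφ, hext⟩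
  · rw [div_lt_one (by linarith)]
    linarith
  · intro z hz
    have h2 := (hK z hz).trans (le_max_left K 1)
    rw [h.dilatationAt_eq hz, ← hK'] at h2
    have h5 := h.norm_halfBeltrami_lt hz
    have h6 := norm_nonneg (halfBeltrami Φ z)
    show ‖halfBeltrami Φ z‖ ≤ _
    generalize ‖halfBeltrami Φ z‖ = l at *
    have hl : 0 < 1 - l := by linarith
    have h7 : (1 + l) / (1 - l) ≤ K' := by
      by_contra! h8
      nlinarith
    rw [div_le_iff₀ hl] at h7
    rw [le_div_iff₀ (by linarith)]
    linarith

lemma IsMinimalLagrangianExtension.oriented {Φ : ℂ → ℂ} {φ : RP1 → RP1}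
    (h : IsMinimalLagrangianExtension Φ φ) (hφ : Function.Injective φ) (ho : OrientationPreserving φ)
    {K : ℝ} (hK : ∀ z ∈ Hset, dilatationAt Φ z ≤ K) :
    ∃ b, ∃ hb : OrientedData Φ b, ∃ ℓ, hb.toSurf.Ext φ ℓ := by
  obtain ⟨b, hb | hb⟩ := h.1.oriented
  · exact ⟨b, hb, hb.ext hφ h.2 hK⟩
  exfalso
  have hdiff : ∀ z ∈ Hset, DifferentiableAt ℝ Φ z := fun z hz =>
    (h.1.1.contDiffAt (isOpen_Hset.mem_nhds hz)).differentiableAt (by simp)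
  obtain ⟨ℓ, E⟩ := hb.ext (mirrorRP_injective.comp hφ) h.2.mirror_comp (K := K) (fun z hz => by
    rw [dilatationAt_mirror_comp (hdiff z hz)]
    exact hK z hz)
  have := infinite_RP1
  obtain ⟨f⟩ : Nonempty (ℕ ↪ RP1) := ⟨Infinite.natEmbedding RP1⟩
  have hne : ∀ i j : ℕ, i ≠ j → f i ≠ f j := fun i j hij h => hij (f.injective h)
  have h1 := E.tripleOrient_pos (hne 0 1 (by simp)) (hne 1 2 (by simp)) (hne 2 0 (by simp))
  obtain ⟨c, hc, h2⟩ := tripleOrient_mirrorRP (φ (f 0)) (φ (f 1)) (φ (f 2))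
  simp only [Function.comp_apply] at h1
  rw [h2] at h1
  have swap : ∀ x y w : RP1, tripleOrient y x w = -tripleOrient x y w := by
    intro x y w
    unfold tripleOrient det2
    ring
  have h3 := ho (f 0) (f 1) (f 2)
  have h4 := ho (f 1) (f 0) (f 2)
  rw [swap (f 0), swap (φ (f 0))] at h4
  generalize tripleOrient (f 0) (f 1) (f 2) = X at *
  generalize tripleOrient (φ (f 0)) (φ (f 1)) (φ (f 2)) = Y at *
  rcases lt_trichotomy X 0 with hX | hX | hX
  · have hY := h4 (by linarith)
    have : 0 < X * Y := mul_pos_of_neg_of_neg hX (by linarith)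
    nlinarith
  · rw [hX] at h1
    simp at h1
  · have hY := h3 hX
    have : 0 < X * Y := mul_pos hX hY
    nlinarith

end

section

lemma crNorm_nonneg (φ : RP1 → RP1) : 0 ≤ crNorm φ := by
  apply Real.sSup_nonneg
  rintro r ⟨z₁, z₂, z₃, z₄, -, rfl⟩
  exact abs_nonneg _

lemma abs_crossRatio_le_exp {φ : RP1 → RP1} (hb : BddAbove (crSet φ)) {m : ℝ} (hm : crNorm φ ≤ m)
    (z₁ z₂ z₃ z₄ : RP1) (h : crossRatio z₁ z₂ z₃ z₄ = -1) :
    |crossRatio (φ z₁) (φ z₂) (φ z₃) (φ z₄)| ≤ Real.exp m := by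
  have h1 := (le_csSup hb (show _ ∈ crSet φ from ⟨z₁, z₂, z₃, z₄, h, rfl⟩)).trans hm
  rcases (abs_nonneg (crossRatio (φ z₁) (φ z₂) (φ z₃) (φ z₄))).eq_or_lt with h2 | h2
  · rw [← h2]
    exact (Real.exp_pos m).le
  · rw [← Real.log_le_iff_le_exp h2]
    exact (le_abs_self _).trans h1

/-- The dilatation bound when the cross-ratio norm is small. -/
lemma sq_ratio_le_of_small {m l : ℝ} (hm : 0 < m) (hm' : m ≤ 1 / 480) (hl : 0 ≤ l)
    (h : l ^ 2 * (1 / (20 * m)) ^ 2 ≤ 126) : ((1 + l) / (1 - l)) ^ 2 ≤ Real.exp (1920 * m) := by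
  have h1 : l ≤ 240 * m := by
    rw [← mul_pow, mul_one_div, div_pow, div_le_iff₀ (by positivity)] at h
    nlinarith
  have h2 : (1 + l) / (1 - l) ≤ Real.exp (4 * l) := by
    refine le_trans ?_ (Real.add_one_le_exp _)
    rw [div_le_iff₀ (by linarith)]
    nlinarith
  calc ((1 + l) / (1 - l)) ^ 2 ≤ Real.exp (4 * l) ^ 2 := by
        gcongr
        exact div_nonneg (by linarith) (by linarith)
    _ = Real.exp (8 * l) := by rw [← Real.exp_nat_mul]; push_cast; ring_nf
    _ ≤ _ := Real.exp_le_exp.mpr (by linarith)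

lemma small_parameter_lt {m : ℝ} (hm : 0 < m) (hm' : m ≤ 1 / 480) :
    18 * ((Real.exp m - 1) / (Real.exp m + 1)) * (1 / (20 * m)) < 1 := by
  have h1 : Real.exp m - 1 ≤ 2 * m := by
    have := (abs_le.mp (Real.abs_exp_sub_one_sub_id_le (x := m) (by rw [abs_of_pos hm]; linarith))).2
    nlinarith
  have h2 : (Real.exp m - 1) / (Real.exp m + 1) ≤ m := by
    have := Real.add_one_le_exp m
    rw [div_le_iff₀ (by linarith)]
    nlinarith
  calc _ ≤ 18 * m * (1 / (20 * m)) := by gcongr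
    _ = 18 / 20 := by field_simp
    _ < 1 := by norm_num

lemma eight_le_exp_three : (8 : ℝ) ≤ Real.exp 3 := by
  have := Real.exp_one_gt_d9
  have h : Real.exp 3 = Real.exp 1 ^ 3 := by rw [← Real.exp_nat_mul]; norm_num
  rw [h]
  calc (8 : ℝ) = 2 ^ 3 := by norm_num
      _ ≤ _ := by gcongr; linarith

lemma exp_neg_le_inv_sqrt {m : ℝ} (hm : 0 < m) :
    Real.exp (-(3 + m / 2)) ≤ 1 / (4 * √(1 + Real.exp m)) := by
  have h8 := eight_le_exp_three
  have h1 : √(1 + Real.exp m) ≤ 2 * Real.exp (m / 2) := by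
    apply Real.sqrt_le_iff.mpr ⟨by positivity, ?_⟩
    rw [mul_pow, ← Real.exp_nat_mul]
    have : ((2 : ℕ) : ℝ) * (m / 2) = m := by push_cast; ring
    rw [this]
    have := Real.add_one_le_exp m
    linarith
  rw [Real.exp_neg, one_div]
  apply inv_anti₀ (by positivity)
  rw [Real.exp_add]
  have := Real.exp_pos (m / 2)
  nlinarith

/-- The dilatation bound when the cross-ratio norm is bounded away from zero. -/
lemma sq_ratio_le_of_large {m l : ℝ} (N : ℕ) (hm : 1 / 480 ≤ m) (hl : 0 ≤ l) (hl1 : l < 1)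
    (h : 0 < l → (1 / (4 * √(1 + Real.exp m))) ^ N ≤ 4000 * Real.exp 12 * (-Real.log (l ^ 2))) :
    ((1 + l) / (1 - l)) ^ 2 ≤ Real.exp ((480 * (48 + 6 * N) + N) * m) := by
  have hm0 : 0 < m := by linarith
  have hl' : 0 < 1 - l := by linarith
  rcases hl.eq_or_lt with h0 | h0
  · rw [← h0]
    simp only [add_zero, sub_zero, div_one, one_pow]
    exact Real.one_le_exp (by positivity)
  set A : ℝ := 21 + 3 * N + N * m / 2 with hA
  have hA0 : 0 ≤ A := by positivity
  have h4000 : (4000 : ℝ) ≤ Real.exp 9 := by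
    have := Real.exp_one_gt_d9
    have h : Real.exp 9 = Real.exp 1 ^ 9 := by rw [← Real.exp_nat_mul]; norm_num
    rw [h]
    calc (4000 : ℝ) ≤ 2.7 ^ 9 := by norm_num
      _ ≤ _ := by gcongr; linarith
  have hlog : 0 ≤ -Real.log (l ^ 2) := by
    have := Real.log_nonpos (sq_nonneg l) (by nlinarith)
    linarith
  have hq : Real.exp (-A) ≤ -Real.log (l ^ 2) := by
    have e1 : Real.exp (-(3 + m / 2)) ^ N ≤ (1 / (4 * √(1 + Real.exp m))) ^ N :=
      pow_le_pow_left₀ (Real.exp_pos _).le (exp_neg_le_inv_sqrt hm0) N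
    rw [← Real.exp_nat_mul] at e1
    have e2 : 4000 * Real.exp 12 * (-Real.log (l ^ 2)) ≤ Real.exp 21 * (-Real.log (l ^ 2)) := by
      have : Real.exp 21 = Real.exp 9 * Real.exp 12 := by rw [← Real.exp_add]; norm_num
      rw [this]
      gcongr
    have e3 := e1.trans ((h h0).trans e2)
    have e4 : -A = (N : ℝ) * (-(3 + m / 2)) - 21 := by rw [hA]; ring
    rw [e4, Real.exp_sub, div_le_iff₀ (Real.exp_pos _)]
    linarith
  have hq1 : Real.exp (-A) ≤ 1 := Real.exp_le_one_iff.mpr (by linarith)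
  have hq0 := Real.exp_pos (-A)
  have hexp : Real.exp (-A) * Real.exp A = 1 := by rw [← Real.exp_add]; simp
  have hAp := Real.exp_pos A
  generalize Real.exp (-A) = q at *
  have ha : l ^ 2 * (1 + q) ≤ 1 := by
    have e1 : Real.log (l ^ 2) ≤ -q := by linarith
    rw [Real.log_le_iff_le_exp (by positivity)] at e1
    have e2 := Real.add_one_le_exp q
    calc l ^ 2 * (1 + q) ≤ Real.exp (-q) * Real.exp q := by
          apply mul_le_mul e1 (by linarith) (by linarith) (Real.exp_pos _).le
      _ = 1 := by rw [← Real.exp_add]; simp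
  have hql : q ≤ 4 * (1 - l) := by
    have e1 : 0 ≤ 1 - l ^ 2 := by nlinarith
    have e2 : q ≤ 2 * (1 - l ^ 2) := by nlinarith
    nlinarith
  have hr : (1 + l) / (1 - l) ≤ Real.exp (3 + A) := by
    have h8 := eight_le_exp_three
    rw [div_le_iff₀ hl', Real.exp_add]
    have e1 : 1 ≤ 4 * (1 - l) * Real.exp A := by
      calc (1 : ℝ) = q * Real.exp A := hexp.symm
        _ ≤ _ := by gcongr
    calc 1 + l ≤ 2 := by linarith
      _ ≤ 8 * (Real.exp A * (1 - l)) := by nlinarith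
      _ ≤ Real.exp 3 * (Real.exp A * (1 - l)) := by gcongr
      _ = _ := by ring
  calc ((1 + l) / (1 - l)) ^ 2 ≤ Real.exp (3 + A) ^ 2 := by
        apply pow_le_pow_left₀ (by positivity) hr
    _ = Real.exp (48 + 6 * N + N * m) := by
        rw [← Real.exp_nat_mul, hA]; push_cast; ring_nf
    _ ≤ _ := by
        apply Real.exp_le_exp.mpr
        have : 0 ≤ (48 + 6 * (N : ℝ)) * (480 * m - 1) := mul_nonneg (by positivity) (by linarith)
        nlinarith

lemma OrientedData.dilatationAt_le_exp {Φ : ℂ → ℂ} {b : ℂ → (ℂ →L[ℝ] ℂ)} (h : OrientedData Φ b)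
    {φ : RP1 → RP1} {ℓ : ℝ} (E : h.toSurf.Ext φ ℓ) (hb : BddAbove (crSet φ)) {m : ℝ} (hm0 : 0 < m)
    (hm : crNorm φ ≤ m) {z : ℂ} (hz : z ∈ Hset) {N : ℕ} (hN : N = 6000) :
    dilatationAt Φ z ≤ Real.exp ((480 * (48 + 6 * N) + N) * m) := by
  have hM := abs_crossRatio_le_exp hb hm
  have hM1 : 1 ≤ Real.exp m := Real.one_le_exp hm0.le
  have ha : h.toSurf.a z = ‖halfBeltrami Φ z‖ ^ 2 := Complex.normSq_eq_norm_sq _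
  have hl0 := norm_nonneg (halfBeltrami Φ z)
  have hl1 := h.norm_halfBeltrami_lt hz
  rw [h.dilatationAt_eq hz]
  rcases le_total m (1 / 480) with hc | hc
  · have hK : 1 ≤ 1 / (20 * m) := by
      rw [le_div_iff₀ (by positivity)]
      linarith
    have h1 := E.dual_a_le hM hM1 hz hK (small_parameter_lt hm0 hc)
    rw [ha] at h1
    refine (sq_ratio_le_of_small hm0 hc hl0 h1).trans (Real.exp_le_exp.mpr ?_)
    have : (0 : ℝ) ≤ N := N.cast_nonneg
    gcongr
    linarith
  · apply sq_ratio_le_of_large N hc hl0 hl1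
    intro hl
    have h1 := E.neg_log_a_ge hM hM1 hz (by rw [ha]; positivity)
    rw [ha, ← hN] at h1
    exact h1

end

end

/-- **Corollary G.** There exists a universal constant `C > 0` such that, for any
quasisymmetric homeomorphism `φ` of `ℝP¹`, the minimal Lagrangian extension
`Φ_ML : ℍ² → ℍ²` of `φ` has maximal dilatation bounded by `ln K(Φ_ML) ≤ C·‖φ‖_cr`. -/
theorem log_maxDilatation_le_crNorm :
    ∃ C : ℝ, 0 < C ∧
      ∀ φ : RP1 ≃ₜ RP1, Quasisymmetric φ →
        ∀ Φ : ℂ → ℂ, IsMinimalLagrangianExtension Φ ⇑φ →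
          Real.log (maxDilatation Φ) ≤ C * crNorm ⇑φ := by
  obtain ⟨N, hN⟩ : ∃ N : ℕ, N = 6000 := ⟨_, rfl⟩
  have hC : (0 : ℝ) < 480 * (48 + 6 * N) + N := by positivity
  refine ⟨480 * (48 + 6 * N) + N, hC, fun φ hφ Φ hΦ => ?_⟩
  have hcr := crNorm_nonneg φ
  by_cases hbdd : BddAbove (Set.range fun z : Hset => dilatationAt Φ z)
  · obtain ⟨K, hK⟩ := hbdd
    obtain ⟨b, hb, ℓ, E⟩ := hΦ.oriented φ.injective hφ.1 (K := K)
      (fun z hz => hK ⟨⟨z, hz⟩, rfl⟩)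
    have key : ∀ m, crNorm φ < m → Real.log (maxDilatation Φ) / (480 * (48 + 6 * N) + N) ≤ m := by
      intro m hm
      have : Nonempty Hset := ⟨⟨Complex.I, by simp [Hset]⟩⟩
      have h1 : maxDilatation Φ ≤ Real.exp ((480 * (48 + 6 * N) + N) * m) :=
        ciSup_le fun z => hb.dilatationAt_le_exp E hφ.2 (hcr.trans_lt hm) hm.le z.2 hN
      rw [div_le_iff₀ hC, mul_comm m]
      have h0 : 0 ≤ maxDilatation Φ := Real.iSup_nonneg fun z => by
        rw [hb.dilatationAt_eq z.2]
        positivity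
      rcases h0.eq_or_lt with h2 | h2
      · rw [← h2, Real.log_zero]
        have := hcr.trans_lt hm
        positivity
      · exact (Real.log_le_iff_le_exp h2).mpr h1
    have := le_of_forall_gt_imp_ge_of_dense key
    rw [div_le_iff₀ hC] at this
    linarith
  · rw [maxDilatation, Real.iSup_of_not_bddAbove hbdd, Real.log_zero]
    positivity

end AdSPaper
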